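/- arXiv:2007.05383 — 2 statements merged into one kernel-verified Lean document; each statement's English description precedes it below -/
import Mathlib

section
/- Let K be a number field and G a finite group containing a subgroup which is abelian but not cyclic (equivalently, a subgroup isomorphic to (ℤ/pℤ) × (ℤ/pℤ) for some prime p). Let E₁/F₁, …, E_r/F_r be finitely many finite Galois field extensions such that each Galois group Gal(E_i/F_i) is isomorphic to G and each F_i is a finitely generated field extension of K of transcendence degree 1 over K. Then there exist a prime v of K and a finite abelian Galois field extension L of the completion K_v whose Galois group is noncyclic and isomorphic to a subgroup of G, such that for no i ∈ {1,…,r} is L a specialization of E_i/F_i over K_v. In particular, the local dimension of G over K is at least 2. -/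
open scoped TensorProduct
open IsDedekindDomain NumberField

set_option synthInstance.maxHeartbeats 1000000
set_option maxHeartbeats 2000000

/-- `M/Ω` is a specialization of the finite Galois field extension `E/F` over `Ω`. -/
def IsSpecialization (K F E Ω M : Type) [Field K] [Field F] [Field E] [Field Ω] [Field M]
    [Algebra K F] [Algebra F E] [Algebra K Ω] [Algebra Ω M] : Prop :=
  ∃ A : Subalgebra K F, A.FG ∧ (∀ x : F, IsIntegral A x → x ∈ A) ∧ IsFractionRing A F ∧
    ∃ ψ : A →ₐ[K] Ω,
      letI : Algebra A E := ((algebraMap F E).comp (algebraMap A F)).toAlgebra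
      letI : Algebra A Ω := ψ.toRingHom.toAlgebra
      IsReduced (Ω ⊗[A] (integralClosure A E)) ∧
      ∃ m : Ideal (Ω ⊗[A] (integralClosure A E)), m.IsMaximal ∧
        Nonempty (((Ω ⊗[A] (integralClosure A E)) ⧸ m) ≃ₐ[Ω] M)

open Polynomial in
/-- Any two elements of `R` are algebraically dependent over `K`. -/
def PairwiseDependent (K R : Type) [Field K] [CommRing R] [Algebra K R] : Prop :=
  ∀ y x : R, ∃ g : K[X][X], g ≠ 0 ∧ g.eval₂ (aeval y : K[X] →ₐ[K] R).toRingHom x = 0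

section Transcendence

open Polynomial
open scoped IntermediateField.algebraAdjoinAdjoin

variable {K : Type} [Field K]

theorem PairwiseDependent.of_injective {R S : Type} [CommRing R] [CommRing S] [Algebra K R]
    [Algebra K S] (h : PairwiseDependent K S) (f : R →ₐ[K] S) (hf : Function.Injective f) :
    PairwiseDependent K R := by
  intro y x
  obtain ⟨g, hg, h0⟩ := h (f y) (f x)
  refine ⟨g, hg, hf ?_⟩
  rw [map_zero, ← h0]
  change f.toRingHom _ = _
  rw [hom_eval₂]
  congr 1
  ext <;> simp

theorem PairwiseDependent.of_transcendental {F E : Type} [Field F] [Field E] [Algebra K F]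
    [Algebra F E] [Algebra K E] [IsScalarTower K F E] [Algebra.IsAlgebraic F E]
    (htr : ∃ x : F, Transcendental K x ∧
      Algebra.IsAlgebraic (IntermediateField.adjoin K {x}) F) : PairwiseDependent K E := by
  obtain ⟨x₀, -, halg⟩ := htr
  have h2 : Algebra.trdeg K F ≤ 1 := by
    have : Algebra.IsAlgebraic (Algebra.adjoin K {x₀}) F :=
      (IsFractionRing.comap_isAlgebraic_iff (K := IntermediateField.adjoin K {x₀})).mpr halg
    simpa using Algebra.IsAlgebraic.trdeg_le_cardinalMk K (A := F) {x₀}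
  have h3 : Algebra.trdeg K E ≤ 1 := by
    rw [← trdeg_add_eq K F (A := E), trdeg_eq_zero_iff (R := F).2 inferInstance, add_zero]
    exact h2
  intro y x
  by_cases hy : IsAlgebraic K y
  · refine ⟨C (minpoly K y), ?_, ?_⟩
    · simpa using minpoly.ne_zero hy.isIntegral
    · simp
  · have hy' : AlgebraicIndependent K (fun _ : Unit => y) :=
      algebraicIndependent_unique_type_iff.mpr hy
    have hb := hy'.isTranscendenceBasis_of_trdeg_le_of_finite (by simpa using h3)
    obtain ⟨p, hp, hp0⟩ := hb.isAlgebraic.isAlgebraic x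
    let S := Algebra.adjoin K (Set.range (fun _ : Unit => y))
    have hyS : y ∈ S := Algebra.subset_adjoin ⟨(), rfl⟩
    have hsurj : Function.Surjective (aeval (⟨y, hyS⟩ : S) : K[X] →ₐ[K] S) := by
      intro c
      obtain ⟨c, hc⟩ := c
      have hc' : c ∈ Algebra.adjoin K (Set.range (fun _ : Unit => y)) := hc
      rw [Set.range_const, Algebra.adjoin_singleton_eq_range_aeval] at hc'
      obtain ⟨q, hq⟩ := hc'
      refine ⟨q, Subtype.ext ?_⟩
      exact (aeval_algHom_apply S.val (⟨y, hyS⟩ : S) q).symm.trans hq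
    obtain ⟨g, hg⟩ := map_surjective (aeval (⟨y, hyS⟩ : S) : K[X] →ₐ[K] S).toRingHom hsurj p
    refine ⟨g, fun h => hp (by rw [← hg, h, Polynomial.map_zero]), ?_⟩
    rw [← hg, aeval_def, eval₂_map] at hp0
    rw [← hp0]
    congr 1
    ext <;> simp

theorem exists_monic_aeval_mem_of_prime {R : Type} [CommRing R] [IsDomain R] [Algebra K R]
    (h : PairwiseDependent K R) (P : Ideal R) [P.IsPrime] (hP : P ≠ ⊥) (y : R) :
    ∃ f : K[X], f.Monic ∧ aeval y f ∈ P := by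
  by_cases hy : IsAlgebraic K y
  · exact ⟨minpoly K y, minpoly.monic hy.isIntegral, by simp⟩
  obtain ⟨x, hxP, hx⟩ := Submodule.exists_mem_ne_zero_of_ne_bot hP
  obtain ⟨g, hg, h0⟩ := h y x
  obtain ⟨q, hq, hdvd⟩ := exists_eq_pow_rootMultiplicity_mul_and_not_dvd g hg 0
  rw [C_0, sub_zero] at hq hdvd
  rw [hq, eval₂_mul, eval₂_pow, eval₂_X] at h0
  have hq0 : q.eval₂ (aeval y : K[X] →ₐ[K] R).toRingHom x = 0 :=
    (mul_eq_zero.mp h0).resolve_left (pow_ne_zero _ hx)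
  have hc : q.coeff 0 ≠ 0 := fun h => hdvd (X_dvd_iff.mpr h)
  have hmem : aeval y (q.coeff 0) ∈ P := by
    rw [← divX_mul_X_add q, eval₂_add, eval₂_mul, eval₂_X, eval₂_C] at hq0
    have : (aeval y : K[X] →ₐ[K] R).toRingHom (q.coeff 0) =
      -((q.divX.eval₂ (aeval y : K[X] →ₐ[K] R).toRingHom x) * x) := by
      linear_combination hq0
    change (aeval y : K[X] →ₐ[K] R).toRingHom (q.coeff 0) ∈ P
    rw [this]
    exact P.neg_mem (P.mul_mem_left _ hxP)
  refine ⟨q.coeff 0 * C (q.coeff 0).leadingCoeff⁻¹, monic_mul_leadingCoeff_inv hc, ?_⟩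
  rw [map_mul]
  exact P.mul_mem_right _ hmem

end Transcendence

section Limit

open Polynomial Filter

variable {K F E : Type} [Field K] [Field F] [Field E] [Algebra F E] [Algebra K E]

/-- A polynomial with `V`-integral coefficients splits over `K` modulo the maximal ideal of `V`. -/
def SplitsModulo (V : ValuationSubring K) (f : K[X]) : Prop :=
  (∀ n, f.coeff n ∈ V) ∧ ∃ s : Multiset K, (∀ a ∈ s, a ∈ V) ∧
    ∀ n, (f - (s.map fun a => X - C a).prod).coeff n ∈ V.nonunits

/-- A valuation ring `W` of `E` above `V`, together with a group `D` of automorphisms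
preserving `W` that is cyclic as soon as no nontrivial element acts trivially on residues. -/
structure IsUnramifiedDatum (V : ValuationSubring K) (W : ValuationSubring E)
    (D : Subgroup (E ≃ₐ[F] E)) : Prop where
  algebraMap_mem : ∀ c ∈ V, algebraMap K E c ∈ W
  algebraMap_mem_nonunits : ∀ c ∈ V.nonunits, algebraMap K E c ∈ W.nonunits
  map_mem : ∀ σ ∈ D, ∀ x ∈ W, σ x ∈ W
  isCyclic : (∀ σ ∈ D, σ ≠ 1 → ∃ x ∈ W, σ x - x ∈ W ∧ σ x - x ∉ W.nonunits) → IsCyclic D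

namespace ValuationSubring

theorem mem_of_mem_nonunits {W : ValuationSubring E} {x : E} (h : x ∈ W.nonunits) : x ∈ W :=
  W.nonunits_le h

theorem mul_mem_nonunits {W : ValuationSubring E} {x y : E} (hx : x ∈ W) (hy : y ∈ W.nonunits) :
    x * y ∈ W.nonunits := by
  rw [mem_nonunits_iff, map_mul]
  exact (mul_le_of_le_one_left' ((W.valuation_le_one_iff x).mpr hx)).trans_lt hy

theorem one_notMem_nonunits {W : ValuationSubring E} : (1 : E) ∉ W.nonunits := by
  rw [mem_nonunits_iff, map_one]
  exact lt_irrefl _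

theorem map_mem_nonunits {W : ValuationSubring E} {σ : E ≃ₐ[F] E}
    (h : ∀ x, σ x ∈ W → x ∈ W) {x : E} (hx : x ∈ W.nonunits) : σ x ∈ W.nonunits := by
  rw [mem_nonunits_iff_or] at hx ⊢
  refine hx.imp (fun h => by rw [h, map_zero]) (fun hx hW => hx (h _ ?_))
  rwa [map_inv₀]

theorem exists_mem_of_prod_mem_nonunits {W : ValuationSubring E} (s : Multiset E)
    (hs : s.prod ∈ W.nonunits) (hW : ∀ a ∈ s, a ∈ W) : ∃ a ∈ s, a ∈ W.nonunits := by
  induction s using Multiset.induction_on with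
  | empty => exact absurd hs (by simpa using one_notMem_nonunits)
  | cons a s ih =>
    by_cases ha : a ∈ W.nonunits
    · exact ⟨a, Multiset.mem_cons_self _ _, ha⟩
    have h1 : a⁻¹ ∈ W := by
      rw [mem_nonunits_iff_or] at ha
      push Not at ha
      exact ha.2
    have ha0 : a ≠ 0 := by
      rw [mem_nonunits_iff_or] at ha
      push Not at ha
      exact ha.1
    rw [Multiset.prod_cons] at hs
    have := mul_mem_nonunits h1 hs
    rw [inv_mul_cancel_left₀ ha0] at this
    obtain ⟨b, hb, hb'⟩ := ih this fun b hb => hW b (Multiset.mem_cons_of_mem hb)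
    exact ⟨b, Multiset.mem_cons_of_mem hb, hb'⟩

/-- The ultrafilter limit of a family of valuation subrings. -/
def ultralimit {ι : Type} (U : Ultrafilter ι) (W : ι → ValuationSubring E) :
    ValuationSubring E where
  carrier := {x | ∀ᶠ i in U, x ∈ W i}
  mul_mem' hx hy := by filter_upwards [hx, hy] with i h1 h2 using (W i).mul_mem _ _ h1 h2
  one_mem' := .of_forall fun i => one_mem _
  add_mem' hx hy := by filter_upwards [hx, hy] with i h1 h2 using (W i).add_mem _ _ h1 h2
  zero_mem' := .of_forall fun i => zero_mem _
  neg_mem' hx := by filter_upwards [hx] with i h1 using (W i).neg_mem _ h1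
  mem_or_inv_mem' x := Ultrafilter.eventually_or.mp (.of_forall fun i => (W i).mem_or_inv_mem x)

variable {ι : Type} {U : Ultrafilter ι} {W : ι → ValuationSubring E}

theorem mem_ultralimit {x : E} : x ∈ ultralimit U W ↔ ∀ᶠ i in U, x ∈ W i := Iff.rfl

theorem mem_nonunits_ultralimit {x : E} :
    x ∈ (ultralimit U W).nonunits ↔ ∀ᶠ i in U, x ∈ (W i).nonunits := by
  simp_rw [mem_nonunits_iff_or, mem_ultralimit, Ultrafilter.eventually_or,
    Ultrafilter.eventually_not, eventually_const]

end ValuationSubring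

open ValuationSubring

theorem IsUnramifiedDatum.sub_mem_nonunits [Algebra K F] [IsScalarTower K F E]
    {V : ValuationSubring K} {W : ValuationSubring E} {D : Subgroup (E ≃ₐ[F] E)}
    (h : IsUnramifiedDatum V W D) {f : K[X]} (hf : SplitsModulo V f) {y : E} (hy : y ∈ W)
    (hfy : aeval y f ∈ W.nonunits) {σ : E ≃ₐ[F] E} (hσ : σ ∈ D) :
    σ y - y ∈ W.nonunits := by
  obtain ⟨-, s, hs, hfs⟩ := hf
  have h1 : aeval y (f - (s.map fun a => X - C a).prod) ∈ W.nonunits := by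
    rw [aeval_eq_sum_range]
    refine sum_mem fun i _ => ?_
    rw [Algebra.smul_def, mul_comm]
    exact mul_mem_nonunits (pow_mem hy _) (h.algebraMap_mem_nonunits _ (hfs i))
  have h2 : (s.map fun a => y - algebraMap K E a).prod ∈ W.nonunits := by
    have := sub_mem hfy h1
    rw [← map_sub, sub_sub_cancel, map_multiset_prod, Multiset.map_map] at this
    simpa using this
  obtain ⟨b, hb, hbW⟩ := exists_mem_of_prod_mem_nonunits _ h2 (by
    intro a ha
    obtain ⟨c, hc, rfl⟩ := Multiset.mem_map.mp ha
    exact sub_mem hy (h.algebraMap_mem _ (hs c hc)))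
  obtain ⟨a, ha, rfl⟩ := Multiset.mem_map.mp hb
  have h3 : σ (y - algebraMap K E a) ∈ W.nonunits := by
    refine map_mem_nonunits (fun x hx => ?_) hbW
    simpa using h.map_mem σ⁻¹ (inv_mem hσ) _ hx
  rw [map_sub, IsScalarTower.algebraMap_apply K F E, σ.commutes,
    ← IsScalarTower.algebraMap_apply K F E] at h3
  simpa using sub_mem h3 hbW

end Limit

section Tame

open ValuationSubring

variable {F E : Type} [Field F] [Field E] [Algebra F E]

theorem sub_one_mem_nonunits_iff {W : ValuationSubring E} {u : Eˣ} :
    u ∈ W.principalUnitGroup ↔ (u : E) - 1 ∈ W.nonunits := by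
  rw [mem_principalUnitGroup_iff, ValuationSubring.mem_nonunits_iff]

theorem map_div_self_mem {W : ValuationSubring E} {D : Subgroup (E ≃ₐ[F] E)} [Finite D]
    (hD : ∀ σ ∈ D, ∀ x ∈ W, σ x ∈ W) {σ : E ≃ₐ[F] E} (hσ : σ ∈ D) {x : E} (hx : x ≠ 0) :
    σ x / x ∈ W := by
  by_contra hW
  have h1 : x / σ x ∈ W.nonunits := by
    rw [mem_nonunits_iff_or, inv_div]
    exact .inr hW
  have hpow : ∀ n : ℕ, x / (σ ^ (n + 1)) x ∈ W.nonunits := by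
    intro n
    induction n with
    | zero => simpa using h1
    | succ n ih =>
      have h2 : σ (x / (σ ^ (n + 1)) x) ∈ W :=
        hD σ hσ _ (mem_of_mem_nonunits ih)
      have h3 := mul_mem_nonunits h2 h1
      rw [map_div₀, ← AlgEquiv.mul_apply, ← pow_succ', div_mul_div_comm, mul_comm (σ x),
        mul_div_mul_right _ _ (by simpa using hx)] at h3
      exact h3
  have hfin : IsOfFinOrder (⟨σ, hσ⟩ : D) := isOfFinOrder_of_finite _
  have hord := hpow (orderOf (⟨σ, hσ⟩ : D) - 1)
  rw [Nat.sub_add_cancel hfin.orderOf_pos] at hord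
  have : σ ^ orderOf (⟨σ, hσ⟩ : D) = 1 := by simp
  rw [this, AlgEquiv.one_apply, div_self hx] at hord
  exact one_notMem_nonunits hord

/-- A finite group acting trivially on the residue field of a discrete valuation ring of
residue characteristic zero is cyclic. -/
theorem isCyclic_of_discrete [CharZero E] {W : ValuationSubring E} {D : Subgroup (E ≃ₐ[F] E)}
    [Finite D]
    (hD : ∀ σ ∈ D, ∀ x ∈ W, σ x ∈ W)
    (hres : ∀ σ ∈ D, ∀ x ∈ W, σ x - x ∈ W.nonunits)
    (hchar : ∀ n : ℕ, n ≠ 0 → (n : E)⁻¹ ∈ W) {s : E} (hs : s ≠ 0)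
    (huni : ∀ x : E, x ≠ 0 → ∃ k : ℤ, x / s ^ k ∈ W ∧ (x / s ^ k)⁻¹ ∈ W) : IsCyclic D := by
  have hmem : ∀ σ ∈ D, ∀ x : E, x ≠ 0 → σ x / x ∈ W := fun σ hσ x hx => map_div_self_mem hD hσ hx
  let χ : D →* IsLocalRing.ResidueField W :=
    { toFun := fun σ => IsLocalRing.residue W ⟨σ.1 s / s, hmem σ.1 σ.2 s hs⟩
      map_one' := by
        rw [← map_one (IsLocalRing.residue W)]
        congr 1
        exact Subtype.ext (by simp [hs])
      map_mul' := by
        rintro ⟨σ, hσ⟩ ⟨τ, hτ⟩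
        rw [← map_mul, ← sub_eq_zero, ← map_sub, IsLocalRing.residue_eq_zero_iff,
          coe_mem_nonunits_iff.symm]
        have h1 := hres σ hσ _ (hmem τ hτ s hs)
        have h2 := mul_mem_nonunits (hmem σ hσ s hs) h1
        convert h2 using 1
        simp only [AddSubgroupClass.coe_sub, MulMemClass.coe_mul,
          AlgEquiv.mul_apply, map_div₀]
        have : σ s ≠ 0 := by simpa using hs
        field_simp }
  refine isCyclic_of_injective_ringHom (R := IsLocalRing.ResidueField W) χ ?_
  rw [injective_iff_map_eq_one]
  rintro ⟨σ, hσ⟩ hχ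
  have hs1 : σ s / s - 1 ∈ W.nonunits := by
    have : IsLocalRing.residue W ⟨σ s / s, hmem σ hσ s hs⟩ = 1 := hχ
    rw [← map_one (IsLocalRing.residue W), ← sub_eq_zero, ← map_sub,
      IsLocalRing.residue_eq_zero_iff, coe_mem_nonunits_iff.symm] at this
    exact this
  have hall : ∀ x : E, x ≠ 0 → σ x / x - 1 ∈ W.nonunits := by
    intro x hx
    obtain ⟨k, hk, hk'⟩ := huni x hx
    have hu0 : x / s ^ k ≠ 0 := div_ne_zero hx (zpow_ne_zero _ hs)
    have h1 : σ (x / s ^ k) / (x / s ^ k) - 1 ∈ W.nonunits := by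
      have := mul_mem_nonunits hk' (hres σ hσ _ hk)
      rwa [mul_sub, inv_mul_cancel₀ hu0, mul_comm, ← div_eq_mul_inv] at this
    have hσs : σ s / s ≠ 0 := div_ne_zero ((map_ne_zero σ).mpr hs) hs
    have hσu : σ (x / s ^ k) / (x / s ^ k) ≠ 0 := div_ne_zero ((map_ne_zero σ).mpr hu0) hu0
    have m1 : Units.mk0 _ hσs ∈ W.principalUnitGroup := sub_one_mem_nonunits_iff.mpr hs1
    have m2 : Units.mk0 _ hσu ∈ W.principalUnitGroup := sub_one_mem_nonunits_iff.mpr h1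
    have m3 := sub_one_mem_nonunits_iff.mp (mul_mem m2 (zpow_mem m1 k))
    convert m3 using 2
    rw [Units.val_mul, Units.val_zpow_eq_zpow_val, Units.val_mk0, Units.val_mk0, map_div₀,
      map_zpow₀, div_zpow]
    have : σ s ≠ 0 := by simpa using hs
    field_simp
  by_contra hne
  have hne' : σ ≠ 1 := fun h => hne (by ext; simp [h])
  obtain ⟨x, hx⟩ : ∃ x, σ x ≠ x := by
    by_contra! h
    exact hne' (AlgEquiv.ext h)
  have hy : σ x - x ≠ 0 := sub_ne_zero.mpr hx
  set y := σ x - x with hydef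
  set n := orderOf (⟨σ, hσ⟩ : D) with hn
  have hn0 : n ≠ 0 := (isOfFinOrder_of_finite _).orderOf_pos.ne'
  have hσn : σ ^ n = 1 := by simp [hn]
  have hsum : ∑ i ∈ Finset.range n, (σ ^ i) y = 0 := by
    have : ∀ i, (σ ^ i) y = (σ ^ (i + 1)) x - (σ ^ i) x := by
      intro i
      rw [hydef, map_sub, pow_succ, AlgEquiv.mul_apply]
    simp_rw [this]
    rw [Finset.sum_range_sub (fun i => (σ ^ i) x), hσn]
    simp
  have hone : ∀ i : ℕ, (σ ^ i) y / y - 1 ∈ W.nonunits := by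
    intro i
    induction i with
    | zero => simp [hy]
    | succ i ih =>
      have hz : (σ ^ i) y ≠ 0 := (map_ne_zero (σ ^ i)).mpr hy
      have m1 : Units.mk0 _ (div_ne_zero hz hy) ∈ W.principalUnitGroup :=
        sub_one_mem_nonunits_iff.mpr ih
      have hz' : σ ((σ ^ i) y) ≠ 0 := (map_ne_zero σ).mpr hz
      have m2 : Units.mk0 _ (div_ne_zero hz' hz) ∈ W.principalUnitGroup :=
        sub_one_mem_nonunits_iff.mpr (hall _ hz)
      have m3 := sub_one_mem_nonunits_iff.mp (mul_mem m2 m1)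
      convert m3 using 2
      rw [Units.val_mul, Units.val_mk0, Units.val_mk0, pow_succ', AlgEquiv.mul_apply,
        div_mul_div_cancel₀ hz]
  have hsum1 : ∑ i ∈ Finset.range n, ((σ ^ i) y / y - 1) ∈ W.nonunits :=
    sum_mem fun i _ => hone i
  rw [Finset.sum_sub_distrib, ← Finset.sum_div, hsum, zero_div, zero_sub, Finset.sum_const,
    Finset.card_range, nsmul_one] at hsum1
  have hn' : (n : E) ∈ W.nonunits := by simpa using neg_mem hsum1
  have := mul_mem_nonunits (hchar n hn0) hn'
  rw [inv_mul_cancel₀ (Nat.cast_ne_zero.mpr hn0)] at this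
  exact one_notMem_nonunits this

end Tame

section Discrete

open ValuationSubring Polynomial

theorem exists_uniformizer_of_isDedekindDomain {R E : Type} [CommRing R] [IsDedekindDomain R]
    [Field E] [Algebra R E] [IsFractionRing R E] (W : ValuationSubring E) (hW : W ≠ ⊤)
    (hR : ∀ x : R, algebraMap R E x ∈ W) :
    ∃ s : E, s ≠ 0 ∧ ∀ x : E, x ≠ 0 → ∃ k : ℤ, x / s ^ k ∈ W ∧ (x / s ^ k)⁻¹ ∈ W := by
  let f : R →+* W := (algebraMap R E).codRestrict W.toSubring hR
  let P : Ideal R := (IsLocalRing.maximalIdeal W).comap f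
  have hP : ∀ x, x ∈ P ↔ algebraMap R E x ∈ W.nonunits := fun x => by
    rw [← SetLike.mem_coe (p := W.nonunits), ← W.image_maximalIdeal]
    constructor
    · exact fun h => ⟨f x, h, rfl⟩
    · rintro ⟨y, hy, hyx⟩
      have : f x = y := Subtype.ext hyx.symm
      rwa [Ideal.mem_comap, this]
  have hprime : P.IsPrime := inferInstance
  have hunit : ∀ x ∉ P, (algebraMap R E x)⁻¹ ∈ W := fun x hx => by
    rw [hP, mem_nonunits_iff_or] at hx
    push Not at hx
    exact hx.2
  have hbot : P ≠ ⊥ := by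
    intro hbot
    refine hW (eq_top_iff.mpr fun x _ => ?_)
    obtain ⟨a, b, hb, rfl⟩ := IsFractionRing.div_surjective (A := R) x
    rw [div_eq_mul_inv]
    refine mul_mem (hR a) (hunit b ?_)
    rw [hbot, Ideal.mem_bot]
    exact nonZeroDivisors.ne_zero hb
  let v : HeightOneSpectrum R := ⟨P, hprime, hbot⟩
  have hv : ∀ x : E, v.valuation E x ≤ 1 → x ∈ W := by
    intro x hx
    obtain ⟨n, d, hnd⟩ := v.exists_primeCompl_mul_eq_of_integer x hx
    have hd0 : algebraMap R E d ≠ 0 := by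
      rw [map_ne_zero_iff _ (IsFractionRing.injective R E)]
      exact fun h => d.2 (by rw [h]; exact zero_mem _)
    rw [eq_div_of_mul_eq hd0 hnd, div_eq_mul_inv]
    exact mul_mem (hR n) (hunit d d.2)
  obtain ⟨s, hs⟩ := v.valuation_exists_uniformizer E
  have hs0 : s ≠ 0 := by
    rintro rfl
    exact WithZero.exp_ne_zero ((map_zero (v.valuation E)).symm.trans hs).symm
  refine ⟨s, hs0, fun x hx => ⟨-WithZero.log (v.valuation E x), ?_⟩⟩
  have : v.valuation E (x / s ^ (-WithZero.log (v.valuation E x))) = 1 := by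
    have hx' : v.valuation E x ≠ 0 := by simpa using hx
    rw [map_div₀, map_zpow₀, hs, ← WithZero.exp_zsmul, smul_eq_mul, neg_mul_neg, mul_one,
      WithZero.exp_log hx', div_self hx']
  exact ⟨hv _ this.le, hv _ (by rw [map_inv₀, this, inv_one])⟩

variable {K E : Type} [Field K] [Field E] [Algebra K E]

theorem exists_uniformizer_of_pairwiseDependent [CharZero K] [Algebra.EssFiniteType K E]
    (hdep : PairwiseDependent K E) (W : ValuationSubring E) (hW : W ≠ ⊤)
    (hK : ∀ c : K, algebraMap K E c ∈ W) :
    ∃ s : E, s ≠ 0 ∧ ∀ x : E, x ≠ 0 → ∃ k : ℤ, x / s ^ k ∈ W ∧ (x / s ^ k)⁻¹ ∈ W := by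
  have hint : ∀ {R : Type} [CommRing R] (g : R →+* E), (∀ r, g r ∈ W) → ∀ x : E,
      g.IsIntegralElem x → x ∈ W := by
    intro R _ g hg x hx
    let f : R →+* W := g.codRestrict W.toSubring hg
    have hx' : IsIntegral W x := by
      obtain ⟨p, hp, hpx⟩ := hx
      refine ⟨p.map f, hp.map f, ?_⟩
      rw [eval₂_map]
      exact hpx
    obtain ⟨y, rfl⟩ := IsIntegrallyClosed.isIntegral_iff.mp hx'
    exact y.2
  obtain ⟨u, hu⟩ : ∃ u, u ∉ W := by
    by_contra! h
    exact hW (eq_top_iff.mpr fun x _ => h x)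
  have htrans : Transcendental K u⁻¹ := by
    intro halg
    have : IsAlgebraic K u := by simpa using halg.inv
    exact hu (hint (algebraMap K E) hK u this.isIntegral)
  have hinj : Function.Injective (aeval u⁻¹ : K[X] →ₐ[K] E) :=
    transcendental_iff_injective.mp htrans
  have htW : u⁻¹ ∈ W := (W.mem_or_inv_mem u).resolve_left hu
  let _ : Algebra K[X] E := (aeval u⁻¹ : K[X] →ₐ[K] E).toRingHom.toAlgebra
  have : IsScalarTower K K[X] E := IsScalarTower.of_algebraMap_eq fun c => by
    change _ = aeval u⁻¹ (C c)
    simp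
  have hfaith : FaithfulSMul K[X] E := (faithfulSMul_iff_algebraMap_injective _ _).mpr hinj
  have halgX : Algebra.IsAlgebraic K[X] E := ⟨fun x => hdep u⁻¹ x⟩
  let _ : Algebra (FractionRing K[X]) E := FractionRing.liftAlgebra K[X] E
  have : IsScalarTower K[X] (FractionRing K[X]) E := FractionRing.isScalarTower_liftAlgebra K[X] E
  have : IsScalarTower K (FractionRing K[X]) E := IsScalarTower.to₁₃₄ K K[X] (FractionRing K[X]) E
  have : Algebra.EssFiniteType (FractionRing K[X]) E := .of_comp K _ _
  have : Algebra.IsAlgebraic (FractionRing K[X]) E :=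
    IsFractionRing.comap_isAlgebraic_iff (A := K[X]).mp halgX
  have : FiniteDimensional (FractionRing K[X]) E :=
    Algebra.finite_of_essFiniteType_of_isAlgebraic
  have : CharZero (FractionRing K[X]) := inferInstance
  let R := integralClosure K[X] E
  have : IsDedekindDomain R := integralClosure.isDedekindDomain K[X] (FractionRing K[X]) E
  have : IsFractionRing R E :=
    IsIntegralClosure.isFractionRing_of_finite_extension K[X] (FractionRing K[X]) E R
  refine exists_uniformizer_of_isDedekindDomain (R := R) W hW fun x => ?_
  refine hint (algebraMap K[X] E) (fun p => ?_) _ x.2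
  change aeval u⁻¹ p ∈ W
  rw [aeval_eq_sum_range]
  refine sum_mem fun i _ => ?_
  rw [Algebra.smul_def]
  exact mul_mem (hK _) (pow_mem htW _)

theorem exists_monic_aeval_mem_nonunits (hdep : PairwiseDependent K E) (W : ValuationSubring E)
    (hW : W ≠ ⊤) (hK : ∀ c : K, algebraMap K E c ∈ W) {y : E} (hy : y ∈ W) :
    ∃ f : K[X], f.Monic ∧ aeval y f ∈ W.nonunits := by
  let _ : Algebra K W := ((algebraMap K E).codRestrict W.toSubring hK).toAlgebra
  let φ : W →ₐ[K] E := { W.subtype with commutes' := fun c => rfl }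
  have hφ : Function.Injective φ := Subtype.val_injective
  have hbot : IsLocalRing.maximalIdeal W ≠ ⊥ := by
    intro h
    obtain ⟨u, hu⟩ : ∃ u, u ∉ W := by
      by_contra! h
      exact hW (eq_top_iff.mpr fun x _ => h x)
    have h1 : u⁻¹ ∈ W.nonunits := by
      rw [mem_nonunits_iff_or, inv_inv]
      exact .inr hu
    rw [← SetLike.mem_coe, ← W.image_maximalIdeal, h] at h1
    obtain ⟨z, hz, hzu⟩ := h1
    have hz0 : z = 0 := hz
    rw [hz0] at hzu
    have : u = 0 := by simpa using hzu.symm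
    exact hu (this ▸ W.zero_mem)
  obtain ⟨f, hf, hfy⟩ := exists_monic_aeval_mem_of_prime (hdep.of_injective φ hφ)
    (IsLocalRing.maximalIdeal W) hbot ⟨y, hy⟩
  refine ⟨f, hf, ?_⟩
  rw [← SetLike.mem_coe, ← W.image_maximalIdeal]
  exact ⟨_, hfy, (aeval_algHom_apply φ (⟨y, hy⟩ : W) f).symm⟩

end Discrete

section LimitCyclic

open Polynomial Filter ValuationSubring

variable {K F E : Type} [Field K] [CharZero K] [Field F] [Field E] [Algebra F E] [Algebra K F]
  [Algebra K E] [IsScalarTower K F E]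

theorem eventually_isCyclic_of_isUnramifiedDatum [FiniteDimensional F E]
    [Algebra.EssFiniteType K E] (hdep : PairwiseDependent K E) {ι : Type} (U : Ultrafilter ι)
    {V : ι → ValuationSubring K} (hV : ∀ f : K[X], f.Monic → ∀ᶠ i in U, SplitsModulo (V i) f)
    {W : ι → ValuationSubring E} {D : ι → Subgroup (E ≃ₐ[F] E)}
    (h : ∀ᶠ i in U, IsUnramifiedDatum (V i) (W i) (D i)) : ∀ᶠ i in U, IsCyclic (D i) := by
  obtain ⟨D₀, hD₀⟩ := (U.map D).eq_pure_of_finite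
  have hD : ∀ᶠ i in U, D i = D₀ := by
    have : {D₀} ∈ U.map D := by rw [hD₀]; exact Ultrafilter.mem_pure.mpr rfl
    exact this
  have h₀ : ∀ᶠ i in U, IsUnramifiedDatum (V i) (W i) D₀ := by
    filter_upwards [h, hD] with i hi hDi using hDi ▸ hi
  suffices hcyc : IsCyclic D₀ by filter_upwards [hD] with i hi using hi ▸ hcyc
  set W₀ := ultralimit U W with hW₀
  have hmap : ∀ σ ∈ D₀, ∀ x ∈ W₀, σ x ∈ W₀ := fun σ hσ x hx => by
    filter_upwards [h₀, hx] with i hi hxi using hi.map_mem σ hσ x hxi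
  have hK : ∀ c : K, algebraMap K E c ∈ W₀ := fun c => by
    filter_upwards [h₀, hV (X - C c) (monic_X_sub_C c)] with i hi hc
    refine hi.algebraMap_mem _ ?_
    simpa using hc.1 0
  by_cases htop : W₀ = ⊤
  · have hx : ∀ σ : E ≃ₐ[F] E, σ ∈ D₀ → σ ≠ 1 → ∀ᶠ i in U,
        ∃ x ∈ W i, σ x - x ∈ W i ∧ σ x - x ∉ (W i).nonunits := by
      intro σ hσ hne
      obtain ⟨x, hx⟩ : ∃ x, σ x ≠ x := by
        by_contra! h
        exact hne (AlgEquiv.ext h)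
      have h1 : ∀ y, ∀ᶠ i in U, y ∈ W i := fun y =>
        mem_ultralimit.mp (by rw [← hW₀, htop]; trivial)
      have h2 : ∀ᶠ i in U, σ x - x ∉ (W i).nonunits := by
        rw [Ultrafilter.eventually_not, ← mem_nonunits_ultralimit, ← hW₀, htop,
          mem_nonunits_iff_or]
        push Not
        exact ⟨sub_ne_zero.mpr hx, trivial⟩
      filter_upwards [h1 x, h1 (σ x - x), h2] with i a b c using ⟨x, a, b, c⟩
    have hall : ∀ᶠ i in U, ∀ σ : E ≃ₐ[F] E, σ ∈ D₀ → σ ≠ 1 →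
        ∃ x ∈ W i, σ x - x ∈ W i ∧ σ x - x ∉ (W i).nonunits := by
      simp only [eventually_all]
      exact hx
    obtain ⟨i, hi, hi'⟩ := (h₀.and hall).exists
    exact hi.isCyclic fun σ hσ hne => hi' σ hσ hne
  · obtain ⟨s, hs, huni⟩ := exists_uniformizer_of_pairwiseDependent hdep W₀ htop hK
    have : CharZero E := charZero_of_injective_algebraMap (algebraMap K E).injective
    refine isCyclic_of_discrete hmap (fun σ hσ y hy => ?_) (fun n hn => ?_) hs huni
    · obtain ⟨f, hf, hfy⟩ := exists_monic_aeval_mem_nonunits hdep W₀ htop hK hy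
      refine mem_nonunits_ultralimit.mpr ?_
      filter_upwards [h₀, hV f hf, mem_nonunits_ultralimit.mp hfy, hy] with i a b c d
      exact a.sub_mem_nonunits b d c hσ
    · simpa using hK (n : K)⁻¹

end LimitCyclic

section Place

open ValuationSubring

variable {B E L : Type} [CommRing B] [Field E] [Field L] [Algebra B E]

/-- The graph of the place of `E = Frac B` extending the homomorphism `ψ : B →+* L`. -/
def PlaceRel (ψ : B →+* L) (x : E) (y : L) : Prop :=
  ∃ b s : B, ψ s ≠ 0 ∧ x * algebraMap B E s = algebraMap B E b ∧ y * ψ s = ψ b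

namespace PlaceRel

variable {ψ : B →+* L} {x x' : E} {y y' : L}

theorem of_algebraMap (b : B) : PlaceRel ψ (algebraMap B E b) (ψ b) :=
  ⟨b, 1, by simp, by simp, by simp⟩

theorem add (h : PlaceRel ψ x y) (h' : PlaceRel ψ x' y') : PlaceRel ψ (x + x') (y + y') := by
  obtain ⟨b, s, hs, hx, hy⟩ := h
  obtain ⟨b', s', hs', hx', hy'⟩ := h'
  refine ⟨b * s' + b' * s, s * s', by simp [hs, hs'], ?_, ?_⟩
  · simp only [map_mul, map_add]
    linear_combination algebraMap B E s' * hx + algebraMap B E s * hx'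
  · simp only [map_mul, map_add]
    linear_combination ψ s' * hy + ψ s * hy'

theorem mul (h : PlaceRel ψ x y) (h' : PlaceRel ψ x' y') : PlaceRel ψ (x * x') (y * y') := by
  obtain ⟨b, s, hs, hx, hy⟩ := h
  obtain ⟨b', s', hs', hx', hy'⟩ := h'
  refine ⟨b * b', s * s', by simp [hs, hs'], ?_, ?_⟩
  · rw [map_mul, map_mul, ← hx, ← hx']
    ring
  · rw [map_mul, map_mul, ← hy, ← hy']
    ring

theorem neg (h : PlaceRel ψ x y) : PlaceRel ψ (-x) (-y) := by
  obtain ⟨b, s, hs, hx, hy⟩ := h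
  exact ⟨-b, s, hs, by rw [neg_mul, hx, map_neg], by rw [neg_mul, hy, map_neg]⟩

theorem sub (h : PlaceRel ψ x y) (h' : PlaceRel ψ x' y') : PlaceRel ψ (x - x') (y - y') := by
  rw [sub_eq_add_neg, sub_eq_add_neg]
  exact h.add h'.neg

variable [FaithfulSMul B E]

theorem unique (h : PlaceRel ψ x y) (h' : PlaceRel ψ x y') : y = y' := by
  obtain ⟨b, s, hs, hx, hy⟩ := h
  obtain ⟨b', s', hs', hx', hy'⟩ := h'
  have h1 : b * s' = b' * s := by
    apply FaithfulSMul.algebraMap_injective B E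
    rw [map_mul, map_mul, ← hx, ← hx']
    ring
  have h2 := congrArg ψ h1
  rw [map_mul, map_mul, ← hy, ← hy'] at h2
  refine mul_right_cancel₀ (mul_ne_zero hs hs') ?_
  linear_combination h2

theorem inv (h : PlaceRel ψ x y) (hy0 : y ≠ 0) : PlaceRel ψ x⁻¹ y⁻¹ := by
  obtain ⟨b, s, hs, hx, hy⟩ := h
  have hb : ψ b ≠ 0 := hy ▸ mul_ne_zero hy0 hs
  have hx0 : x ≠ 0 := by
    rintro rfl
    rw [zero_mul, eq_comm, map_eq_zero_iff _ (FaithfulSMul.algebraMap_injective B E)] at hx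
    exact hb (by rw [hx, map_zero])
  refine ⟨s, b, hb, ?_, ?_⟩
  · rw [← hx, inv_mul_cancel_left₀ hx0]
  · rw [← hy, inv_mul_cancel_left₀ hy0]

theorem total [IsDedekindDomain B] [IsFractionRing B E] (ψ : B →+* L) (x : E) :
    (∃ y, PlaceRel ψ x y) ∨ ∃ y, PlaceRel ψ x⁻¹ y := by
  have key : ∀ (z : E) (n d : B), ψ d ≠ 0 → z * algebraMap B E d = algebraMap B E n →
      ∃ y, PlaceRel ψ z y := fun z n d hd h =>
    ⟨ψ n / ψ d, n, d, hd, h, div_mul_cancel₀ _ hd⟩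
  by_cases hbot : RingHom.ker ψ = ⊥
  · obtain ⟨a, b, hb, rfl⟩ := IsFractionRing.div_surjective (A := B) x
    have hb0 : b ≠ 0 := nonZeroDivisors.ne_zero hb
    refine .inl (key _ a b (fun h => hb0 ?_) (div_mul_cancel₀ _ ?_))
    · rwa [← RingHom.mem_ker, hbot] at h
    · rwa [Ne, map_eq_zero_iff _ (FaithfulSMul.algebraMap_injective B E)]
  · let v : HeightOneSpectrum B := ⟨RingHom.ker ψ, RingHom.ker_isPrime ψ, hbot⟩
    obtain ⟨n, d, h | h⟩ := v.exists_primeCompl_mul_eq_or_mul_eq x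
    · exact .inl (key _ n d d.2 h)
    · right
      refine key _ n d d.2 ?_
      have hd0 : algebraMap B E d ≠ 0 := by
        rw [Ne, map_eq_zero_iff _ (FaithfulSMul.algebraMap_injective B E)]
        exact fun h => d.2 (by rw [h]; exact zero_mem _)
      have hx0 : x ≠ 0 := by
        rintro rfl
        rw [zero_mul] at h
        exact hd0 h.symm
      rw [← h, inv_mul_cancel_left₀ hx0]

end PlaceRel

variable [IsDedekindDomain B] [IsFractionRing B E]

/-- The valuation ring of the composite of the place extending `ψ` with `O`. -/
def placeValuationSubring (ψ : B →+* L) (O : ValuationSubring L) : ValuationSubring E where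
  carrier := {x | ∃ y ∈ O, PlaceRel ψ x y}
  mul_mem' := fun ⟨_, h, hr⟩ ⟨_, h', hr'⟩ => ⟨_, O.mul_mem _ _ h h', hr.mul hr'⟩
  one_mem' := ⟨_, O.one_mem, by simpa using PlaceRel.of_algebraMap (E := E) (ψ := ψ) 1⟩
  add_mem' := fun ⟨_, h, hr⟩ ⟨_, h', hr'⟩ => ⟨_, O.add_mem _ _ h h', hr.add hr'⟩
  zero_mem' := ⟨_, O.zero_mem, by simpa using PlaceRel.of_algebraMap (E := E) (ψ := ψ) 0⟩
  neg_mem' := fun ⟨_, h, hr⟩ => ⟨_, O.neg_mem _ h, hr.neg⟩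
  mem_or_inv_mem' := by
    have key : ∀ (x : E) (y : L), PlaceRel ψ x y →
        (∃ y ∈ O, PlaceRel ψ x y) ∨ ∃ y ∈ O, PlaceRel ψ x⁻¹ y := by
      intro x y h
      by_cases hy : y ∈ O
      · exact .inl ⟨y, hy, h⟩
      · have hy0 : y ≠ 0 := fun h0 => hy (h0 ▸ O.zero_mem)
        exact .inr ⟨y⁻¹, (O.mem_or_inv_mem y).resolve_left hy, h.inv hy0⟩
    intro x
    obtain ⟨y, h⟩ | ⟨y, h⟩ := PlaceRel.total ψ x
    · exact key x y h
    · simpa [or_comm] using key x⁻¹ y h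

variable {ψ : B →+* L} {O : ValuationSubring L} {x : E}

theorem mem_placeValuationSubring :
    x ∈ placeValuationSubring (E := E) ψ O ↔ ∃ y ∈ O, PlaceRel ψ x y := Iff.rfl

theorem mem_nonunits_placeValuationSubring :
    x ∈ (placeValuationSubring (E := E) ψ O).nonunits ↔ ∃ y ∈ O.nonunits, PlaceRel ψ x y := by
  constructor
  · intro h
    obtain ⟨y, hy, hxy⟩ := mem_of_mem_nonunits h
    refine ⟨y, ?_, hxy⟩
    rw [mem_nonunits_iff_or] at h ⊢
    by_contra! hy'
    obtain rfl | h := h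
    · refine hy'.1 (hxy.unique ?_)
      simpa using PlaceRel.of_algebraMap (E := E) (ψ := ψ) 0
    · exact h ⟨_, hy'.2, hxy.inv hy'.1⟩
  · rintro ⟨y, hy, hxy⟩
    rw [mem_nonunits_iff_or]
    by_contra! hx
    obtain ⟨z, hz, hxz⟩ := hx.2
    have h1 := hxz.mul hxy
    rw [inv_mul_cancel₀ hx.1] at h1
    have h2 : z * y = 1 := h1.unique (by simpa using PlaceRel.of_algebraMap (E := E) (ψ := ψ) 1)
    exact ValuationSubring.one_notMem_nonunits (h2 ▸ mul_mem_nonunits hz hy)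

end Place

section Conjugacy

open Polynomial

variable {K A B L : Type} [Field K] [Infinite K] [CommRing A] [CommRing B] [Field L]
  [Algebra K B] [Algebra K L] [Algebra A B]

/-- Two homomorphisms from `B` to a field that agree on the ring of invariants are conjugate. -/
theorem exists_algHom_comp_eq (G : Type) [Group G] [Finite G] [MulSemiringAction G B]
    [Algebra.IsInvariant A B G] [SMulCommClass G K B] (f g : B →ₐ[K] L)
    (h : ∀ a : A, f (algebraMap A B a) = g (algebraMap A B a)) :
    ∃ σ : G, ∀ b, g b = f (σ • b) := by
  cases nonempty_fintype G
  let p : G → Subspace K B := fun σ =>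
    LinearMap.eqLocus g.toLinearMap (f.toLinearMap ∘ₗ DistribSMul.toLinearMap K B σ)
  have hp : ∀ σ b, b ∈ p σ ↔ g b = f (σ • b) := fun σ b => Iff.rfl
  have hcov : ⋃ σ, (p σ : Set B) = Set.univ := by
    refine Set.eq_univ_of_forall fun b => ?_
    obtain ⟨q, hq⟩ := (mem_lifts _).mp (Algebra.IsInvariant.charpoly_mem_lifts A B G b)
    have h1 : (MulSemiringAction.charpoly G b).eval₂ (g : B →+* L) (g b) = 0 := by
      have := hom_eval₂ (MulSemiringAction.charpoly G b) (RingHom.id B) (g : B →+* L) b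
      rw [RingHom.comp_id] at this
      rw [RingHom.coe_coe] at this
      rw [← this]
      change g (eval b _) = 0
      rw [MulSemiringAction.eval_charpoly, map_zero]
    have h2 : (MulSemiringAction.charpoly G b).eval₂ (f : B →+* L) (g b) = 0 := by
      rw [← hq, eval₂_map] at h1 ⊢
      rw [← h1]
      congr 1
      ext a
      exact h a
    rw [MulSemiringAction.charpoly_eq, eval₂_finsetProd, Finset.prod_eq_zero_iff] at h2
    obtain ⟨σ, -, hσ⟩ := h2
    rw [eval₂_sub, eval₂_X, eval₂_C, sub_eq_zero] at hσ
    exact Set.mem_iUnion.mpr ⟨σ, hσ⟩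
  obtain ⟨σ, hσ⟩ := Subspace.exists_eq_top_of_iUnion_eq_univ hcov
  exact ⟨σ, fun b => (hp σ b).mp (hσ ▸ Submodule.mem_top)⟩

end Conjugacy

section ResidueAction

variable {Ω L : Type} [Field Ω] [Field L] [Algebra Ω L]

/-- The action of the Galois group on an invariant valuation ring. -/
def ValuationSubring.galHom (O : ValuationSubring L)
    (hO : ∀ τ : L ≃ₐ[Ω] L, ∀ y ∈ O, τ y ∈ O) : (L ≃ₐ[Ω] L) →* (O ≃+* O) where
  toFun τ :=
    { toFun := fun y => ⟨τ y, hO τ y y.2⟩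
      invFun := fun y => ⟨τ.symm y, hO τ.symm y y.2⟩
      left_inv := fun y => Subtype.ext (τ.symm_apply_apply y)
      right_inv := fun y => Subtype.ext (τ.apply_symm_apply y)
      map_mul' := fun _ _ => Subtype.ext (map_mul τ _ _)
      map_add' := fun _ _ => Subtype.ext (map_add τ _ _) }
  map_one' := rfl
  map_mul' _ _ := rfl

theorem isCyclic_ringAut_of_finite (k : Type) [Field k] [Finite k] : IsCyclic (k ≃+* k) := by
  let p := ringChar k
  have : Fact p.Prime := ⟨CharP.char_is_prime k p⟩
  let _ : Algebra (ZMod p) k := ZMod.algebra k p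
  let e : (k ≃+* k) →* (k ≃ₐ[ZMod p] k) :=
    { toFun := fun s => AlgEquiv.ofRingEquiv (f := s) fun c =>
        RingHom.congr_fun (RingHom.ext_zmod (s.toRingHom.comp (algebraMap (ZMod p) k))
          (algebraMap (ZMod p) k)) c
      map_one' := rfl
      map_mul' := fun _ _ => rfl }
  refine isCyclic_of_injective e fun s t hst => RingEquiv.ext fun x => ?_
  exact DFunLike.congr_fun hst x

end ResidueAction

section Datum

open ValuationSubring

variable {K A B F E Ω L : Type} [Field K] [CommRing A] [CommRing B] [Field F] [Field E]
  [Field Ω] [Field L] [Algebra K B] [Algebra A B] [Algebra K L] [Algebra A F] [Algebra B E]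
  [IsFractionRing A F] [Algebra F E] [Algebra A E] [IsScalarTower A F E] [IsScalarTower A B E]
  [IsIntegralClosure B A E] [Algebra Ω L] [FiniteDimensional F E]

variable (F) in
/-- The pairs of automorphisms of `E/F` and `L/Ω` compatible with a specialization `ψ`. -/
def compatibleAut (ψ : B →ₐ[K] L) : Subgroup ((E ≃ₐ[F] E) × (L ≃ₐ[Ω] L)) where
  carrier := {p | ∀ b, ψ (galRestrict A F E B p.1 b) = p.2 (ψ b)}
  mul_mem' {p q} hp hq b := by
    rw [Prod.fst_mul, Prod.snd_mul, map_mul, AlgEquiv.mul_apply, AlgEquiv.mul_apply, hp, hq]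
  one_mem' b := by
    rw [Prod.fst_one, Prod.snd_one, map_one, AlgEquiv.one_apply, AlgEquiv.one_apply]
  inv_mem' {p} hp b := by
    have h := hp (galRestrict A F E B p⁻¹.1 b)
    rw [← AlgEquiv.mul_apply, ← map_mul, Prod.fst_inv, mul_inv_cancel, map_one,
      AlgEquiv.one_apply] at h
    rw [h, Prod.snd_inv, ← AlgEquiv.mul_apply, inv_mul_cancel, AlgEquiv.one_apply, Prod.fst_inv]

variable {ψ : B →ₐ[K] L}

theorem mem_compatibleAut {p : (E ≃ₐ[F] E) × (L ≃ₐ[Ω] L)} :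
    p ∈ compatibleAut (A := A) F ψ ↔ ∀ b, ψ (galRestrict A F E B p.1 b) = p.2 (ψ b) := Iff.rfl

theorem PlaceRel.map {p : (E ≃ₐ[F] E) × (L ≃ₐ[Ω] L)} (hp : p ∈ compatibleAut (A := A) F ψ)
    {x : E} {y : L} (h : PlaceRel (ψ : B →+* L) x y) :
    PlaceRel (ψ : B →+* L) (p.1 x) (p.2 y) := by
  obtain ⟨b, s, hs, hx, hy⟩ := h
  refine ⟨galRestrict A F E B p.1 b, galRestrict A F E B p.1 s, ?_, ?_, ?_⟩
  · rw [RingHom.coe_coe] at hs ⊢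
    rw [mem_compatibleAut.mp hp]
    simpa using hs
  · rw [algebraMap_galRestrict_apply, algebraMap_galRestrict_apply, ← map_mul, hx]
  · rw [RingHom.coe_coe] at hy ⊢
    rw [mem_compatibleAut.mp hp, mem_compatibleAut.mp hp, ← map_mul, hy]

theorem exists_isUnramifiedDatum [CharZero K] [Algebra K A] [IsScalarTower K A B] [Algebra K E]
    [Algebra K Ω] [IsScalarTower K B E] [IsFractionRing B E] [IsIntegrallyClosed A]
    [IsScalarTower K Ω L] [IsGalois F E] [IsDedekindDomain B]
    {φ : A →ₐ[K] Ω} (hφ : ∀ a, ψ (algebraMap A B a) = algebraMap Ω L (φ a))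
    (hψ : Algebra.adjoin Ω (Set.range ψ) = ⊤)
    (V : ValuationSubring K) (O : ValuationSubring L)
    (hO : ∀ τ : L ≃ₐ[Ω] L, ∀ y ∈ O, τ y ∈ O) (hV : ∀ c ∈ V, algebraMap K L c ∈ O)
    (hV' : ∀ c ∈ V.nonunits, algebraMap K L c ∈ O.nonunits)
    [Finite (IsLocalRing.ResidueField O)] :
    ∃ (W : ValuationSubring E) (D : Subgroup (E ≃ₐ[F] E)), IsUnramifiedDatum V W D ∧
      (IsCyclic D → IsCyclic (L ≃ₐ[Ω] L)) := by
  set P := compatibleAut (A := A) (Ω := Ω) (E := E) F ψ with hP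
  have hrel (c : K) : PlaceRel (ψ : B →+* L) (algebraMap K E c) (algebraMap K L c) := by
    have := PlaceRel.of_algebraMap (E := E) (ψ := (ψ : B →+* L)) (algebraMap K B c)
    rwa [← IsScalarTower.algebraMap_apply, RingHom.coe_coe, AlgHom.commutes] at this
  have huniq : ∀ p ∈ P, p.1 = 1 → p.2 = 1 := by
    intro p hp h1
    have h2 : (p.2 : L →ₐ[Ω] L) = AlgHom.id Ω L := by
      refine AlgHom.ext_of_adjoin_eq_top hψ ?_
      rintro _ ⟨b, rfl⟩
      have := hp b
      rw [h1, map_one, AlgEquiv.one_apply] at this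
      exact this.symm
    exact AlgEquiv.ext fun y => DFunLike.congr_fun h2 y
  have hsurj : Function.Surjective ((MonoidHom.snd _ _).comp P.subtype) := by
    intro τ
    have : Algebra.IsInvariant A B (B ≃ₐ[A] B) := Algebra.isInvariant_of_isGalois' A F E B
    have : Finite (B ≃ₐ[A] B) := Finite.of_equiv _ (galRestrict A F E B).toEquiv
    have : SMulCommClass (B ≃ₐ[A] B) K B := ⟨fun σ c b => by
      rw [← algebraMap_smul A c b, ← algebraMap_smul A c (σ • b)]
      exact map_smul σ _ _⟩
    obtain ⟨σ, hσ⟩ := exists_algHom_comp_eq (K := K) (A := A) (B ≃ₐ[A] B) ψ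
      (((τ : L →ₐ[Ω] L).restrictScalars K).comp ψ) fun a => by
        change _ = τ (ψ _)
        rw [hφ, AlgEquiv.commutes]
    refine ⟨⟨((galRestrict A F E B).symm σ, τ), fun b => ?_⟩, rfl⟩
    rw [MulEquiv.apply_symm_apply]
    exact (hσ b).symm
  refine ⟨placeValuationSubring (ψ : B →+* L) O, P.map (MonoidHom.fst _ _), ⟨?_, ?_, ?_, ?_⟩, ?_⟩
  · exact fun c hc => mem_placeValuationSubring.mpr ⟨_, hV c hc, hrel c⟩
  · exact fun c hc => mem_nonunits_placeValuationSubring.mpr ⟨_, hV' c hc, hrel c⟩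
  · rintro _ ⟨p, hp, rfl⟩ x ⟨y, hy, hxy⟩
    exact ⟨p.2 y, hO _ _ hy, hxy.map hp⟩
  · intro h
    have hcyc := isCyclic_ringAut_of_finite (IsLocalRing.ResidueField O)
    have : IsCyclic P := by
      refine isCyclic_of_injective (((IsLocalRing.ResidueField.mapAut (R := O)).comp
        (O.galHom hO)).comp ((MonoidHom.snd _ _).comp P.subtype))
        ((injective_iff_map_eq_one _).mpr fun p hp => ?_)
      have h1 : p.1.1 = 1 := by
        by_contra hne
        obtain ⟨x, ⟨y, hy, hxy⟩, -, hx⟩ := h p.1.1 ⟨p.1, p.2, rfl⟩ hne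
        refine hx (mem_nonunits_placeValuationSubring.mpr ⟨_, ?_, (hxy.map p.2).sub hxy⟩)
        have h2 := DFunLike.congr_fun hp (IsLocalRing.residue O ⟨y, hy⟩)
        have h3 : IsLocalRing.residue O (O.galHom hO p.1.2 ⟨y, hy⟩) =
          IsLocalRing.residue O ⟨y, hy⟩ := h2
        rw [← sub_eq_zero, ← map_sub, IsLocalRing.residue_eq_zero_iff] at h3
        exact (ValuationSubring.coe_mem_nonunits_iff).mpr h3
      exact Subtype.ext (Prod.ext h1 (huniq _ p.2 h1))
    exact isCyclic_of_surjective _ (MonoidHom.subgroupMap_surjective (MonoidHom.fst _ _) P)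
  · intro h
    have : IsCyclic P := by
      refine isCyclic_of_injective ((MonoidHom.fst _ _).subgroupMap P)
        ((injective_iff_map_eq_one _).mpr fun p hp => ?_)
      have h1 : p.1.1 = 1 := congrArg Subtype.val hp
      exact Subtype.ext (Prod.ext h1 (huniq _ p.2 h1))
    exact isCyclic_of_surjective _ hsurj

end Datum

section Specialization

open Polynomial

theorem PairwiseDependent.isDedekindDomain {K A : Type} [Field K] [CommRing A] [IsDomain A]
    [Algebra K A] [Algebra.FiniteType K A] [IsIntegrallyClosed A] (h : PairwiseDependent K A) :
    IsDedekindDomain A := by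
  have : IsNoetherianRing A := Algebra.FiniteType.isNoetherianRing K A
  have : Ring.DimensionLEOne A := ⟨fun {P} hP0 hP => by
    have : Algebra.IsIntegral K (A ⧸ P) := ⟨fun z => by
      obtain ⟨y, rfl⟩ := Ideal.Quotient.mk_surjective z
      obtain ⟨f, hf, hfy⟩ := exists_monic_aeval_mem_of_prime h P hP0 y
      refine ⟨f, hf, ?_⟩
      rw [← aeval_def, ← Ideal.Quotient.mkₐ_eq_mk K, aeval_algHom_apply]
      exact Ideal.Quotient.eq_zero_iff_mem.mpr hfy⟩
    exact Ideal.Quotient.maximal_of_isField _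
      (isField_of_isIntegral_of_isField' (Field.toIsField K))⟩
  have : IsDedekindRing A := { }
  exact { }

variable {K A F E Ω L : Type} [Field K] [CharZero K] [CommRing A] [Field F] [Field E] [Field Ω]
  [Field L] [Algebra K F] [Algebra F E] [FiniteDimensional F E] [IsGalois F E] [Algebra K E]
  [IsScalarTower K F E] [Algebra K Ω] [Algebra Ω L]

theorem exists_isUnramifiedDatum_of_algEquiv [Algebra K A] [Algebra.FiniteType K A] [Algebra A F]
    [IsScalarTower K A F] [IsFractionRing A F] [IsIntegrallyClosed A] {_ : Algebra A E}
    (hE : ∀ a, algebraMap A E a = algebraMap F E (algebraMap A F a)) {_ : Algebra A Ω}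
    (hΩ : ∀ c, algebraMap K Ω c = algebraMap A Ω (algebraMap K A c)) (hdep : PairwiseDependent K F)
    {m : Ideal (Ω ⊗[A] (integralClosure A E))}
    (e : ((Ω ⊗[A] (integralClosure A E)) ⧸ m) ≃ₐ[Ω] L)
    (V : ValuationSubring K) (O : ValuationSubring L)
    (hO : ∀ τ : L ≃ₐ[Ω] L, ∀ y ∈ O, τ y ∈ O)
    (hV : ∀ c ∈ V, algebraMap Ω L (algebraMap K Ω c) ∈ O)
    (hV' : ∀ c ∈ V.nonunits, algebraMap Ω L (algebraMap K Ω c) ∈ O.nonunits)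
    [Finite (IsLocalRing.ResidueField O)] :
    ∃ (W : ValuationSubring E) (D : Subgroup (E ≃ₐ[F] E)), IsUnramifiedDatum V W D ∧
      (IsCyclic D → IsCyclic (L ≃ₐ[Ω] L)) := by
  have : IsScalarTower A F E := .of_algebraMap_eq hE
  have : IsScalarTower K A Ω := .of_algebraMap_eq hΩ
  let _ : Algebra K L := ((algebraMap Ω L).comp (algebraMap K Ω)).toAlgebra
  have : IsScalarTower K Ω L := .of_algebraMap_eq fun _ => rfl
  have hAF := IsFractionRing.injective A F
  have : IsDomain A := hAF.isDomain (algebraMap A F)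
  have : IsDedekindDomain A :=
    (hdep.of_injective (IsScalarTower.toAlgHom K A F) hAF).isDedekindDomain
  have : IsScalarTower K A E := .of_algebraMap_eq fun c => by
    rw [IsScalarTower.algebraMap_apply A F E, ← IsScalarTower.algebraMap_apply K A F,
      ← IsScalarTower.algebraMap_apply K F E]
  have : IsDedekindDomain (integralClosure A E) := integralClosure.isDedekindDomain A F E
  have : IsFractionRing (integralClosure A E) E :=
    IsIntegralClosure.isFractionRing_of_finite_extension A F E _
  have hmk (a : A) : e (Ideal.Quotient.mk m (1 ⊗ₜ algebraMap A (integralClosure A E) a)) =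
      algebraMap Ω L (algebraMap A Ω a) := by
    rw [Algebra.algebraMap_eq_smul_one (A := integralClosure A E), ← TensorProduct.smul_tmul,
      ← Algebra.algebraMap_eq_smul_one, ← e.commutes]
    rfl
  let ψ : integralClosure A E →ₐ[K] L :=
    { toRingHom := (e : _ →+* L).comp ((Ideal.Quotient.mk m).comp
        (Algebra.TensorProduct.includeRight : _ →ₐ[A] Ω ⊗[A] (integralClosure A E)).toRingHom)
      commutes' := fun c => by
        rw [IsScalarTower.algebraMap_apply K A (integralClosure A E)]
        refine (hmk _).trans ?_
        rw [← IsScalarTower.algebraMap_apply K A Ω]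
        rfl }
  refine exists_isUnramifiedDatum (A := A) (ψ := ψ) (φ := IsScalarTower.toAlgHom K A Ω)
    hmk ?_ V O hO hV hV'
  refine eq_top_iff.mpr fun y _ => ?_
  obtain ⟨t, rfl⟩ := e.surjective y
  obtain ⟨t, rfl⟩ := Ideal.Quotient.mk_surjective t
  induction t with
  | zero => simp
  | add s t hs ht => rw [map_add, map_add]; exact add_mem (hs trivial) (ht trivial)
  | tmul w b =>
    have h1 : (Ideal.Quotient.mk m (w ⊗ₜ b) : (Ω ⊗[A] (integralClosure A E)) ⧸ m) =
        w • Ideal.Quotient.mk m (1 ⊗ₜ b) := by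
      rw [← Ideal.Quotient.mkₐ_eq_mk Ω, ← map_smul, TensorProduct.smul_tmul', smul_eq_mul, mul_one]
    rw [h1, map_smul]
    exact Subalgebra.smul_mem _ (Algebra.subset_adjoin (Set.mem_range_self (f := ψ) b)) w

theorem IsSpecialization.exists_isUnramifiedDatum (hdep : PairwiseDependent K F)
    (h : IsSpecialization K F E Ω L) (V : ValuationSubring K) (O : ValuationSubring L)
    (hO : ∀ τ : L ≃ₐ[Ω] L, ∀ y ∈ O, τ y ∈ O)
    (hV : ∀ c ∈ V, algebraMap Ω L (algebraMap K Ω c) ∈ O)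
    (hV' : ∀ c ∈ V.nonunits, algebraMap Ω L (algebraMap K Ω c) ∈ O.nonunits)
    [Finite (IsLocalRing.ResidueField O)] :
    ∃ (W : ValuationSubring E) (D : Subgroup (E ≃ₐ[F] E)), IsUnramifiedDatum V W D ∧
      (IsCyclic D → IsCyclic (L ≃ₐ[Ω] L)) := by
  obtain ⟨A, hfg, hcl, hfrac, φ, -, m, -, ⟨e⟩⟩ := h
  have : Algebra.FiniteType K A := (Subalgebra.fg_iff_finiteType A).mp hfg
  have : IsIntegrallyClosed A := (isIntegrallyClosed_iff F).mpr fun {x} hx => ⟨⟨x, hcl x hx⟩, rfl⟩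
  exact exists_isUnramifiedDatum_of_algEquiv (fun _ => rfl) (fun c => (φ.commutes c).symm) hdep e
    V O hO hV hV'

end Specialization

section SplitPrimes

open Polynomial

theorem Valuation.mem_nonunits_valuationSubring_iff {K Γ : Type} [Field K]
    [LinearOrderedCommGroupWithZero Γ] (v : Valuation K Γ) {x : K} :
    x ∈ v.valuationSubring.nonunits ↔ v x < 1 := by
  rw [ValuationSubring.mem_nonunits_iff]
  exact (isEquiv_valuation_valuationSubring v).lt_one_iff_lt_one.symm

theorem ValuationSubring.eval_mem_and_sub_mem_nonunits {K : Type} [Field K]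
    (W : ValuationSubring K) {f : K[X]} (hf : ∀ n, f.coeff n ∈ W) {a b : K} (ha : a ∈ W)
    (hb : b ∈ W) (hab : a - b ∈ W.nonunits) :
    f.eval b ∈ W ∧ f.eval a - f.eval b ∈ W.nonunits := by
  obtain ⟨g, rfl⟩ := (mem_lifts f).mp ((lifts_iff_coeff_lifts (f := W.subtype) f).mpr fun n =>
    ⟨⟨_, hf n⟩, rfl⟩)
  have h (c : W) : (g.map W.subtype).eval (c : K) = (g.eval c : W) := eval_map_apply W.subtype c
  obtain ⟨d, hd⟩ := sub_dvd_eval_sub (⟨a, ha⟩ : W) ⟨b, hb⟩ g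
  rw [h ⟨a, ha⟩, h ⟨b, hb⟩]
  refine ⟨Subtype.prop _, ?_⟩
  rw [← AddSubgroupClass.coe_sub, hd, mul_comm]
  exact mul_mem_nonunits d.2 hab

/-- For an algebraic integer `η` and a nonzero integer `D`, some `1 + D (η - m)` with `m` an
integer is a nonzero nonunit. -/
theorem NumberField.exists_one_add_mul_sub_notIsUnit {M : Type} [Field M] [NumberField M]
    (η : 𝓞 M) {D : ℤ} (hD : D ≠ 0) :
    ∃ m : ℕ, (1 + D * (η - m) : 𝓞 M) ≠ 0 ∧ ¬ IsUnit (1 + D * (η - m) : 𝓞 M) := by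
  obtain ⟨N, hN⟩ := Finite.exists_le fun σ : M →ₐ[ℚ] ℂ => ‖(1 + D * σ η : ℂ)‖ + 1
  obtain ⟨m, hm⟩ := exists_nat_gt N
  have key (σ : M →ₐ[ℚ] ℂ) : 1 < ‖σ (1 + D * (η - m) : 𝓞 M)‖ := by
    have h1 : σ (1 + D * (η - m) : 𝓞 M) = (1 + D * σ η) - D * m := by
      push_cast
      simp only [map_add, map_mul, map_sub, map_one, map_intCast, map_natCast]
      ring
    have h2 : (m : ℝ) ≤ ‖(D * m : ℂ)‖ := by
      rw [norm_mul, Complex.norm_natCast, Complex.norm_intCast]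
      have : (1 : ℝ) ≤ |(D : ℝ)| := by exact_mod_cast Int.one_le_abs hD
      nlinarith [Nat.cast_nonneg (α := ℝ) m]
    have h3 := norm_sub_norm_le (D * m : ℂ) (1 + D * σ η)
    rw [h1, norm_sub_rev]
    linarith [hN σ]
  have hne : Nonempty (M →ₐ[ℚ] ℂ) := ⟨IsAlgClosed.lift⟩
  refine ⟨m, fun h => ?_, fun h => ?_⟩
  · obtain ⟨σ⟩ := hne
    have := key σ
    simp only [h, map_zero, norm_zero] at this
    linarith
  · rw [isUnit_iff_norm, RingOfIntegers.coe_norm] at h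
    have h1 := congrArg norm (Algebra.norm_eq_prod_embeddings ℚ ℂ
      ((1 + D * (η - m) : 𝓞 M) : M))
    rw [norm_prod] at h1
    have h2 : ∏ _σ : M →ₐ[ℚ] ℂ, (1 : ℝ) < ∏ σ : M →ₐ[ℚ] ℂ, ‖σ (1 + D * (η - m) : 𝓞 M)‖ :=
      Finset.prod_lt_prod_of_nonempty (fun _ _ => one_pos) (fun σ _ => key σ)
        Finset.univ_nonempty
    rw [Finset.prod_const_one, ← h1, eq_ratCast, Complex.norm_ratCast] at h2
    rw [← Rat.cast_abs, h, Rat.cast_one] at h2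
    exact lt_irrefl _ h2

/-- Finitely many elements of a number field are congruent to rational numbers modulo some
prime. -/
theorem NumberField.exists_forall_mem_sub_ratCast_mem_nonunits {M : Type} [Field M]
    [NumberField M] (S : Finset M) :
    ∃ w : HeightOneSpectrum (𝓞 M), ∀ s ∈ S, ∃ a : ℚ,
      (a : M) ∈ (w.valuation M).valuationSubring ∧
      s - a ∈ (w.valuation M).valuationSubring.nonunits := by
  classical
  let pb := Field.powerBasisOfFiniteOfSeparable ℚ M
  choose g hg using pb.exists_eq_aeval'
  obtain ⟨D, hD, hint⟩ := exists_integral_multiples ℤ ℚ (insert pb.gen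
    (S.biUnion fun s => (g s).support.image fun n => ((g s).coeff n : M)))
  obtain ⟨η, hη⟩ : ∃ η : 𝓞 M, algebraMap (𝓞 M) M η = D • pb.gen :=
    ⟨⟨_, hint _ (Finset.mem_insert_self _ _)⟩, rfl⟩
  obtain ⟨m, h0, hunit⟩ := exists_one_add_mul_sub_notIsUnit η hD
  obtain ⟨P, hP, hmem⟩ := exists_max_ideal_of_mem_nonunits hunit
  let w : HeightOneSpectrum (𝓞 M) := ⟨P, hP.isPrime, fun h => h0 (by rwa [h] at hmem)⟩
  set W := (w.valuation M).valuationSubring with hW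
  have hint' (x : 𝓞 M) : (x : M) ∈ W := w.valuation_le_one x
  have hDP : (D : 𝓞 M) ∉ P := fun h => hP.ne_top ((Ideal.eq_top_iff_one _).mpr (by
    have := P.sub_mem hmem (P.mul_mem_right (η - m) h)
    rwa [add_sub_cancel_right] at this))
  have hcoe : ((D : 𝓞 M) : M) = D := map_intCast (algebraMap (𝓞 M) M) D
  have hDM : (D : M) ≠ 0 := by exact_mod_cast hD
  have hDinv : (D : M)⁻¹ ∈ W := by
    have h1 : w.valuation M ((D : 𝓞 M) : M) = 1 := w.valuation_eq_one_iff_notMem.mpr hDP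
    rw [Valuation.mem_valuationSubring_iff, map_inv₀]
    rw [hcoe] at h1
    rw [h1, inv_one]
  have hscale (x : M) (hx : IsIntegral ℤ (D • x)) : x ∈ W := by
    have h1 : x = (D : M)⁻¹ * (D • x) := by
      rw [zsmul_eq_mul, inv_mul_cancel_left₀ hDM]
    rw [h1]
    exact W.mul_mem _ _ hDinv (hint' ⟨_, hx⟩)
  have hgen := hscale _ (hint _ (Finset.mem_insert_self _ _))
  let a₀ : ℚ := (D * m - 1) / D ^ 2
  have ha : (a₀ : M) ∈ W := by
    have h1 : (a₀ : M) = (D : M)⁻¹ * (D : M)⁻¹ * algebraMap (𝓞 M) M (D * m - 1) := by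
      rw [map_sub, map_mul, map_one, map_intCast, map_natCast]
      simp only [a₀]
      push_cast
      field_simp
    rw [h1]
    exact W.mul_mem _ _ (W.mul_mem _ _ hDinv hDinv) (hint' _)
  have hsub : pb.gen - a₀ ∈ W.nonunits := by
    have h1 : pb.gen - a₀ =
        (D : M)⁻¹ * (D : M)⁻¹ * algebraMap (𝓞 M) M (1 + D * (η - m)) := by
      rw [map_add, map_mul, map_sub, map_one, map_intCast, map_natCast, hη, zsmul_eq_mul]
      simp only [a₀]
      push_cast
      field_simp
      ring
    rw [h1]
    refine ValuationSubring.mul_mem_nonunits (W.mul_mem _ _ hDinv hDinv) ?_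
    rw [Valuation.mem_nonunits_valuationSubring_iff]
    exact (w.valuation_lt_one_iff_mem _).mpr hmem
  refine ⟨w, fun s hs => ⟨(g s).eval a₀, ?_⟩⟩
  have hcoeff (n : ℕ) : ((g s).map (algebraMap ℚ M)).coeff n ∈ W := by
    rw [coeff_map, eq_ratCast]
    by_cases hn : n ∈ (g s).support
    · exact hscale _ (hint _ (Finset.mem_insert_of_mem (Finset.mem_biUnion.mpr
        ⟨s, hs, Finset.mem_image_of_mem _ hn⟩)))
    · rw [notMem_support_iff.mp hn, Rat.cast_zero]
      exact W.zero_mem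
  have h := W.eval_mem_and_sub_mem_nonunits hcoeff hgen ha hsub
  rwa [← eq_ratCast (algebraMap ℚ M) a₀, eval_map_apply, eval_map_algebraMap, ← hg,
    eq_ratCast] at h

end SplitPrimes

section SplitPrimesRelative

open Polynomial

theorem IsDedekindDomain.HeightOneSpectrum.comap_valuationSubring {K M : Type} [Field K]
    [Field M] [NumberField K] [NumberField M] [Algebra K M] (w : HeightOneSpectrum (𝓞 M)) :
    ((w.under (𝓞 K)).valuation K).valuationSubring =
      (w.valuation M).valuationSubring.comap (algebraMap K M) := by
  ext x
  have : w.asIdeal.LiesOver (w.under (𝓞 K)).asIdeal := ⟨rfl⟩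
  rw [ValuationSubring.mem_comap, Valuation.mem_valuationSubring_iff,
    Valuation.mem_valuationSubring_iff, ← HeightOneSpectrum.valuation_liesOver M (w.under (𝓞 K)) w,
    pow_le_one_iff (Ideal.IsDedekindDomain.ramificationIdx'_ne_zero_of_liesOver w.asIdeal
      (w.under (𝓞 K)).ne_bot)]

theorem ValuationSubring.mem_nonunits_comap {K M : Type} [Field K] [Field M] [Algebra K M]
    (W : ValuationSubring M) {x : K} :
    x ∈ (W.comap (algebraMap K M)).nonunits ↔ algebraMap K M x ∈ W.nonunits := by
  rw [ValuationSubring.mem_nonunits_iff_or, ValuationSubring.mem_nonunits_iff_or,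
    ValuationSubring.mem_comap, map_inv₀, map_eq_zero]

theorem Polynomial.coeff_X_sub_C_mul_mem_of_smul_mem {R S : Type} [CommRing R] [SetLike S R]
    [AddSubgroupClass S R] (I : S) {r : R} {p : R[X]} (hI : ∀ x ∈ I, r * x ∈ I)
    (hp : ∀ n, p.coeff n ∈ I) (n : ℕ) : ((X - C r) * p).coeff n ∈ I := by
  rw [sub_mul, coeff_sub, coeff_C_mul]
  refine sub_mem ?_ (hI _ (hp n))
  cases n with
  | zero =>
    rw [mul_coeff_zero, coeff_X_zero, zero_mul]
    exact zero_mem _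
  | succ n =>
    rw [coeff_X_mul]
    exact hp n

/-- If `f` splits in `M` and all its coefficients and roots are congruent to elements of `K`
modulo `W`, then `f` splits over `K` modulo the restriction of `W`. -/
theorem splitsModulo_comap {K M : Type} [Field K] [Field M] [Algebra K M] {W : ValuationSubring M}
    {f : K[X]} (hf : f.Monic) (hsplit : (f.map (algebraMap K M)).Splits)
    (hcoeff : ∀ n, algebraMap K M (f.coeff n) ∈ W)
    (hroot : ∀ r ∈ (f.map (algebraMap K M)).roots, ∃ a : K, algebraMap K M a ∈ W ∧
      r - algebraMap K M a ∈ W.nonunits) :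
    SplitsModulo (W.comap (algebraMap K M)) f := by
  choose! φ hφ hφ' using hroot
  refine ⟨hcoeff, (f.map (algebraMap K M)).roots.map φ, ?_, fun n => ?_⟩
  · simp only [Multiset.mem_map]
    rintro _ ⟨r, hr, rfl⟩
    exact hφ r hr
  rw [ValuationSubring.mem_nonunits_comap, ← coeff_map, Polynomial.map_sub,
    Polynomial.map_multiset_prod, Multiset.map_map, Multiset.map_map]
  nth_rw 1 [hsplit.eq_prod_roots_of_monic (hf.map _)]
  simp only [Function.comp_def, Polynomial.map_sub, map_X, map_C]
  generalize (f.map (algebraMap K M)).roots = s at hφ hφ'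
  clear hcoeff hsplit
  suffices h : (∀ n, (s.map fun a => X - C (algebraMap K M (φ a))).prod.coeff n ∈ W) ∧
      ∀ n, ((s.map fun a => X - C a).prod -
        (s.map fun a => X - C (algebraMap K M (φ a))).prod).coeff n ∈ W.nonunits from h.2 n
  induction s using Multiset.induction_on with
  | empty =>
    refine ⟨fun n => ?_, fun n => ?_⟩
    · rw [Multiset.map_zero, Multiset.prod_zero, coeff_one]
      split_ifs
      exacts [W.one_mem, W.zero_mem]
    · rw [Multiset.map_zero, Multiset.map_zero, sub_self, coeff_zero]
      exact zero_mem _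
  | cons r s ih =>
    obtain ⟨h1, h2⟩ := ih (fun r hr => hφ r (Multiset.mem_cons_of_mem hr))
      (fun r hr => hφ' r (Multiset.mem_cons_of_mem hr))
    have ha := hφ r (Multiset.mem_cons_self r s)
    have hra := hφ' r (Multiset.mem_cons_self r s)
    have hr : r ∈ W := by
      simpa using W.add_mem _ _ (ValuationSubring.mem_of_mem_nonunits hra) ha
    simp only [Multiset.map_cons, Multiset.prod_cons]
    generalize (s.map fun a => X - C a).prod = p at h2
    generalize (s.map fun a => X - C (algebraMap K M (φ a))).prod = q at h1 h2
    refine ⟨coeff_X_sub_C_mul_mem_of_smul_mem W (fun x => W.mul_mem _ x ha) h1, fun n => ?_⟩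
    have h3 : (X - C r) * p - (X - C (algebraMap K M (φ r))) * q =
        (X - C r) * (p - q) - C (r - algebraMap K M (φ r)) * q := by
      rw [C_sub]
      ring
    rw [h3, coeff_sub, coeff_C_mul]
    refine sub_mem (coeff_X_sub_C_mul_mem_of_smul_mem _
      (fun _ => ValuationSubring.mul_mem_nonunits hr) h2 n) ?_
    rw [mul_comm]
    exact ValuationSubring.mul_mem_nonunits (h1 n) hra

theorem NumberField.exists_forall_mem_splitsModulo_of_splits {K M : Type} [Field K]
    [NumberField K] [Field M] [NumberField M] [Algebra K M]
    (T : Finset K[X]) (hT : ∀ f ∈ T, f.Monic)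
    (hsplit : ∀ f ∈ T, (f.map (algebraMap K M)).Splits) :
    ∃ v : HeightOneSpectrum (𝓞 K), ∀ f ∈ T, SplitsModulo (v.valuation K).valuationSubring f := by
  classical
  obtain ⟨w, hw⟩ := exists_forall_mem_sub_ratCast_mem_nonunits (T.biUnion fun f =>
    f.support.image (fun n => algebraMap K M (f.coeff n)) ∪
      (f.map (algebraMap K M)).roots.toFinset)
  refine ⟨w.under (𝓞 K), fun f hf => ?_⟩
  rw [w.comap_valuationSubring]
  refine splitsModulo_comap (hT f hf) (hsplit f hf) (fun n => ?_) fun r hr => ?_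
  · by_cases hn : n ∈ f.support
    · obtain ⟨a, ha, ha'⟩ := hw _ (Finset.mem_biUnion.mpr ⟨f, hf, Finset.mem_union_left _
        (Finset.mem_image_of_mem _ hn)⟩)
      simpa using ValuationSubring.add_mem _ _ _ (ValuationSubring.mem_of_mem_nonunits ha') ha
    · rw [notMem_support_iff.mp hn, map_zero]
      exact ValuationSubring.zero_mem _
  · obtain ⟨a, ha⟩ := hw _ (Finset.mem_biUnion.mpr ⟨f, hf, Finset.mem_union_right _
      (Multiset.mem_toFinset.mpr hr)⟩)
    exact ⟨a, by rwa [map_ratCast]⟩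

/-- Finitely many monic polynomials over a number field split simultaneously modulo some
prime. -/
theorem NumberField.exists_forall_mem_splitsModulo {K : Type} [Field K] [NumberField K]
    (T : Finset K[X]) (hT : ∀ f ∈ T, f.Monic) :
    ∃ v : HeightOneSpectrum (𝓞 K), ∀ f ∈ T, SplitsModulo (v.valuation K).valuationSubring f := by
  have hne : ∏ f ∈ T, f ≠ 0 := Finset.prod_ne_zero_iff.mpr fun f hf => (hT f hf).ne_zero
  have := NumberField.of_module_finite K (∏ f ∈ T, f).SplittingField
  refine exists_forall_mem_splitsModulo_of_splits (M := (∏ f ∈ T, f).SplittingField) T hT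
    fun f hf => ?_
  exact (SplittingField.splits _).of_dvd (map_ne_zero hne)
    (map_dvd (mapRingHom (algebraMap K _)) (Finset.dvd_prod_of_mem _ hf))

end SplitPrimesRelative

section CompleteExtension

open Polynomial

theorem ValuationSubring.mem_nonunits_algebraMap_iff {Ω L : Type} [Field Ω] [Field L]
    [Algebra Ω L] {V : ValuationSubring Ω} {O : ValuationSubring L}
    (h : ∀ c, algebraMap Ω L c ∈ O ↔ c ∈ V) {c : Ω} :
    algebraMap Ω L c ∈ O.nonunits ↔ c ∈ V.nonunits := by
  rw [ValuationSubring.mem_nonunits_iff_or, ValuationSubring.mem_nonunits_iff_or, ← map_inv₀, h,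
    map_eq_zero]

theorem Module.finite_of_smul_eq_zero_of_finite_quotient {R M : Type} [CommRing R] [AddCommGroup M]
    [Module R M] [Module.Finite R M] (I : Ideal R) [_root_.Finite (R ⧸ I)]
    (h : ∀ r ∈ I, ∀ m : M, r • m = 0) : _root_.Finite M := by
  obtain ⟨n, f, hf⟩ := Module.Finite.exists_fin' R M
  have : Function.Surjective fun c : Fin n → R ⧸ I => f fun i => (c i).out := by
    intro m
    obtain ⟨x, rfl⟩ := hf m
    refine ⟨fun i => Ideal.Quotient.mk I (x i), ?_⟩
    rw [← sub_eq_zero, ← map_sub, pi_eq_sum_univ ((fun i => (_ : R ⧸ I).out) - x), map_sum]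
    refine Finset.sum_eq_zero fun i _ => ?_
    rw [map_smul]
    refine h _ ?_ _
    rw [Pi.sub_apply, ← Ideal.Quotient.eq]
    exact Quotient.out_eq _
  exact _root_.Finite.of_surjective _ this

theorem isIntegral_of_spectralNorm_le_one {Ω L : Type}
    [NormedField Ω] [Field L] [Algebra Ω L] [Algebra.IsAlgebraic Ω L] (V : ValuationSubring Ω)
    (hV : ∀ c, c ∈ V ↔ ‖c‖ ≤ 1) {x : L} (hx : spectralNorm Ω L x ≤ 1) : IsIntegral V x := by
  have hint : IsIntegral Ω x := (Algebra.IsAlgebraic.isAlgebraic x).isIntegral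
  have hcoeff := (spectralValue_le_one_iff (minpoly.monic hint)).1 hx
  have hlift : minpoly Ω x ∈ lifts (algebraMap V Ω) := by
    rw [lifts_iff_coeff_lifts]
    exact fun n => ⟨⟨_, (hV _).2 (hcoeff n)⟩, rfl⟩
  obtain ⟨q, hq, -, hmonic⟩ := lifts_and_natDegree_eq_and_monic hlift (minpoly.monic hint)
  refine ⟨q, hmonic, ?_⟩
  rw [IsScalarTower.algebraMap_eq V Ω L, ← eval₂_map, hq]
  exact minpoly.aeval Ω x

variable {Ω L : Type} [NontriviallyNormedField Ω] [IsUltrametricDist Ω] [CompleteSpace Ω]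
  [Field L] [Algebra Ω L]

/-- The elements of spectral norm at most one in an algebraic extension of a complete field. -/
def spectralValuationSubring (Ω L : Type) [NontriviallyNormedField Ω] [IsUltrametricDist Ω]
    [CompleteSpace Ω] [Field L] [Algebra Ω L] [Algebra.IsAlgebraic Ω L] : ValuationSubring L where
  carrier := {x | spectralNorm Ω L x ≤ 1}
  mul_mem' {x y} hx hy := by
    rw [Set.mem_ofPred_eq, ← spectralMulAlgNorm_def, map_mul]
    exact mul_le_one₀ hx (apply_nonneg _ _) hy
  one_mem' := spectralNorm_one.le
  add_mem' {x y} hx hy := (isNonarchimedean_spectralNorm x y).trans (max_le hx hy)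
  zero_mem' := by
    rw [Set.mem_ofPred_eq, spectralNorm_zero]
    exact zero_le_one
  neg_mem' {x} hx := by
    rw [Set.mem_ofPred_eq, spectralNorm_neg (Algebra.IsAlgebraic.isAlgebraic x)]
    exact hx
  mem_or_inv_mem' x := by
    rcases eq_or_ne x 0 with rfl | hx
    · left
      change spectralNorm Ω L 0 ≤ 1
      rw [spectralNorm_zero]
      exact zero_le_one
    · change spectralNorm Ω L x ≤ 1 ∨ spectralNorm Ω L x⁻¹ ≤ 1
      have h : spectralNorm Ω L x * spectralNorm Ω L x⁻¹ = 1 := by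
        rw [← spectralMulAlgNorm_def, ← spectralMulAlgNorm_def, ← map_mul, mul_inv_cancel₀ hx,
          map_one]
      by_contra! hcon
      exact (one_lt_mul_of_lt_of_le hcon.1 hcon.2.le).ne' h

theorem mem_spectralValuationSubring [Algebra.IsAlgebraic Ω L] {x : L} :
    x ∈ spectralValuationSubring Ω L ↔ spectralNorm Ω L x ≤ 1 := Iff.rfl

theorem finite_residueField_spectralValuationSubring [FiniteDimensional Ω L]
    [Algebra.IsSeparable Ω L] (V : ValuationSubring Ω) (hV : ∀ c, c ∈ V ↔ ‖c‖ ≤ 1)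
    [IsNoetherianRing V] [Finite (IsLocalRing.ResidueField V)] :
    Finite (IsLocalRing.ResidueField (spectralValuationSubring Ω L)) := by
  set O := spectralValuationSubring Ω L with hO
  have hVO : ∀ c, algebraMap Ω L c ∈ O ↔ c ∈ V := fun c => by
    rw [hV, mem_spectralValuationSubring, spectralNorm_extends]
  let : Algebra V O := (((algebraMap Ω L).comp V.subtype).codRestrict O.toSubring
    fun c => (hVO c).2 c.2).toAlgebra
  have : IsScalarTower V O L := IsScalarTower.of_algebraMap_eq fun _ => rfl
  have : IsIntegralClosure O V L := by
    refine ⟨Subtype.val_injective, fun {x} => ⟨fun h => ⟨⟨x, ?_⟩, rfl⟩, ?_⟩⟩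
    · exact (IsIntegrallyClosed.isIntegral_iff (R := O) (K := L)).1 h.tower_top |>.elim
        fun y hy => hy ▸ y.2
    · rintro ⟨y, rfl⟩
      exact isIntegral_of_spectralNorm_le_one V hV y.2
  have : Module.Finite V O := IsIntegralClosure.finite V Ω L O
  have : Module.Finite V (IsLocalRing.ResidueField O) :=
    Module.Finite.of_surjective
      (IsScalarTower.toAlgHom V O (IsLocalRing.ResidueField O)).toLinearMap
      IsLocalRing.residue_surjective
  have : Finite (V ⧸ IsLocalRing.maximalIdeal V) := ‹Finite (IsLocalRing.ResidueField V)›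
  refine Module.finite_of_smul_eq_zero_of_finite_quotient (R := V) (IsLocalRing.maximalIdeal V) ?_
  intro r hr m
  rw [Algebra.smul_def]
  have : algebraMap V (IsLocalRing.ResidueField O) r = 0 := by
    rw [IsScalarTower.algebraMap_apply V O]
    refine (IsLocalRing.residue_eq_zero_iff _).2 ?_
    rw [← ValuationSubring.coe_mem_nonunits_iff]
    exact (ValuationSubring.mem_nonunits_algebraMap_iff hVO).2
      ((ValuationSubring.coe_mem_nonunits_iff).2 hr)
  rw [this, zero_mul]

end CompleteExtension

section AdicCompletionExtension

variable {K : Type} [Field K] [NumberField K] (v : HeightOneSpectrum (𝓞 K))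

open HeightOneSpectrum

theorem NumberField.mem_nonunits_adicCompletionIntegers_iff {x : v.adicCompletion K} :
    x ∈ (v.adicCompletionIntegers K).nonunits ↔ Valued.v x < 1 :=
  Valuation.mem_nonunits_valuationSubring_iff _

theorem NumberField.norm_adicCompletion_lt_one_iff (x : v.adicCompletion K) :
    ‖x‖ < 1 ↔ Valued.v x < 1 :=
  Valued.toNormedField.norm_lt_one_iff

theorem NumberField.exists_valued_sub_algebraMap_lt_one (x : v.adicCompletion K) :
    ∃ c : K, Valued.v (x - algebraMap K (v.adicCompletion K) c) < 1 := by
  obtain ⟨c, hc⟩ := (denseRange_algebraMap (K := K) (v := v)).exists_dist_lt x one_pos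
  rw [dist_eq_norm] at hc
  exact ⟨c, (NumberField.norm_adicCompletion_lt_one_iff v _).1 hc⟩

theorem NumberField.finite_residueField_adicCompletionIntegers :
    Finite (IsLocalRing.ResidueField (v.adicCompletionIntegers K)) := by
  have : Finite (𝓞 K ⧸ v.asIdeal) := Ideal.finiteQuotientOfFreeOfNeBot v.asIdeal v.ne_bot
  let f := (IsLocalRing.residue (v.adicCompletionIntegers K)).comp
      (algebraMap (𝓞 K) (v.adicCompletionIntegers K))
  have hsurj : Function.Surjective f := by
    intro y
    obtain ⟨x, rfl⟩ := IsLocalRing.residue_surjective y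
    obtain ⟨c, hc⟩ := NumberField.exists_valued_sub_algebraMap_lt_one v (x : v.adicCompletion K)
    have hc' : v.valuation K c ≤ 1 := by
      rw [← valuedAdicCompletion_eq_valuation']
      have h := Valuation.map_sub_le _ ((mem_adicCompletionIntegers _ _ _).1 x.2) hc.le
      rwa [sub_sub_cancel] at h
    obtain ⟨a, ha⟩ := exists_valuation_sub_lt_of_integer v hc' 1
    refine ⟨a, ?_⟩
    change IsLocalRing.residue _ _ = _
    rw [← sub_eq_zero, ← map_sub, IsLocalRing.residue_eq_zero_iff,
      ← ValuationSubring.coe_mem_nonunits_iff]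
    refine (NumberField.mem_nonunits_adicCompletionIntegers_iff v).2 ?_
    rw [← valuedAdicCompletion_eq_valuation'] at ha
    have h := Valuation.map_sub_lt _ ha hc
    rw [Units.val_one] at h
    convert h using 2
    change algebraMap K (v.adicCompletion K) (algebraMap (𝓞 K) K a) - (x : v.adicCompletion K) =
      algebraMap K (v.adicCompletion K) (algebraMap (𝓞 K) K a - c) - _
    rw [map_sub]
    ring
  have hker : ∀ a ∈ v.asIdeal, f a = 0 := by
    intro a ha
    refine (IsLocalRing.residue_eq_zero_iff _).2 ?_
    rw [← ValuationSubring.coe_mem_nonunits_iff,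
      NumberField.mem_nonunits_adicCompletionIntegers_iff]
    change Valued.v (algebraMap K (v.adicCompletion K) (algebraMap (𝓞 K) K a)) < 1
    rwa [← valuation_lt_one_iff_mem (K := K), ← valuedAdicCompletion_eq_valuation'] at ha
  exact Finite.of_surjective _ (Ideal.Quotient.lift_surjective_of_surjective _ hker hsurj)

/-- A finite Galois extension of `K_v` has a Galois stable valuation ring with finite residue
field which extends the valuation ring of `K_v`. -/
theorem NumberField.exists_valuationSubring_extension (L : Type) [Field L]
    [Algebra (v.adicCompletion K) L] [FiniteDimensional (v.adicCompletion K) L] :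
    ∃ O : ValuationSubring L, (∀ τ : L ≃ₐ[v.adicCompletion K] L, ∀ y ∈ O, τ y ∈ O) ∧
      (∀ c, algebraMap (v.adicCompletion K) L c ∈ O ↔ c ∈ v.adicCompletionIntegers K) ∧
      Finite (IsLocalRing.ResidueField O) := by
  let _ : NontriviallyNormedField (v.adicCompletion K) :=
    Valued.toNontriviallyNormedField _ (WithZero (Multiplicative ℤ))
  have : CharZero (v.adicCompletion K) :=
    charZero_of_injective_algebraMap (algebraMap K (v.adicCompletion K)).injective
  have := NumberField.finite_residueField_adicCompletionIntegers v
  have hV : ∀ c, c ∈ v.adicCompletionIntegers K ↔ ‖c‖ ≤ 1 := fun c =>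
    (mem_adicCompletionIntegers _ _ _).trans Valued.toNormedField.norm_le_one_iff.symm
  have : IsUltrametricDist (v.adicCompletion K) := inferInstance
  refine ⟨spectralValuationSubring (v.adicCompletion K) L, fun τ y hy => ?_, fun c => ?_, ?_⟩
  · rwa [mem_spectralValuationSubring, ← spectralNorm_eq_of_equiv]
  · rw [hV, mem_spectralValuationSubring, spectralNorm_extends]
  · exact finite_residueField_spectralValuationSubring (v.adicCompletionIntegers K) hV

end AdicCompletionExtension

section RootsOfUnityModulo

open Polynomial

theorem ValuationSubring.sum_mem_nonunits {K ι : Type} [Field K] (V : ValuationSubring K)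
    {s : Finset ι} {f : ι → K} (h : ∀ i ∈ s, f i ∈ V.nonunits) : ∑ i ∈ s, f i ∈ V.nonunits :=
  (ValuationSubring.mem_nonunits_iff _).2 (Valuation.map_sum_lt _ one_ne_zero fun i hi =>
    (ValuationSubring.mem_nonunits_iff _).1 (h i hi))

theorem ValuationSubring.sub_mem_nonunits {K : Type} [Field K] (V : ValuationSubring K) {x y : K}
    (hx : x ∈ V.nonunits) (hy : y ∈ V.nonunits) : x - y ∈ V.nonunits :=
  (ValuationSubring.mem_nonunits_iff _).2 (Valuation.map_sub_lt _
    ((ValuationSubring.mem_nonunits_iff _).1 hx) ((ValuationSubring.mem_nonunits_iff _).1 hy))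

theorem SplitsModulo.exists_eval_mem_nonunits {K : Type} [Field K] {V : ValuationSubring K}
    {f : K[X]} (h : SplitsModulo V f) (hf : f.Monic) (hdeg : f.natDegree ≠ 0) :
    ∃ a ∈ V, f.eval a ∈ V.nonunits := by
  obtain ⟨-, s, hs, hfs⟩ := h
  rcases s.empty_or_exists_mem with rfl | ⟨a, ha⟩
  · have h1 := hfs f.natDegree
    rw [Multiset.map_zero, Multiset.prod_zero, coeff_sub, coeff_one, if_neg hdeg,
      hf.coeff_natDegree, sub_zero] at h1
    exact absurd h1 ValuationSubring.one_notMem_nonunits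
  · refine ⟨a, hs a ha, ?_⟩
    have h0 : (s.map fun a => X - C a).prod.eval a = 0 := by
      rw [eval_multiset_prod, Multiset.map_map]
      exact Multiset.prod_eq_zero (Multiset.mem_map.2 ⟨a, ha, by simp⟩)
    rw [← sub_zero (f.eval a), ← h0, ← eval_sub, eval_eq_sum]
    exact V.sum_mem_nonunits fun n _ => by
      dsimp only
      rw [mul_comm]
      exact ValuationSubring.mul_mem_nonunits (V.toSubring.pow_mem (hs a ha) n) (hfs n)

theorem ValuationSubring.coeff_cyclotomic_mem {M : Type} [Field M] (W : ValuationSubring M)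
    (p n : ℕ) : (cyclotomic p M).coeff n ∈ W := by
  rw [← map_cyclotomic_int, coeff_map]
  exact intCast_mem W _

theorem ValuationSubring.mem_of_pow_eq_one {M : Type} [Field M] (W : ValuationSubring M)
    {p : ℕ} (hp : p ≠ 0) {η : M} (hη : η ^ p = 1) : η ∈ W := by
  rcases W.mem_or_inv_mem η with h | h
  · exact h
  · have : η = η⁻¹ ^ (p - 1) := by
      rw [inv_pow]
      refine eq_inv_of_mul_eq_one_left ?_
      rw [← pow_succ', Nat.sub_add_cancel (Nat.one_le_iff_ne_zero.2 hp), hη]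
    rw [this]
    exact W.toSubring.pow_mem h _

theorem IsPrimitiveRoot.natCast_mem_nonunits {M : Type} [Field M] (W : ValuationSubring M)
    {p : ℕ} (hp : p.Prime) {η : M} (hη : IsPrimitiveRoot η p) (h : 1 - η ∈ W.nonunits) :
    (p : M) ∈ W.nonunits := by
  have : Fact p.Prime := ⟨hp⟩
  have h1 := (W.eval_mem_and_sub_mem_nonunits (W.coeff_cyclotomic_mem p) W.one_mem
    (W.mem_of_pow_eq_one hp.ne_zero hη.pow_eq_one) h).2
  rwa [eval_one_cyclotomic_prime, (hη.isRoot_cyclotomic hp.pos).eq_zero, sub_zero] at h1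

theorem exists_isPrimitiveRoot_of_eval_mem_nonunits {Ω M : Type} [Field Ω] [Field M] [Algebra Ω M]
    [CharZero Ω] {V : ValuationSubring Ω} {W : ValuationSubring M} {p : ℕ} (hp : p.Prime)
    [IsCyclotomicExtension {p} Ω M]
    (hVW : ∀ c, algebraMap Ω M c ∈ W ↔ c ∈ V)
    (hW : ∀ τ : M ≃ₐ[Ω] M, ∀ y ∈ W, τ y ∈ W) (hpV : (p : Ω) ∉ V.nonunits)
    {a : Ω} (ha : a ∈ V) (h : (cyclotomic p Ω).eval a ∈ V.nonunits) :
    ∃ ζ : Ω, IsPrimitiveRoot ζ p := by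
  have : NeZero p := ⟨hp.ne_zero⟩
  have : NeZero (p : Ω) := ⟨Nat.cast_ne_zero.2 hp.ne_zero⟩
  have : NeZero (p : M) := NeZero.nat_of_injective (algebraMap Ω M).injective
  have : IsGalois Ω M := IsCyclotomicExtension.isGalois {p} Ω M
  have : FiniteDimensional Ω M := IsCyclotomicExtension.finiteDimensional {p} Ω M
  have hroot := IsCyclotomicExtension.zeta_spec p Ω M
  have hpM : (p : M) ∉ W.nonunits := by
    rw [← map_natCast (algebraMap Ω M), ValuationSubring.mem_nonunits_algebraMap_iff hVW]
    exact hpV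
  have haW := (hVW a).2 ha
  have h1 : (cyclotomic p M).eval (algebraMap Ω M a) ∈ W.nonunits := by
    rw [← map_cyclotomic p (algebraMap Ω M), eval_map_apply,
      ValuationSubring.mem_nonunits_algebraMap_iff hVW]
    exact h
  rw [cyclotomic_eq_prod_X_sub_primitiveRoots hroot, eval_prod] at h1
  have hmemW : ∀ η : M, η ^ p = 1 → η ∈ W := fun η => W.mem_of_pow_eq_one hp.ne_zero
  obtain ⟨b, hb, hbW⟩ := ValuationSubring.exists_mem_of_prod_mem_nonunits
    ((primitiveRoots p M).val.map fun η => (X - C η).eval (algebraMap Ω M a)) h1 (by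
      intro b hb
      obtain ⟨η, hη, rfl⟩ := Multiset.mem_map.1 hb
      rw [eval_sub, eval_X, eval_C]
      exact sub_mem haW (hmemW η (isPrimitiveRoot_of_mem_primitiveRoots hη).pow_eq_one))
  obtain ⟨η, hη, rfl⟩ := Multiset.mem_map.1 hb
  have hη := isPrimitiveRoot_of_mem_primitiveRoots hη
  rw [eval_sub, eval_X, eval_C] at hbW
  have hfix : ∀ τ : M ≃ₐ[Ω] M, τ η = η := by
    intro τ
    have h2 : algebraMap Ω M a - τ η ∈ W.nonunits := by
      have := ValuationSubring.map_mem_nonunits (σ := τ) (fun x hx => ?_) hbW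
      · rwa [map_sub, τ.commutes] at this
      · simpa using hW τ⁻¹ _ hx
    have hη0 := hη.ne_zero hp.ne_zero
    have hpow : (τ η / η) ^ p = 1 := by
      rw [div_pow, ← map_pow, hη.pow_eq_one, map_one, div_one]
    by_contra hne
    have hprim : IsPrimitiveRoot (τ η / η) p := by
      have : Fact p.Prime := ⟨hp⟩
      exact IsPrimitiveRoot.iff_orderOf.2
        (orderOf_eq_prime hpow (by rwa [ne_eq, div_eq_one_iff_eq hη0]))
    refine hpM (hprim.natCast_mem_nonunits W hp ?_)
    have h3 : 1 - τ η / η = η⁻¹ * ((algebraMap Ω M a - τ η) - (algebraMap Ω M a - η)) := by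
      field_simp
      ring
    rw [h3]
    exact ValuationSubring.mul_mem_nonunits
      (hmemW _ (by rw [inv_pow, hη.pow_eq_one, inv_one])) (W.sub_mem_nonunits h2 hbW)
  obtain ⟨ζ, rfl⟩ := (IsGalois.mem_range_algebraMap_iff_fixed η).2 hfix
  exact ⟨ζ, hη.of_map_of_injective (algebraMap Ω M).injective⟩

end RootsOfUnityModulo

section KummerBiextension

open Polynomial

/-- The Kummer character `τ ↦ τ α / α` of an element `α` whose `p`-th power lies in the base. -/
def kummerCharacter {Ω L : Type} [Field Ω] [Field L] [Algebra Ω L] {p : ℕ} [NeZero p]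
    (hfix : ∀ η : L, η ^ p = 1 → ∀ τ : L ≃ₐ[Ω] L, τ η = η) {α : L} (hα : α ≠ 0) {a : Ω}
    (h : α ^ p = algebraMap Ω L a) : (L ≃ₐ[Ω] L) →* rootsOfUnity p L :=
  have hpow (τ : L ≃ₐ[Ω] L) : (τ α / α) ^ p = 1 := by
    rw [div_pow, ← map_pow, h, τ.commutes, ← h, div_self (pow_ne_zero _ hα)]
  { toFun τ := rootsOfUnity.mkOfPowEq (τ α / α) (hpow τ)
    map_one' := by
      ext
      rw [rootsOfUnity.val_mkOfPowEq_coe]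
      simp [hα]
    map_mul' σ τ := by
      ext
      push_cast
      rw [rootsOfUnity.val_mkOfPowEq_coe, rootsOfUnity.val_mkOfPowEq_coe,
        rootsOfUnity.val_mkOfPowEq_coe, AlgEquiv.mul_apply, ← hfix _ (hpow τ) σ, map_div₀]
      have : σ α ≠ 0 := (map_ne_zero σ).2 hα
      field_simp }

theorem kummerCharacter_mul {Ω L : Type} [Field Ω] [Field L] [Algebra Ω L] {p : ℕ} [NeZero p]
    (hfix : ∀ η : L, η ^ p = 1 → ∀ τ : L ≃ₐ[Ω] L, τ η = η) {α : L} (hα : α ≠ 0) {a : Ω}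
    (h : α ^ p = algebraMap Ω L a) (τ : L ≃ₐ[Ω] L) :
    τ α = ((kummerCharacter hfix hα h τ : Lˣ) : L) * α := by
  change τ α = ((rootsOfUnity.mkOfPowEq (τ α / α) _ : Lˣ) : L) * α
  rw [rootsOfUnity.val_mkOfPowEq_coe, div_mul_cancel₀ _ hα]

variable {Ω L : Type} [Field Ω] [Field L] [Algebra Ω L] {p : ℕ} {a b : Ω}
  [IsSplittingField Ω L ((X ^ p - C a) * (X ^ p - C b))]

theorem exists_pow_eq_of_isSplittingField (hp : p.Prime) :
    (∃ α : L, α ^ p = algebraMap Ω L a) ∧ ∃ β : L, β ^ p = algebraMap Ω L b := by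
  have hs := IsSplittingField.splits L ((X ^ p - C a) * (X ^ p - C b))
  rw [Polynomial.map_mul] at hs
  have key : ∀ c : Ω, (X ^ p - C c).map (algebraMap Ω L) ∣
      (X ^ p - C a).map (algebraMap Ω L) * (X ^ p - C b).map (algebraMap Ω L) →
      ∃ α : L, α ^ p = algebraMap Ω L c := by
    intro c hc
    have hne : ∀ c : Ω, (X ^ p - C c).map (algebraMap Ω L) ≠ 0 := fun c =>
      ((monic_X_pow_sub_C c hp.ne_zero).map _).ne_zero
    obtain ⟨α, hα⟩ := (hs.of_dvd (mul_ne_zero (hne a) (hne b)) hc).exists_eval_eq_zero (by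
      rw [degree_map, degree_X_pow_sub_C hp.pos]
      exact_mod_cast hp.ne_zero)
    exact ⟨α, by simpa [sub_eq_zero] using hα⟩
  exact ⟨key a (dvd_mul_right _ _), key b (dvd_mul_left _ _)⟩

theorem exists_injective_kummerCharacter (hp : p.Prime) {ζ : Ω} (hζ : IsPrimitiveRoot ζ p)
    (ha : a ≠ 0) (hb : b ≠ 0) :
    ∃ (α β : L) (χ ψ : (L ≃ₐ[Ω] L) →* rootsOfUnity p L), α ^ p = algebraMap Ω L a ∧
      β ^ p = algebraMap Ω L b ∧ (∀ τ, τ α = ((χ τ : Lˣ) : L) * α) ∧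
      (∀ τ, τ β = ((ψ τ : Lˣ) : L) * β) ∧ Function.Injective (χ.prod ψ) := by
  have : NeZero p := ⟨hp.ne_zero⟩
  have hζL := hζ.map_of_injective (algebraMap Ω L).injective
  have hfix : ∀ η : L, η ^ p = 1 → ∀ τ : L ≃ₐ[Ω] L, τ η = η := by
    intro η hη τ
    obtain ⟨i, -, rfl⟩ := hζL.eq_pow_of_pow_eq_one hη
    rw [map_pow, τ.commutes]
  obtain ⟨⟨α, hα⟩, β, hβ⟩ := exists_pow_eq_of_isSplittingField (L := L) (a := a) (b := b) hp
  have hα0 : α ≠ 0 := by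
    rintro rfl
    rw [zero_pow hp.ne_zero] at hα
    exact ha ((map_eq_zero _).1 hα.symm)
  have hβ0 : β ≠ 0 := by
    rintro rfl
    rw [zero_pow hp.ne_zero] at hβ
    exact hb ((map_eq_zero _).1 hβ.symm)
  refine ⟨α, β, kummerCharacter hfix hα0 hα, kummerCharacter hfix hβ0 hβ, hα, hβ,
    kummerCharacter_mul hfix hα0 hα, kummerCharacter_mul hfix hβ0 hβ, ?_⟩
  refine (injective_iff_map_eq_one _).2 fun τ hτ => ?_
  rw [MonoidHom.prod_apply, Prod.mk_eq_one] at hτ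
  have hτα := kummerCharacter_mul hfix hα0 hα τ
  have hτβ := kummerCharacter_mul hfix hβ0 hβ τ
  rw [hτ.1, OneMemClass.coe_one, Units.val_one, one_mul] at hτα
  rw [hτ.2, OneMemClass.coe_one, Units.val_one, one_mul] at hτβ
  have hroot : ∀ γ : L, γ ≠ 0 → τ γ = γ → ∀ r : L, r ^ p = γ ^ p → τ r = r := by
    intro γ hγ0 hγ r hr
    have h1 := hfix (r / γ) (by rw [div_pow, hr, div_self (pow_ne_zero _ hγ0)]) τ
    rw [map_div₀, hγ] at h1
    exact (div_left_inj' hγ0).1 h1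
  have htop := IsSplittingField.adjoin_rootSet L ((X ^ p - C a) * (X ^ p - C b))
  have heq : (τ : L →ₐ[Ω] L) = AlgHom.id Ω L := by
    refine AlgHom.ext_of_adjoin_eq_top htop fun r hr => ?_
    have hr := (mem_rootSet.1 hr).2
    rw [map_mul, mul_eq_zero, map_sub, map_sub, map_pow, aeval_X, aeval_C, aeval_C, sub_eq_zero,
      sub_eq_zero, ← hα, ← hβ] at hr
    rcases hr with hr | hr
    · exact hroot α hα0 hτα r hr
    · exact hroot β hβ0 hτβ r hr
  ext x
  exact DFunLike.congr_fun heq x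

theorem not_isCyclic_of_isSplittingField [IsGalois Ω L] [FiniteDimensional Ω L] (hp : p.Prime)
    {ζ : Ω} (hζ : IsPrimitiveRoot ζ p) (ha : ∀ c, c ^ p ≠ a) (hb : ∀ (j : ℕ) c, c ^ p ≠ b * a ^ j) :
    ¬ IsCyclic (L ≃ₐ[Ω] L) := by
  have : NeZero p := ⟨hp.ne_zero⟩
  have ha0 : a ≠ 0 := fun h => ha 0 (by rw [h, zero_pow hp.ne_zero])
  have hb0 : b ≠ 0 := fun h => hb 0 0 (by rw [h, zero_mul, zero_pow hp.ne_zero])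
  obtain ⟨α, β, χ, ψ, hα, hβ, hχ, hψ, -⟩ :=
    exists_injective_kummerCharacter (L := L) hp hζ ha0 hb0
  rintro ⟨σ, hσ⟩
  have hfixed : ∀ x : L, σ x = x → ∃ c, algebraMap Ω L c = x := by
    intro x hx
    refine (IsGalois.mem_range_algebraMap_iff_fixed x).2 fun τ => ?_
    exact Subgroup.zpowers_le (H := MulAction.stabilizer (L ≃ₐ[Ω] L) x).2 hx (hσ τ)
  by_cases h : χ σ = 1
  · obtain ⟨c, rfl⟩ := hfixed α (by rw [hχ, h, OneMemClass.coe_one, Units.val_one, one_mul])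
    rw [← map_pow] at hα
    exact ha c ((algebraMap Ω L).injective hα)
  · have hχσ : IsPrimitiveRoot ((χ σ : Lˣ) : L) p := by
      have : Fact p.Prime := ⟨hp⟩
      have hpow : ((χ σ : Lˣ) : L) ^ p = 1 := by
        rw [← Units.val_pow_eq_pow_val, (χ σ).2, Units.val_one]
      exact IsPrimitiveRoot.iff_orderOf.2 (orderOf_eq_prime hpow fun h1 => h (by ext; exact h1))
    obtain ⟨j, -, hj⟩ := hχσ.eq_pow_of_pow_eq_one (ξ := ((ψ σ : Lˣ) : L)⁻¹) (by
      rw [inv_pow, ← Units.val_pow_eq_pow_val, (ψ σ).2, Units.val_one, inv_one])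
    obtain ⟨c, hc⟩ := hfixed (β * α ^ j) (by
      rw [map_mul, map_pow, hχ, hψ, mul_pow, hj, mul_mul_mul_comm,
        mul_inv_cancel₀ (Units.ne_zero _), one_mul])
    refine hb j c ((algebraMap Ω L).injective ?_)
    rw [map_mul, map_pow, map_pow, hc, ← hα, ← hβ]
    ring

/-- If `a` and `b` are independent modulo `p`-th powers and the base contains the `p`-th roots of
unity, then adjoining `p`-th roots of `a` and `b` gives a noncyclic abelian extension. -/
theorem exists_kummer_biextension {Ω : Type} [Field Ω] [CharZero Ω] {p : ℕ} (hp : p.Prime)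
    {ζ : Ω} (hζ : IsPrimitiveRoot ζ p) {a b : Ω} (ha : ∀ c, c ^ p ≠ a)
    (hb : ∀ (j : ℕ) c, c ^ p ≠ b * a ^ j) :
    ∃ (L : Type) (_ : Field L) (_ : Algebra Ω L), FiniteDimensional Ω L ∧ IsGalois Ω L ∧
      ¬ IsCyclic (L ≃ₐ[Ω] L) ∧ Nat.card (rootsOfUnity p L) = p ∧
      ∃ f : (L ≃ₐ[Ω] L) →* rootsOfUnity p L × rootsOfUnity p L, Function.Injective f := by
  have : NeZero p := ⟨hp.ne_zero⟩
  have ha0 : a ≠ 0 := fun h => ha 0 (by rw [h, zero_pow hp.ne_zero])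
  have hb0 : b ≠ 0 := fun h => hb 0 0 (by rw [h, zero_mul, zero_pow hp.ne_zero])
  let q := (X ^ p - C a) * (X ^ p - C b)
  have : FiniteDimensional Ω q.SplittingField := IsSplittingField.finiteDimensional _ q
  have : IsGalois Ω q.SplittingField :=
    { to_normal := Normal.of_isSplittingField q }
  obtain ⟨-, -, χ, ψ, -, -, -, -, hinj⟩ :=
    exists_injective_kummerCharacter (L := q.SplittingField) hp hζ ha0 hb0
  refine ⟨q.SplittingField, inferInstance, inferInstance, ‹_›, ‹_›,
    not_isCyclic_of_isSplittingField hp hζ ha hb, ?_, _, hinj⟩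
  exact (hζ.map_of_injective (algebraMap Ω q.SplittingField).injective).card_rootsOfUnity

end KummerBiextension

section LocalBiextension

open Polynomial HeightOneSpectrum

/-- If a `p`-th root of unity does not become trivial in the finite residue field, then some unit
is not a `p`-th power. -/
theorem ValuationSubring.exists_unit_forall_pow_ne {Ω : Type} [Field Ω] (V : ValuationSubring Ω)
    [Finite (IsLocalRing.ResidueField V)] {p : ℕ} (hp : p.Prime) (hpV : (p : Ω) ∉ V.nonunits)
    {ζ : Ω} (hζ : IsPrimitiveRoot ζ p) :
    ∃ u ∈ V, u ∉ V.nonunits ∧ ∀ c : Ω, c ^ p ≠ u := by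
  have hζV := V.mem_of_pow_eq_one hp.ne_zero hζ.pow_eq_one
  let k := IsLocalRing.ResidueField V
  let z : k := IsLocalRing.residue V ⟨ζ, hζV⟩
  have hz : z ≠ 1 := by
    intro h
    refine hpV (hζ.natCast_mem_nonunits V hp ?_)
    have h1 : IsLocalRing.residue V (1 - ⟨ζ, hζV⟩) = 0 := by
      rw [map_sub, map_one, sub_eq_zero]
      exact h.symm
    rw [IsLocalRing.residue_eq_zero_iff, ← ValuationSubring.coe_mem_nonunits_iff] at h1
    exact h1
  have hzp : z ^ p = 1 := by
    rw [← map_pow, ← map_one (IsLocalRing.residue V)]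
    congr 1
    ext
    exact hζ.pow_eq_one
  have hns : ¬ Function.Surjective fun x : k => x ^ p := fun h =>
    hz (Finite.injective_iff_surjective.2 h (by simp [hzp]))
  obtain ⟨y, hy⟩ := not_forall.1 hns
  obtain ⟨u, rfl⟩ := IsLocalRing.residue_surjective y
  refine ⟨u, u.2, fun hu => hy ⟨0, ?_⟩, fun c hc => hy ?_⟩
  · rw [ValuationSubring.coe_mem_nonunits_iff, ← IsLocalRing.residue_eq_zero_iff] at hu
    rw [hu]
    exact zero_pow hp.ne_zero
  · have hcV : c ∈ V := by
      rw [← ValuationSubring.valuation_le_one_iff]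
      refine (pow_le_one_iff hp.ne_zero).1 ?_
      rw [← map_pow, hc]
      exact V.valuation_le_one u
    refine ⟨IsLocalRing.residue V ⟨c, hcV⟩, ?_⟩
    dsimp only
    rw [← map_pow]
    congr 1
    ext
    exact hc

variable {K : Type} [Field K] [NumberField K] (v : HeightOneSpectrum (𝓞 K))

theorem NumberField.exists_isPrimitiveRoot_adicCompletion {p : ℕ} (hp : p.Prime)
    (hpv : (p : v.adicCompletion K) ∉ (v.adicCompletionIntegers K).nonunits)
    (h : SplitsModulo (v.valuation K).valuationSubring (cyclotomic p K)) :
    ∃ ζ : v.adicCompletion K, IsPrimitiveRoot ζ p := by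
  have : NeZero p := ⟨hp.ne_zero⟩
  have : CharZero (v.adicCompletion K) :=
    charZero_of_injective_algebraMap (algebraMap K (v.adicCompletion K)).injective
  have : FiniteDimensional (v.adicCompletion K) (CyclotomicField p (v.adicCompletion K)) :=
    IsCyclotomicExtension.finiteDimensional {p} _ _
  obtain ⟨a, ha, hav⟩ := h.exists_eval_mem_nonunits (cyclotomic.monic p K) (by
    rw [natDegree_cyclotomic]
    exact (Nat.totient_pos.2 hp.pos).ne')
  obtain ⟨W, hW, hVW, -⟩ := NumberField.exists_valuationSubring_extension v
    (CyclotomicField p (v.adicCompletion K))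
  refine exists_isPrimitiveRoot_of_eval_mem_nonunits hp hVW hW hpv
    (a := algebraMap K (v.adicCompletion K) a) ?_ ?_
  · rw [mem_adicCompletionIntegers]
    exact (valuedAdicCompletion_eq_valuation' v a).trans_le ha
  · rw [← map_cyclotomic p (algebraMap K (v.adicCompletion K)), eval_map_apply,
      NumberField.mem_nonunits_adicCompletionIntegers_iff]
    exact (valuedAdicCompletion_eq_valuation' v _).trans_lt
      ((Valuation.mem_nonunits_valuationSubring_iff _).1 hav)

theorem NumberField.exists_biextension_adicCompletion {p : ℕ} (hp : p.Prime)
    (hpv : SplitsModulo (v.valuation K).valuationSubring (X - C (p : K)⁻¹))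
    (h : SplitsModulo (v.valuation K).valuationSubring (cyclotomic p K)) :
    ∃ (L : Type) (_ : Field L) (_ : Algebra (v.adicCompletion K) L),
      FiniteDimensional (v.adicCompletion K) L ∧ IsGalois (v.adicCompletion K) L ∧
      ¬ IsCyclic (L ≃ₐ[v.adicCompletion K] L) ∧ Nat.card (rootsOfUnity p L) = p ∧
      ∃ f : (L ≃ₐ[v.adicCompletion K] L) →* rootsOfUnity p L × rootsOfUnity p L,
        Function.Injective f := by
  have : CharZero (v.adicCompletion K) :=
    charZero_of_injective_algebraMap (algebraMap K (v.adicCompletion K)).injective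
  have := NumberField.finite_residueField_adicCompletionIntegers v
  have hpv' : (p : v.adicCompletion K) ∉ (v.adicCompletionIntegers K).nonunits := by
    have h0 := hpv.1 0
    rw [coeff_sub, coeff_X_zero, coeff_C_zero, zero_sub, neg_mem_iff,
      Valuation.mem_valuationSubring_iff, ← valuedAdicCompletion_eq_valuation'] at h0
    change Valued.v (algebraMap K (v.adicCompletion K) (p : K)⁻¹) ≤ 1 at h0
    rw [map_inv₀, map_natCast] at h0
    rw [ValuationSubring.mem_nonunits_iff_or, mem_adicCompletionIntegers]
    rintro (h | h)
    · exact hp.ne_zero (Nat.cast_eq_zero.1 h)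
    · exact h h0
  obtain ⟨ζ, hζ⟩ := NumberField.exists_isPrimitiveRoot_adicCompletion v hp hpv' h
  obtain ⟨u, hu, hu', hup⟩ := (v.adicCompletionIntegers K).exists_unit_forall_pow_ne hp hpv' hζ
  obtain ⟨π, hπ⟩ := v.valuation_exists_uniformizer K
  refine exists_kummer_biextension hp hζ hup (b := algebraMap K (v.adicCompletion K) π) ?_
  intro j c hc
  have hvu : Valued.v u = 1 := by
    rw [mem_adicCompletionIntegers] at hu
    rw [NumberField.mem_nonunits_adicCompletionIntegers_iff] at hu'
    exact hu.antisymm (not_lt.1 hu')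
  have hvc := congrArg Valued.v hc
  rw [map_mul, map_pow, map_pow, hvu, one_pow, mul_one] at hvc
  have hvπ : Valued.v (algebraMap K (v.adicCompletion K) π) = WithZero.exp (-1 : ℤ) :=
    (valuedAdicCompletion_eq_valuation' v π).trans hπ
  rw [hvπ] at hvc
  have hlog := congrArg WithZero.log hvc
  rw [WithZero.log_pow, WithZero.log_exp, nsmul_eq_mul] at hlog
  have : (p : ℤ) ∣ 1 := ⟨-WithZero.log (Valued.v c), by linarith⟩
  exact hp.one_lt.ne' (Nat.dvd_one.1 (by exact_mod_cast this))

end LocalBiextension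

section ElementaryAbelianSubgroup

theorem isCyclic_of_forall_prime_card_pow_eq_one_le {H : Type} [CommGroup H] [Fintype H]
    [DecidableEq H]
    (h : ∀ p : ℕ, p.Prime → (Finset.univ.filter fun x : H => x ^ p = 1).card ≤ p) :
    IsCyclic H := by
  refine isCyclic_of_card_pow_eq_one_le fun n hn => ?_
  induction n using Nat.recOnMul with
  | zero => exact absurd hn (lt_irrefl 0)
  | one => simp [Finset.filter_eq']
  | prime p hp => exact h p hp
  | mul m n hm hn' =>
    have hm0 : 0 < m := Nat.pos_of_mul_pos_right hn
    have hn0 : 0 < n := Nat.pos_of_mul_pos_left hn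
    refine (Finset.card_le_mul_card_image_of_maps_to (f := fun x : H => x ^ m)
      (t := Finset.univ.filter fun x : H => x ^ n = 1) ?_ m fun b _ => ?_).trans
      (Nat.mul_le_mul_left m (hn' hn0))
    · intro x hx
      simpa [← pow_mul] using hx
    · rcases Finset.eq_empty_or_nonempty (Finset.filter (fun x : H => x ^ m = b)
        (Finset.univ.filter fun x : H => x ^ (m * n) = 1)) with h0 | ⟨a, ha⟩
      · rw [h0, Finset.card_empty]
        exact Nat.zero_le m
      · refine (Finset.card_le_card_of_injOn (fun x => x / a) ?_
          (div_left_injective.injOn)).trans (hm hm0)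
        intro x hx
        have hx := (Finset.mem_filter.1 hx).2
        have ha := (Finset.mem_filter.1 ha).2
        simp [div_pow, hx, ha]

theorem exists_injective_prod_of_pow_eq_one {H C : Type} [CommGroup H] [Finite H] [CommGroup C]
    {p : ℕ} (hp : p.Prime) (hC : Nat.card C = p) {x y : H} (hx : x ^ p = 1) (hx1 : x ≠ 1)
    (hy : y ^ p = 1) (hyx : y ∉ Subgroup.zpowers x) :
    ∃ f : C × C →* H, Function.Injective f := by
  have : Fact p.Prime := ⟨hp⟩
  have hcard : ∀ z : H, z ^ p = 1 → z ≠ 1 → Nat.card (Subgroup.zpowers z) = p := fun z hz hz1 => by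
    rw [Nat.card_zpowers, orderOf_eq_prime hz hz1]
  have hy1 : y ≠ 1 := fun h => hyx (h ▸ one_mem _)
  let e₁ : C ≃* Subgroup.zpowers x := mulEquivOfPrimeCardEq hC (hcard x hx hx1)
  let e₂ : C ≃* Subgroup.zpowers y := mulEquivOfPrimeCardEq hC (hcard y hy hy1)
  refine ⟨((Subgroup.subtype _).comp e₁.toMonoidHom).coprod
    ((Subgroup.subtype _).comp e₂.toMonoidHom), (injective_iff_map_eq_one _).2 ?_⟩
  rintro ⟨c, d⟩ h
  change (e₁ c : H) * (e₂ d : H) = 1 at h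
  have hd : e₂ d = 1 := by
    by_contra hd
    obtain ⟨n, hn⟩ := mem_zpowers_of_prime_card (hcard y hy hy1) hd
      (g' := ⟨y, Subgroup.mem_zpowers y⟩)
    refine hyx ?_
    have hn : (e₂ d : H) ^ n = y := congrArg Subtype.val hn
    rw [← hn, eq_inv_of_mul_eq_one_right h]
    exact zpow_mem (inv_mem (e₁ c).2) n
  rw [hd, OneMemClass.coe_one, mul_one] at h
  exact Prod.ext (e₁.map_eq_one_iff.1 (Subtype.ext h)) (e₂.map_eq_one_iff.1 hd)

/-- A finite group with a noncyclic abelian subgroup contains a product of two groups of the same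
prime order. -/
theorem exists_prime_injective_prod {G : Type} [Group G] [Finite G]
    (hG : ∃ H : Subgroup G, (∀ x y : H, x * y = y * x) ∧ ¬ IsCyclic H) :
    ∃ p : ℕ, p.Prime ∧ ∀ (C : Type) [CommGroup C], Nat.card C = p →
      ∃ f : C × C →* G, Function.Injective f := by
  obtain ⟨H, hcomm, hcyc⟩ := hG
  classical
  let _ : CommGroup H := { (inferInstance : Group H) with mul_comm := hcomm }
  have := Fintype.ofFinite H
  have hex : ∃ p : ℕ, p.Prime ∧ p < (Finset.univ.filter fun x : H => x ^ p = 1).card := by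
    by_contra! h
    exact hcyc (isCyclic_of_forall_prime_card_pow_eq_one_le h)
  obtain ⟨p, hp, hlt⟩ := hex
  refine ⟨p, hp, fun C _ hC => ?_⟩
  obtain ⟨x, hx, hx1⟩ := Finset.exists_mem_ne (hp.one_lt.trans hlt) 1
  have hx := (Finset.mem_filter.1 hx).2
  obtain ⟨y, hy, hyx⟩ : ∃ y ∈ Finset.univ.filter fun x : H => x ^ p = 1,
      y ∉ Finset.univ.filter fun y : H => y ∈ Subgroup.zpowers x := by
    by_contra! h
    have : Fact p.Prime := ⟨hp⟩
    have h1 := Finset.card_le_card h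
    rw [← Fintype.card_subtype (fun y => y ∈ Subgroup.zpowers x), ← Nat.card_eq_fintype_card] at h1
    have h2 : Nat.card (Subgroup.zpowers x) = p := by
      rw [Nat.card_zpowers, orderOf_eq_prime hx hx1]
    exact hlt.not_ge (h1.trans h2.le)
  obtain ⟨f, hf⟩ := exists_injective_prod_of_pow_eq_one (C := C) hp hC hx hx1
    (Finset.mem_filter.1 hy).2 fun h => hyx (Finset.mem_filter.2 ⟨Finset.mem_univ _, h⟩)
  exact ⟨H.subtype.comp f, H.subtype_injective.comp hf⟩

end ElementaryAbelianSubgroup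

section Main

open Polynomial Filter

/-- A local biextension that is a specialization of one of finitely many extensions gives rise to
noncyclic unramified data for one of them. -/
theorem NumberField.exists_isUnramifiedDatum_not_isCyclic {K F E : Type} [Field K] [NumberField K]
    [Field F] [Field E] [Algebra K F] [Algebra F E] [Algebra K E] [IsScalarTower K F E]
    [FiniteDimensional F E] [IsGalois F E] (hdep : PairwiseDependent K F)
    (v : HeightOneSpectrum (𝓞 K)) {L : Type} [Field L] [Algebra (v.adicCompletion K) L]
    [FiniteDimensional (v.adicCompletion K) L]
    (hL : ¬ IsCyclic (L ≃ₐ[v.adicCompletion K] L))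
    (h : IsSpecialization K F E (v.adicCompletion K) L) :
    ∃ (W : ValuationSubring E) (D : Subgroup (E ≃ₐ[F] E)),
      IsUnramifiedDatum (v.valuation K).valuationSubring W D ∧ ¬ IsCyclic D := by
  obtain ⟨O, hO, hO', hfin⟩ := NumberField.exists_valuationSubring_extension v L
  obtain ⟨W, D, hWD, hD⟩ := h.exists_isUnramifiedDatum hdep (v.valuation K).valuationSubring O hO
    (fun c hc => (hO' _).2 ((HeightOneSpectrum.valuedAdicCompletion_eq_valuation' v c).trans_le hc))
    (fun c hc => (ValuationSubring.mem_nonunits_algebraMap_iff hO').2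
      ((NumberField.mem_nonunits_adicCompletionIntegers_iff v).2
        ((HeightOneSpectrum.valuedAdicCompletion_eq_valuation' v c).trans_lt
          ((Valuation.mem_nonunits_valuationSubring_iff _).1 hc))))
  exact ⟨W, D, hWD, fun hc => hL (hD hc)⟩

/-- There is an ultrafilter family of primes modulo which every monic polynomial eventually
splits, and for which finitely many prescribed polynomials always split. -/
theorem NumberField.exists_ultrafilter_splitsModulo (K : Type) [Field K] [NumberField K]
    (T : Finset K[X]) (hT : ∀ f ∈ T, f.Monic) :
    ∃ (U : Ultrafilter (Finset K[X])) (v : Finset K[X] → HeightOneSpectrum (𝓞 K)),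
      (∀ i, ∀ f ∈ T, SplitsModulo ((v i).valuation K).valuationSubring f) ∧
      ∀ f : K[X], f.Monic → ∀ᶠ i in U, SplitsModulo ((v i).valuation K).valuationSubring f := by
  classical
  choose v hv using fun i : Finset K[X] =>
    NumberField.exists_forall_mem_splitsModulo (T ∪ i.filter Monic) fun f hf =>
      (Finset.mem_union.1 hf).elim (hT f) fun h => (Finset.mem_filter.1 h).2
  refine ⟨Ultrafilter.of atTop, v, fun i f hf => hv i f (Finset.mem_union_left _ hf),
    fun f hf => Ultrafilter.of_le atTop ?_⟩
  filter_upwards [eventually_ge_atTop {f}] with i hi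
  exact hv i f (Finset.mem_union_right _
    (Finset.mem_filter.2 ⟨hi (Finset.mem_singleton_self f), hf⟩))

/-- Theorem B.1 (thm:locdim_not1): if the finite group `G` contains a noncyclic abelian
subgroup, then no finite family of Galois extensions `E i / F i` with group `G`, where each
`F i` is a finitely generated field extension of the number field `K` of transcendence
degree `1`, can specialize to all local Galois extensions: there are a prime `v` of `K` and
a finite abelian noncyclic Galois extension `L/K_v` with group embedding into `G` which is a
specialization of no `E i / F i` over `K_v`.  In particular the local dimension of `G` over
`K` is at least `2`. -/
theorem local_dimension_ge_two (K : Type) [Field K] [NumberField K]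
    (G : Type) [Group G] [Finite G]
    (hG : ∃ H : Subgroup G, (∀ x y : H, x * y = y * x) ∧ ¬ IsCyclic H)
    (r : ℕ) (F E : Fin r → Type)
    [∀ i, Field (F i)] [∀ i, Field (E i)]
    [∀ i, Algebra K (F i)] [∀ i, Algebra (F i) (E i)]
    [∀ i, FiniteDimensional (F i) (E i)] [∀ i, IsGalois (F i) (E i)]
    (hGal : ∀ i, Nonempty ((E i ≃ₐ[F i] E i) ≃* G))
    (hfg : ∀ i, (⊤ : IntermediateField K (F i)).FG)
    (htr : ∀ i, ∃ x : F i, Transcendental K x ∧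
      Algebra.IsAlgebraic (IntermediateField.adjoin K {x}) (F i)) :
    ∃ (v : HeightOneSpectrum (𝓞 K)) (L : Type) (_ : Field L)
      (_ : Algebra (v.adicCompletion K) L),
      FiniteDimensional (v.adicCompletion K) L ∧
      IsGalois (v.adicCompletion K) L ∧
      (∀ σ τ : L ≃ₐ[v.adicCompletion K] L, σ * τ = τ * σ) ∧
      ¬ IsCyclic (L ≃ₐ[v.adicCompletion K] L) ∧
      (∃ f : (L ≃ₐ[v.adicCompletion K] L) →* G, Function.Injective f) ∧
      ∀ i, ¬ IsSpecialization K (F i) (E i) (v.adicCompletion K) L := by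
  classical
  obtain ⟨p, hp, hpG⟩ := exists_prime_injective_prod hG
  let _ : ∀ i, Algebra K (E i) := fun i =>
    ((algebraMap (F i) (E i)).comp (algebraMap K (F i))).toAlgebra
  have : ∀ i, IsScalarTower K (F i) (E i) := fun i => IsScalarTower.of_algebraMap_eq fun _ => rfl
  obtain ⟨U, v, hvT, hv⟩ := NumberField.exists_ultrafilter_splitsModulo K
    {X - C (p : K)⁻¹, cyclotomic p K} fun f hf => by
      rcases Finset.mem_insert.1 hf with rfl | hf
      · exact monic_X_sub_C _
      · exact Finset.mem_singleton.1 hf ▸ cyclotomic.monic p K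
  by_contra hcon
  have hspec (n : Finset K[X]) : ∃ i, ∃ WD : ValuationSubring (E i) × Subgroup (E i ≃ₐ[F i] E i),
      IsUnramifiedDatum ((v n).valuation K).valuationSubring WD.1 WD.2 ∧ ¬ IsCyclic WD.2 := by
    obtain ⟨L, _, _, hfd, hgal, hcyc, hcard, g, hg⟩ :=
      NumberField.exists_biextension_adicCompletion (v n) hp (hvT n _ (by simp))
        (hvT n _ (by simp))
    obtain ⟨f, hf⟩ := hpG (rootsOfUnity p L) hcard
    by_contra hn
    refine hcon ⟨v n, L, _, _, hfd, hgal, fun σ τ => hg ?_, hcyc, ⟨f.comp g, hf.comp hg⟩,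
      fun i hi => hn ?_⟩
    · rw [map_mul, map_mul, mul_comm]
    · obtain ⟨W, D, h⟩ := NumberField.exists_isUnramifiedDatum_not_isCyclic
        (PairwiseDependent.of_transcendental (htr i)) (v n) hcyc hi
      exact ⟨i, (W, D), h⟩
  obtain ⟨i, hi⟩ := Ultrafilter.eventually_exists_iff.1 (Eventually.of_forall hspec :
    ∀ᶠ n in (U : Filter (Finset K[X])), _)
  obtain ⟨WD, hWD⟩ := hi.choice
  have : Algebra.EssFiniteType K (F i) := IntermediateField.fg_top_iff.1 (hfg i)
  have : Algebra.EssFiniteType K (E i) := Algebra.EssFiniteType.comp K (F i) (E i)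
  obtain ⟨n, hn, hn'⟩ := ((eventually_isCyclic_of_isUnramifiedDatum
    (PairwiseDependent.of_transcendental (htr i)) U hv (hWD.mono fun n h => h.1)).and hWD).exists
  exact hn'.2 hn

end Main
end

section
/- For all rational numbers a₁, a₂, a₃, a₄, a₅, each nonzero, there exist ε ∈ {1, −1}, rational numbers x₁, x₂, x₃, x₄, and a nonzero rational number c such that a₁x₁² + a₂x₂² + a₃x₃² + a₄x₄² = ε · a₅ · c². -/
/-- The elementary relations between one-dimensional quadratic forms `⟨a⟩` in the Witt group. -/
inductive WittRel (K : Type*) [Field K] : Multiset K → Multiset K → Prop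
  | zero : WittRel K {0} 0
  | mul_sq (a b : K) (hb : b ≠ 0) : WittRel K {a * b ^ 2} {a}
  | add (a b : K) : WittRel K {a, b} {a + b, a * b * (a + b)}

/-- The group generated by symbols `⟨a⟩`, `a ∈ K`, modulo the Witt relations. In characteristic
different from two this is the Witt group of `K`. -/
def WittGroup (K : Type*) [Field K] : Type _ := (addConGen (WittRel K)).Quotient

namespace WittGroup

section Field

variable {K : Type*} [Field K]

instance : AddCommMonoid (WittGroup K) :=
  inferInstanceAs (AddCommMonoid (addConGen (WittRel K)).Quotient)

/-- The class of a diagonal quadratic form. -/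
def mk : Multiset K →+ WittGroup K := (addConGen (WittRel K)).mk'

/-- The class of the one-dimensional form `a x²`. -/
def of (a : K) : WittGroup K := mk {a}

lemma mk_eq_of_rel {s t : Multiset K} (h : WittRel K s t) : mk s = mk t :=
  (AddCon.eq _).2 (AddConGen.Rel.of _ _ h)

lemma mk_pair (a b : K) : mk {a, b} = of a + of b := by
  rw [Multiset.insert_eq_cons, ← Multiset.singleton_add, map_add]; rfl

@[simp] lemma of_zero : of (0 : K) = 0 := mk_eq_of_rel .zero

lemma of_mul_sq (a : K) {b : K} (hb : b ≠ 0) : of (a * b ^ 2) = of a :=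
  mk_eq_of_rel (.mul_sq a b hb)

lemma of_add_of (a b : K) : of a + of b = of (a + b) + of (a * b * (a + b)) := by
  simpa only [mk_pair] using mk_eq_of_rel (.add a b)

lemma of_add_of_neg (a : K) : of a + of (-a) = 0 := by
  simp [of_add_of]

@[elab_as_elim]
lemma induction {P : WittGroup K → Prop} (zero : P 0) (add_of : ∀ x a, P x → P (x + of a))
    (x : WittGroup K) : P x := by
  induction x using AddCon.induction_on with
  | H s =>
    change P (mk s)
    induction s using Multiset.induction with
    | empty => rwa [map_zero]
    | cons a s ih =>
      rw [← Multiset.singleton_add, add_comm, map_add]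
      exact add_of _ a ih

section Lift

variable {M : Type*} [AddCommMonoid M] (f : K → M) (zero : f 0 = 0)
  (mul_sq : ∀ a b, b ≠ 0 → f (a * b ^ 2) = f a)
  (add : ∀ a b, f a + f b = f (a + b) + f (a * b * (a + b)))

/-- The homomorphism induced by a function compatible with the Witt relations. -/
def lift : WittGroup K →+ M :=
  (addConGen (WittRel K)).lift (Multiset.sumAddMonoidHom.comp (Multiset.mapAddMonoidHom f)) <| by
    rw [AddCon.addConGen_le]
    rintro _ _ (_ | ⟨a, b, hb⟩ | ⟨a, b⟩)
    · simpa [AddCon.ker_rel] using zero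
    · simpa [AddCon.ker_rel] using mul_sq a b hb
    · simpa [AddCon.ker_rel] using add a b

@[simp] lemma lift_of (a : K) : lift f zero mul_sq add (of a) = f a := by
  change (Multiset.map f {a}).sum = f a
  simp

end Lift

instance : Neg (WittGroup K) :=
  ⟨lift (fun a => of (-a)) (by simp) (fun a b hb => by rw [← of_mul_sq (-a) hb]; ring_nf)
    (fun a b => by rw [of_add_of]; ring_nf)⟩

lemma neg_of (a : K) : -of a = of (-a) := lift_of ..

instance : AddCommGroup (WittGroup K) :=
  { (inferInstance : AddCommMonoid (WittGroup K)) with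
    neg := Neg.neg
    zsmul := zsmulRec
    neg_add_cancel := fun x => by
      induction x using induction with
      | zero => exact (add_zero _).trans (map_zero (lift (K := K) _ _ _ _))
      | add_of x a ih =>
        have h : -(x + of a) = -x + -of a := map_add (lift (K := K) _ _ _ _) x (of a)
        rw [h, neg_of, add_add_add_comm, ih, add_comm (of (-a)), of_add_of_neg, add_zero] }

lemma of_neg (a : K) : of (-a) = -of a := (neg_of a).symm

end Field

end WittGroup

section

open Module

lemma Submodule.finrank_le_finrank_map_add {K V W : Type*} [Field K] [AddCommGroup V] [Module K V]
    [FiniteDimensional K V] [AddCommGroup W] [Module K W] (F : V →ₗ[K] W) {N U : Submodule K V}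
    (h : N ⊓ LinearMap.ker F ≤ U) : finrank K N ≤ finrank K (N.map F) + finrank K U := by
  have h₁ := (F.domRestrict N).finrank_range_add_finrank_ker
  rw [LinearMap.range_domRestrict] at h₁
  have h₂ := finrank_map_subtype_eq N (LinearMap.ker (F.domRestrict N))
  rw [LinearMap.ker_domRestrict, Submodule.map_comap_subtype] at h₂
  have h₃ := Submodule.finrank_mono h
  rw [LinearMap.ker_domRestrict] at h₁
  omega

/-- The diagonal quadratic form `∑ wᵢ xᵢ²` has a totally isotropic subspace of the dimension
expected of a hyperbolic form, its radical being counted twice. -/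
def IsMetabolic {K ι : Type*} [Field K] [Fintype ι] (w : ι → K) : Prop :=
  ∃ N : Submodule K (ι → K), (∀ v ∈ N, ∑ i, w i * v i ^ 2 = 0) ∧
    Nat.card ι + Nat.card {i // w i = 0} ≤ 2 * finrank K N

namespace IsMetabolic

variable {K : Type*} [Field K] {ι κ : Type*} [Fintype ι] [Fintype κ]

lemma comp_equiv {w : ι → K} (h : IsMetabolic w) (e : κ ≃ ι) : IsMetabolic (w ∘ e) := by
  obtain ⟨N, hN, hd⟩ := h
  refine ⟨N.map (LinearEquiv.funCongrLeft K K e).toLinearMap, ?_, ?_⟩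
  · rintro _ ⟨v, hv, rfl⟩
    simpa using (e.sum_comp fun i => w i * v i ^ 2).trans (hN v hv)
  · rw [LinearEquiv.finrank_map_eq, Nat.card_congr e]
    rwa [Nat.card_congr (e.subtypeEquiv (p := fun i => (w ∘ e) i = 0) (q := fun i => w i = 0)
      fun _ => Iff.rfl)]

lemma of_map_eq {w : ι → K} {u : κ → K} (h : IsMetabolic w)
    (hwu : Finset.univ.val.map u = Finset.univ.val.map w) : IsMetabolic u := by
  classical
  have hcard (c : K) : Nonempty ({i // u i = c} ≃ {i // w i = c}) := by
    have h := congrArg (Multiset.count c) hwu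
    rw [Multiset.count_map, Multiset.count_map] at h
    refine ⟨Fintype.equivOfCardEq ?_⟩
    rw [Fintype.card_subtype, Fintype.card_subtype]
    simpa only [eq_comm, Finset.card_def, Finset.filter_val] using h
  let e : κ ≃ ι := Equiv.ofFiberEquiv fun c => (hcard c).some
  have he : u = w ∘ e := funext fun a => (Equiv.ofFiberEquiv_map _ a).symm
  exact he ▸ h.comp_equiv e

lemma sum_elim {w : ι → K} {u : κ → K} (hw : IsMetabolic w) (hu : IsMetabolic u) :
    IsMetabolic (Sum.elim w u) := by
  obtain ⟨N, hN, hd⟩ := hw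
  obtain ⟨N', hN', hd'⟩ := hu
  let F : (N × N') →ₗ[K] (ι ⊕ κ → K) :=
    (LinearEquiv.sumArrowLequivProdArrow ι κ K K).symm.toLinearMap ∘ₗ
      N.subtype.prodMap N'.subtype
  have hF : Function.Injective F :=
    (LinearEquiv.sumArrowLequivProdArrow ι κ K K).symm.injective.comp
      (N.injective_subtype.prodMap N'.injective_subtype)
  refine ⟨LinearMap.range F, ?_, ?_⟩
  · rintro _ ⟨⟨⟨v, hv⟩, ⟨v', hv'⟩⟩, rfl⟩
    simp [F, hN v hv, hN' v' hv']
  · rw [LinearMap.finrank_range_of_inj hF, Nat.card_sum, finrank_prod,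
      Nat.card_congr (Equiv.subtypeSum (p := fun i => Sum.elim w u i = 0)), Nat.card_sum]
    simp only [Sum.elim_inl, Sum.elim_inr]
    omega

/-- Removing a weight zero. -/
lemma of_sum_elim_zero {w : ι → K} (h : IsMetabolic (Sum.elim w (0 : Fin 1 → K))) :
    IsMetabolic w := by
  obtain ⟨N, hN, hd⟩ := h
  let F : (ι ⊕ Fin 1 → K) →ₗ[K] (ι → K) := LinearMap.funLeft K K Sum.inl
  let e : ι ⊕ Fin 1 → K := Sum.elim 0 1
  refine ⟨N.map F, ?_, ?_⟩
  · rintro _ ⟨v, hv, rfl⟩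
    simpa [F, LinearMap.funLeft] using hN v hv
  · have hker : N ⊓ LinearMap.ker F ≤ K ∙ e := by
      rintro v ⟨-, hv⟩
      refine Submodule.mem_span_singleton.2 ⟨v (.inr 0), ?_⟩
      ext (i | i)
      · simpa [e, F, LinearMap.funLeft] using (congrFun (LinearMap.mem_ker.1 hv) i).symm
      · simp [e, Subsingleton.elim i 0]
    have h₁ := Submodule.finrank_le_finrank_map_add F hker
    have h₂ : finrank K (K ∙ e) ≤ 1 := (finrank_span_le_card _).trans (by simp)
    rw [Nat.card_sum, Nat.card_congr (Equiv.subtypeSum (p := fun i => Sum.elim w 0 i = 0)),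
      Nat.card_sum] at hd
    have h₃ : Nat.card {i : Fin 1 // (0 : Fin 1 → K) i = 0} = 1 := by simp
    simp only [Sum.elim_inl, Sum.elim_inr, h₃, Nat.card_fin] at hd
    omega

/-- Removing a hyperbolic plane. -/
lemma of_sum_elim_neg (h2 : (2 : K) ≠ 0) {w : ι → K} {u : Fin 2 → K}
    (hu₀ : u 0 ≠ 0) (hu₁ : u 1 = -u 0)
    (h : IsMetabolic (Sum.elim w u)) :
    IsMetabolic w := by
  obtain ⟨N, hN, hd⟩ := h
  let F : (ι ⊕ Fin 2 → K) →ₗ[K] (ι → K) := LinearMap.funLeft K K Sum.inl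
  let l : (ι ⊕ Fin 2 → K) →ₗ[K] K := LinearMap.proj (.inr 0) - LinearMap.proj (.inr 1)
  let e : ι ⊕ Fin 2 → K := Sum.elim 0 1
  have hker : N ⊓ LinearMap.ker l ⊓ LinearMap.ker F ≤ N ⊓ K ∙ e := by
    rintro v ⟨⟨hv, hl⟩, hF⟩
    refine ⟨hv, Submodule.mem_span_singleton.2 ⟨v (.inr 0), ?_⟩⟩
    ext (i | i)
    · simpa [e, F, LinearMap.funLeft] using (congrFun (LinearMap.mem_ker.1 hF) i).symm
    · fin_cases i
      · simp [e]
      · simpa [e, l, sub_eq_zero] using hl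
  refine ⟨(N ⊓ LinearMap.ker l).map F, ?_, ?_⟩
  · rintro _ ⟨v, ⟨hv, hl⟩, rfl⟩
    have h₀ : v (.inr 0) = v (.inr 1) := by simpa [l, sub_eq_zero] using hl
    simpa [F, LinearMap.funLeft, h₀, hu₁] using hN v hv
  · have hzero : Nat.card {i // Sum.elim w u i = 0} = Nat.card {i // w i = 0} := by
      rw [Nat.card_congr (Equiv.subtypeSum (p := fun i => Sum.elim w u i = 0)), Nat.card_sum]
      have : IsEmpty {i : Fin 2 // u i = 0} := ⟨by simp [Fin.forall_fin_two, hu₀, hu₁]⟩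
      simp
    rw [hzero, Nat.card_sum, Nat.card_fin] at hd
    have h₁ := Submodule.finrank_le_finrank_map_add F hker
    have h₂ := Submodule.finrank_le_finrank_map_add l (le_refl (N ⊓ LinearMap.ker l))
    by_cases he : e ∈ N
    · have hmap : N.map l = ⊥ := by
        refine LinearMap.le_ker_iff_map.1 fun v hv => ?_
        have h₃ := hN _ (N.add_mem hv he)
        have h₄ := hN v hv
        simp only [Fintype.sum_sum_type, Fin.sum_univ_two, e, Pi.add_apply, Sum.elim_inl,
          Sum.elim_inr, Pi.zero_apply, Pi.one_apply, add_zero, hu₁] at h₃ h₄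
        have h₅ : 2 * u 0 * (v (.inr 0) - v (.inr 1)) = 0 := by linear_combination h₃ - h₄
        simpa [l, h2, hu₀] using h₅
      rw [hmap, finrank_bot] at h₂
      have h₃ := Submodule.finrank_mono (inf_le_right : N ⊓ K ∙ e ≤ K ∙ e)
      have h₄ : finrank K (K ∙ e) ≤ 1 := (finrank_span_le_card _).trans (by simp)
      omega
    · have hbot : N ⊓ K ∙ e = ⊥ := by
        rw [← disjoint_iff, Submodule.disjoint_span_singleton' (by
          intro h; simpa [e] using congrFun h (.inr 0))]
        exact he
      rw [hbot, finrank_bot] at h₁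
      have h₃ := Submodule.finrank_le (N.map l)
      rw [finrank_self] at h₃
      omega

end IsMetabolic

/-- The diagonal form with the given multiset of coefficients is metabolic. -/
def Multiset.IsMetabolic {K : Type*} [Field K] (s : Multiset K) : Prop :=
  _root_.IsMetabolic s.toList.get

namespace Multiset.IsMetabolic

lemma map_univ_get {K : Type*} (s : Multiset K) : Finset.univ.val.map s.toList.get = s := by
  rw [Fin.univ_val_map, List.ofFn_get, coe_toList]

lemma map_univ_sum_elim {K ι κ : Type*} [Fintype ι] [Fintype κ] (w : ι → K) (u : κ → K) :
    Finset.univ.val.map (Sum.elim w u) = Finset.univ.val.map w + Finset.univ.val.map u := by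
  simp [← Finset.univ_disjSum_univ, Finset.val_disjSum, Multiset.disjSum, Function.comp_def]

variable {K : Type*} [Field K]

lemma map_univ_iff {ι : Type*} [Fintype ι] (w : ι → K) :
    (Finset.univ.val.map w).IsMetabolic ↔ _root_.IsMetabolic w :=
  ⟨fun h => h.of_map_eq (map_univ_get _).symm, fun h => h.of_map_eq (map_univ_get _)⟩

lemma add {s t : Multiset K} (hs : s.IsMetabolic) (ht : t.IsMetabolic) : (s + t).IsMetabolic := by
  rw [← map_univ_get s, ← map_univ_get t, ← map_univ_sum_elim, map_univ_iff]
  exact hs.sum_elim ht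

lemma map_neg {s : Multiset K} (hs : s.IsMetabolic) : (s.map Neg.neg).IsMetabolic := by
  obtain ⟨N, hN, hd⟩ := hs
  rw [← map_univ_get s, Multiset.map_map, map_univ_iff]
  refine ⟨N, fun v hv => ?_, ?_⟩
  · simpa using hN v hv
  · simpa using hd

lemma of_add_zero {s : Multiset K} (h : (s + {0}).IsMetabolic) : s.IsMetabolic := by
  have h₁ : s + {0} = Finset.univ.val.map (Sum.elim s.toList.get (0 : Fin 1 → K)) := by
    rw [map_univ_sum_elim, map_univ_get]; simp
  rw [h₁, map_univ_iff] at h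
  exact h.of_sum_elim_zero

lemma of_add_pair_neg (h2 : (2 : K) ≠ 0) {s : Multiset K} {a : K}
    (h : (s + {a, -a}).IsMetabolic) : s.IsMetabolic := by
  obtain rfl | ha := eq_or_ne a 0
  · refine of_add_zero (of_add_zero ?_)
    rw [add_assoc]
    simpa using h
  · have h₁ : s + {a, -a} = Finset.univ.val.map (Sum.elim s.toList.get ![a, -a]) := by
      rw [map_univ_sum_elim, map_univ_get]; rfl
    rw [h₁, map_univ_iff] at h
    exact h.of_sum_elim_neg h2 (by simpa) (by simp)

lemma of_add_map_neg (h2 : (2 : K) ≠ 0) {s t : Multiset K}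
    (h : (s + (t + t.map Neg.neg)).IsMetabolic) : s.IsMetabolic := by
  induction t using Multiset.induction with
  | empty => simpa using h
  | cons a t ih =>
    refine ih (of_add_pair_neg h2 (a := a) ?_)
    convert h using 1
    rw [map_cons, insert_eq_cons, ← singleton_add, ← singleton_add, ← singleton_add]
    abel

lemma zero : (0 : Multiset K).IsMetabolic := by
  have h : (0 : Multiset K) = Finset.univ.val.map (Fin.elim0 : Fin 0 → K) := by simp
  rw [h, map_univ_iff]
  exact ⟨⊥, by simp, by simp⟩

lemma singleton_zero : ({0} : Multiset K).IsMetabolic := by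
  have h : ({0} : Multiset K) = Finset.univ.val.map (0 : Fin 1 → K) := by simp
  rw [h, map_univ_iff]
  refine ⟨⊤, by simp, by simp⟩

lemma pair_neg (a : K) : ({a, -a} : Multiset K).IsMetabolic := by
  obtain rfl | ha := eq_or_ne a 0
  · simpa using singleton_zero.add singleton_zero
  have h : ({a, -a} : Multiset K) = Finset.univ.val.map ![a, -a] := rfl
  rw [h, map_univ_iff]
  refine ⟨K ∙ 1, fun v hv => ?_, ?_⟩
  · obtain ⟨c, rfl⟩ := Submodule.mem_span_singleton.1 hv
    simp
  · have : IsEmpty {i : Fin 2 // ![a, -a] i = 0} := ⟨by simp [Fin.forall_fin_two, ha]⟩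
    rw [finrank_span_singleton one_ne_zero]
    simp

lemma add_map_neg (s : Multiset K) : (s + s.map Neg.neg).IsMetabolic := by
  induction s using Multiset.induction with
  | empty => simpa using zero
  | cons a s ih =>
    convert ih.add (pair_neg a) using 1
    rw [map_cons, insert_eq_cons, ← singleton_add, ← singleton_add, ← singleton_add]
    abel

lemma mul_sq (a : K) {b : K} (hb : b ≠ 0) : ({a * b ^ 2, -a} : Multiset K).IsMetabolic := by
  obtain rfl | ha := eq_or_ne a 0
  · simpa using singleton_zero.add singleton_zero
  have h : ({a * b ^ 2, -a} : Multiset K) = Finset.univ.val.map ![a * b ^ 2, -a] := rfl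
  rw [h, map_univ_iff]
  refine ⟨K ∙ ![1, b], fun v hv => ?_, ?_⟩
  · obtain ⟨c, rfl⟩ := Submodule.mem_span_singleton.1 hv
    simp
    ring
  · have : IsEmpty {i : Fin 2 // ![a * b ^ 2, -a] i = 0} :=
      ⟨by simp [Fin.forall_fin_two, ha, hb]⟩
    rw [finrank_span_singleton (by simp)]
    simp

lemma pair_add (a b : K) :
    ({a, b, -(a + b), -(a * b * (a + b))} : Multiset K).IsMetabolic := by
  by_cases h₀ : a * b * (a + b) = 0
  · obtain ⟨c, hc⟩ : ∃ c, ({a, b, -(a + b), -(a * b * (a + b))} : Multiset K) =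
        {c, -c} + {0} + {0} := by
      simp only [insert_eq_cons, ← singleton_add]
      obtain (rfl | rfl) | hab := by simpa only [mul_eq_zero] using h₀
      · exact ⟨b, by simp only [zero_add, zero_mul, neg_zero]; abel⟩
      · exact ⟨a, by simp only [add_zero, mul_zero, zero_mul, neg_zero]; abel⟩
      · exact ⟨a, by
          rw [eq_neg_of_add_eq_zero_right hab]
          simp only [add_neg_cancel, mul_zero, neg_zero]; abel⟩
    rw [hc]
    exact ((pair_neg c).add singleton_zero).add singleton_zero
  have h : ({a, b, -(a + b), -(a * b * (a + b))} : Multiset K) =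
    Finset.univ.val.map ![a, b, -(a + b), -(a * b * (a + b))] := rfl
  rw [h, map_univ_iff]
  refine ⟨Submodule.span K (Set.range ![![1, 1, 1, 0], ![b, -a, 0, 1]]), fun v hv => ?_, ?_⟩
  · obtain ⟨c, rfl⟩ := (Submodule.mem_span_range_iff_exists_fun K).1 hv
    simp [Fin.sum_univ_four]
    ring
  · have : IsEmpty {i : Fin 4 // ![a, b, -(a + b), -(a * b * (a + b))] i = 0} :=
      ⟨by
        simp only [mul_eq_zero, not_or] at h₀
        simp [Fin.forall_fin_succ, -neg_add_rev, h₀]⟩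
    rw [finrank_span_eq_card]
    · simp [-neg_add_rev]
    · rw [LinearIndependent.pair_iff]
      intro s t hst
      have h₁ := congrFun hst 2
      have h₂ := congrFun hst 3
      simp_all

end Multiset.IsMetabolic

/-- Two diagonal forms are congruent when their difference is metabolic. -/
def metabolicCon {K : Type*} [Field K] (h2 : (2 : K) ≠ 0) : AddCon (Multiset K) where
  r s t := (s + t.map Neg.neg).IsMetabolic
  iseqv :=
    { refl := .add_map_neg
      symm := fun {s t} h => by
        simpa [add_comm] using h.map_neg
      trans := fun {s t u} h₁ h₂ => by
        refine .of_add_map_neg h2 (t := t) ?_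
        convert h₁.add h₂ using 1
        abel }
  add' := fun {s t u v} h₁ h₂ => by
    convert h₁.add h₂ using 1
    rw [Multiset.map_add]
    abel

namespace WittGroup

lemma isMetabolic_of_mk_eq_zero {K : Type*} [Field K] (h2 : (2 : K) ≠ 0) {s : Multiset K}
    (hs : mk s = 0) : s.IsMetabolic := by
  have h : addConGen (WittRel K) ≤ metabolicCon h2 := by
    rw [AddCon.addConGen_le]
    rintro _ _ (_ | ⟨a, b, hb⟩ | ⟨a, b⟩)
    · exact .singleton_zero
    · exact .mul_sq a hb
    · exact .pair_add a b
  have h₀ : metabolicCon h2 s 0 := h ((AddCon.eq _).1 hs)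
  simpa [metabolicCon] using h₀

end WittGroup

end

namespace WittGroup

section Field

variable {K L : Type*} [Field K] [Field L]

/-- Base change along a field homomorphism. -/
def map (f : K →+* L) : WittGroup K →+ WittGroup L :=
  lift (fun a => of (f a)) (by simp)
    (fun a b hb => by rw [map_mul, map_pow, of_mul_sq _ ((map_ne_zero f).2 hb)])
    (fun a b => by rw [of_add_of, map_add, map_mul, map_mul, map_add])

@[simp] lemma map_of (f : K →+* L) (a : K) : map f (of a) = of (f a) := lift_of ..

open Classical in
/-- The number of nonzero coefficients modulo two. -/
noncomputable def rank : WittGroup K →+ ZMod 2 :=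
  lift (fun a => if a = 0 then 0 else 1) (by simp) (fun a b hb => by simp [hb]) fun a b => by
    by_cases ha : a = 0
    · simp [ha]
    by_cases hb : b = 0
    · simp [hb]
    by_cases hab : a + b = 0
    · simp [ha, hb, hab]
      rfl
    · simp [ha, hb, hab]

lemma rank_of {a : K} (ha : a ≠ 0) : rank (of a) = 1 := by simp [rank, ha]

end Field

section Padic

open PadicInt

variable {p : ℕ} [Fact p.Prime]

lemma norm_mul_zpow_neg_valuation_le (a : ℚ_[p]) : ‖a * (p : ℚ_[p]) ^ (-a.valuation)‖ ≤ 1 := by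
  obtain rfl | ha := eq_or_ne a 0
  · simp
  · have hp : (p : ℝ) ≠ 0 := mod_cast (Fact.out : p.Prime).ne_zero
    rw [norm_mul, Padic.norm_eq_zpow_neg_valuation ha, Padic.norm_p_zpow, ← zpow_add₀ hp]
    simp

/-- The residue of `⟨a⟩`, namely `⟨u mod p⟩` if `a = p ^ k * u` with `k` odd and `u` a unit. -/
noncomputable def residueOf (a : ℚ_[p]) : WittGroup (ZMod p) :=
  if Odd a.valuation then of (toZMod ⟨_, norm_mul_zpow_neg_valuation_le a⟩) else 0

lemma _root_.Padic.valuation_zpow_mul_unit (k : ℤ) (u : ℤ_[p]ˣ) :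
    ((p : ℚ_[p]) ^ k * ((u : ℤ_[p]) : ℚ_[p])).valuation = k := by
  have hp : (p : ℚ_[p]) ≠ 0 := mod_cast (Fact.out : p.Prime).ne_zero
  have hu : ((u : ℤ_[p]) : ℚ_[p]) ≠ 0 := by simp
  rw [Padic.valuation_mul (zpow_ne_zero _ hp) hu, Padic.valuation_zpow, Padic.valuation_p,
    PadicInt.valuation_coe]
  have h := PadicInt.norm_eq_zpow_neg_valuation u.ne_zero
  rw [norm_units, eq_comm, zpow_eq_one_iff_right₀ p.cast_nonneg
    (mod_cast (Fact.out : p.Prime).ne_one), neg_eq_zero, Nat.cast_eq_zero] at h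
  simp [h]

lemma residueOf_zpow_mul_unit (k : ℤ) (u : ℤ_[p]ˣ) :
    residueOf ((p : ℚ_[p]) ^ k * ((u : ℤ_[p]) : ℚ_[p])) =
      if Odd k then of (toZMod (u : ℤ_[p])) else 0 := by
  have hp : (p : ℚ_[p]) ≠ 0 := mod_cast (Fact.out : p.Prime).ne_zero
  have h : (⟨_, norm_mul_zpow_neg_valuation_le ((p : ℚ_[p]) ^ k * ((u : ℤ_[p]) : ℚ_[p]))⟩ : ℤ_[p]) =
      (u : ℤ_[p]) := by
    refine Subtype.ext ?_
    change _ * _ * (p : ℚ_[p]) ^ (-Padic.valuation _) = _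
    rw [Padic.valuation_zpow_mul_unit, mul_right_comm, ← zpow_add₀ hp]
    simp
  rw [residueOf, h]
  simp only [Padic.valuation_zpow_mul_unit]

lemma _root_.Padic.exists_zpow_mul_unit {a : ℚ_[p]} (ha : a ≠ 0) :
    ∃ (k : ℤ) (u : ℤ_[p]ˣ), a = (p : ℚ_[p]) ^ k * ((u : ℤ_[p]) : ℚ_[p]) := by
  have hp : (p : ℚ_[p]) ≠ 0 := mod_cast (Fact.out : p.Prime).ne_zero
  have hp' : (p : ℝ) ≠ 0 := mod_cast (Fact.out : p.Prime).ne_zero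
  have h : ‖a * (p : ℚ_[p]) ^ (-a.valuation)‖ = 1 := by
    rw [norm_mul, Padic.norm_eq_zpow_neg_valuation ha, Padic.norm_p_zpow, ← zpow_add₀ hp']
    simp
  refine ⟨a.valuation, mkUnits h, ?_⟩
  rw [mkUnits_eq, mul_left_comm, ← zpow_add₀ hp]
  simp

lemma residueOf_zero : residueOf (0 : ℚ_[p]) = 0 := by simp [residueOf]

lemma toZMod_unit_ne_zero (u : ℤ_[p]ˣ) : toZMod (u : ℤ_[p]) ≠ 0 := (u.isUnit.map _).ne_zero

lemma residueOf_mul_sq (a b : ℚ_[p]) (hb : b ≠ 0) : residueOf (a * b ^ 2) = residueOf a := by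
  obtain rfl | ha := eq_or_ne a 0
  · simp
  have hp : (p : ℚ_[p]) ≠ 0 := mod_cast (Fact.out : p.Prime).ne_zero
  obtain ⟨k, u, rfl⟩ := Padic.exists_zpow_mul_unit ha
  obtain ⟨l, v, rfl⟩ := Padic.exists_zpow_mul_unit hb
  have h : (p : ℚ_[p]) ^ k * ((u : ℤ_[p]) : ℚ_[p]) * (p ^ l * ((v : ℤ_[p]) : ℚ_[p])) ^ 2 =
      (p : ℚ_[p]) ^ (k + 2 * l) * (((u * v ^ 2 : ℤ_[p]ˣ) : ℤ_[p]) : ℚ_[p]) := by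
    rw [zpow_add₀ hp, two_mul, zpow_add₀ hp]
    push_cast
    ring
  rw [h, residueOf_zpow_mul_unit, residueOf_zpow_mul_unit]
  simp [of_mul_sq _ (toZMod_unit_ne_zero v), Int.odd_add]

lemma residueOf_neg (a : ℚ_[p]) : residueOf (-a) = -residueOf a := by
  obtain rfl | ha := eq_or_ne a 0
  · simp [residueOf_zero]
  obtain ⟨k, u, rfl⟩ := Padic.exists_zpow_mul_unit ha
  have h : -((p : ℚ_[p]) ^ k * ((u : ℤ_[p]) : ℚ_[p])) =
      (p : ℚ_[p]) ^ k * (((-u : ℤ_[p]ˣ) : ℤ_[p]) : ℚ_[p]) := by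
    push_cast
    ring
  rw [h, residueOf_zpow_mul_unit, residueOf_zpow_mul_unit]
  split_ifs <;> simp [of_neg]

lemma residueOf_add_of_le {k l : ℤ} (hkl : k ≤ l) (u v : ℤ_[p]ˣ) {a b : ℚ_[p]}
    (ha : a = (p : ℚ_[p]) ^ k * ((u : ℤ_[p]) : ℚ_[p]))
    (hb : b = (p : ℚ_[p]) ^ l * ((v : ℤ_[p]) : ℚ_[p])) :
    residueOf a + residueOf b = residueOf (a + b) + residueOf (a * b * (a + b)) := by
  have hp : (p : ℚ_[p]) ≠ 0 := mod_cast (Fact.out : p.Prime).ne_zero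
  obtain hab | hab := eq_or_ne (a + b) 0
  · simp [residueOf_zero, eq_neg_of_add_eq_zero_right hab, residueOf_neg]
  obtain ⟨m, rfl⟩ := Int.le.dest hkl
  let w : ℤ_[p] := u + p ^ m * v
  have hw : a + b = (p : ℚ_[p]) ^ k * (w : ℚ_[p]) := by
    simp only [w, ha, hb, zpow_add₀ hp]
    push_cast
    rw [zpow_natCast]
    ring
  have hw₀ : w ≠ 0 := by
    rintro h
    simp [hw, h] at hab
  have hsum : a + b = (p : ℚ_[p]) ^ (k + w.valuation) * ((unitCoeff hw₀ : ℤ_[p]) : ℚ_[p]) := by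
    rw [hw]
    nth_rw 1 [unitCoeff_spec hw₀]
    rw [zpow_add₀ hp]
    push_cast
    rw [zpow_natCast]
    ring
  have hprod : a * b * (a + b) = (p : ℚ_[p]) ^ (k + (k + m) + (k + w.valuation)) *
      (((u * v * unitCoeff hw₀ : ℤ_[p]ˣ) : ℤ_[p]) : ℚ_[p]) := by
    rw [hsum, ha, hb, zpow_add₀ hp (k + (k + m)), zpow_add₀ hp k (k + m)]
    push_cast
    ring
  rw [hprod, hsum, ha, hb]
  simp only [residueOf_zpow_mul_unit]
  have hres := congrArg toZMod (unitCoeff_spec hw₀)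
  have hu := toZMod_unit_ne_zero u
  have hz := toZMod_unit_ne_zero (unitCoeff hw₀)
  generalize w.valuation = n at hres ⊢
  generalize unitCoeff hw₀ = z at hres hz ⊢
  simp only [w, map_add, map_mul, map_pow, map_natCast, CharP.cast_eq_zero] at hres
  simp only [Units.val_mul, map_mul]
  generalize toZMod (u : ℤ_[p]) = x at *
  generalize toZMod (v : ℤ_[p]) = y at *
  generalize toZMod (z : ℤ_[p]) = t at *
  obtain rfl | hm := eq_or_ne m 0
  · obtain rfl | hn := eq_or_ne n 0
    · obtain rfl : x + y = t := by simpa using hres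
      simp only [Nat.cast_zero, add_zero]
      by_cases hk : Odd k
      · have : Odd (k + k + k) := by grind
        simp [hk, this, of_add_of x y]
      · have : ¬ Odd (k + k + k) := by grind
        simp [hk, this]
    · obtain rfl : y = -x := by
        rw [zero_pow hn] at hres
        linear_combination hres
      have h : of (x * -x * t) = -of t := by
        rw [← of_neg, ← of_mul_sq (-t) hu]
        ring_nf
      have : Odd (k + k + (k + n)) ↔ Odd (k + n) := by grind
      simp only [Nat.cast_zero, add_zero, h, this, of_neg]
      split_ifs <;> simp
  · have h : x = t * 0 ^ n := by simpa [hm] using hres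
    obtain rfl | hn := eq_or_ne n 0
    · obtain rfl : x = t := by simpa using h
      have h : of (x * y * x) = of y := by
        rw [← of_mul_sq y hu]
        ring_nf
      have : Odd (k + (k + m) + (k + (0 : ℕ))) ↔ Odd (k + m) := by grind
      simp only [h, this]
      simp
    · exact absurd (by simpa [hn] using h) hu

/-- The second residue homomorphism. -/
noncomputable def padicResidue (p : ℕ) [Fact p.Prime] : WittGroup ℚ_[p] →+ WittGroup (ZMod p) :=
  lift residueOf residueOf_zero residueOf_mul_sq fun a b => by
    obtain rfl | ha := eq_or_ne a 0
    · simp [residueOf_zero]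
    obtain rfl | hb := eq_or_ne b 0
    · simp [residueOf_zero]
    obtain ⟨k, u, hu⟩ := Padic.exists_zpow_mul_unit ha
    obtain ⟨l, v, hv⟩ := Padic.exists_zpow_mul_unit hb
    obtain h | h := le_total k l
    · exact residueOf_add_of_le h u v hu hv
    · rw [add_comm, residueOf_add_of_le h v u hv hu, add_comm b, mul_comm b]

end Padic

lemma rank_residueOf {p : ℕ} [Fact p.Prime] {a : ℚ_[p]} (ha : a ≠ 0) :
    rank (residueOf a) = (a.valuation : ZMod 2) := by
  obtain ⟨k, u, rfl⟩ := Padic.exists_zpow_mul_unit ha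
  rw [residueOf_zpow_mul_unit, Padic.valuation_zpow_mul_unit]
  split_ifs with hk
  · rw [rank_of (toZMod_unit_ne_zero u), (ZMod.intCast_eq_one_iff_odd).2 hk]
  · rw [map_zero, (ZMod.intCast_eq_zero_iff_even).2 (Int.not_odd_iff_even.1 hk)]

/-- The second residue at `p` of a rational quadratic form. -/
noncomputable def residue (p : ℕ) [Fact p.Prime] : WittGroup ℚ →+ WittGroup (ZMod p) :=
  (padicResidue p).comp (map (Rat.castHom ℚ_[p]))

section

variable {p : ℕ} [Fact p.Prime]

lemma residue_of (a : ℚ) : residue p (of a) = residueOf (a : ℚ_[p]) := by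
  simp [residue, padicResidue]

lemma rank_residue_of {a : ℚ} (ha : a ≠ 0) :
    rank (residue p (of a)) = (padicValRat p a : ZMod 2) := by
  rw [residue_of, rank_residueOf (mod_cast ha), Padic.valuation_ratCast]

lemma residue_of_pow_mul (k : ℕ) {u : ℤ} (hu : (u : ZMod p) ≠ 0) :
    residue p (of ((p : ℚ) ^ k * u)) = if Odd k then of (u : ZMod p) else 0 := by
  have h : IsUnit (u : ℤ_[p]) := by
    rw [PadicInt.isUnit_iff]
    refine le_antisymm (PadicInt.norm_le_one _) (not_lt.1 fun h => hu ?_)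
    exact (ZMod.intCast_zmod_eq_zero_iff_dvd _ _).2 (PadicInt.norm_int_lt_one_iff_dvd u |>.1 h)
  have := residueOf_zpow_mul_unit (k : ℤ) h.unit
  rw [residue_of]
  simpa using this

lemma residue_of_intCast {u : ℤ} (hu : (u : ZMod p) ≠ 0) : residue p (of (u : ℚ)) = 0 := by
  simpa using residue_of_pow_mul 0 hu

end

lemma exists_of_intCast (a : ℚ) : ∃ n : ℤ, of a = of (n : ℚ) := by
  refine ⟨a.num * a.den, ?_⟩
  rw [← of_mul_sq a (b := a.den) (by simp)]
  push_cast
  congr 1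
  nth_rw 1 [← Rat.num_div_den a]
  field_simp

/-- The signature of a rational quadratic form. -/
def signature : WittGroup ℚ →+ ℤ :=
  lift (fun a => (SignType.sign a : ℤ)) (by simp)
    (fun a b hb => by simp [sign_mul, sign_pos, (show 0 < b ^ 2 by positivity)])
    fun a b => by
      obtain rfl | ha := eq_or_ne a 0
      · simp
      obtain rfl | hb := eq_or_ne b 0
      · simp
      obtain ha | ha := ha.lt_or_gt <;> obtain hb | hb := hb.lt_or_gt
      · simp [sign_mul, ha, hb, add_neg ha hb]
      · obtain hab | hab | hab := lt_trichotomy (a + b) 0 <;> simp [sign_mul, *]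
      · obtain hab | hab | hab := lt_trichotomy (a + b) 0 <;> simp [sign_mul, *]
      · simp [ha, hb, add_pos ha hb]

lemma signature_of (a : ℚ) : signature (of a) = (SignType.sign a : ℤ) := lift_of ..

section FiniteField

open Polynomial

variable {F : Type*} [Field F] [Fintype F]

lemma _root_.FiniteField.exists_mul_sq_add_mul_sq_eq (hF : ringChar F ≠ 2) {u v : F} (hu : u ≠ 0)
    (hv : v ≠ 0) (d : F) : ∃ x y, u * x ^ 2 + v * y ^ 2 = d := by
  have hf : (C u * X ^ 2 - C d : F[X]).degree = 2 := by
    compute_degree!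
  have hg : (C v * X ^ 2 : F[X]).degree = 2 := by
    compute_degree!
  obtain ⟨x, y, h⟩ := FiniteField.exists_root_sum_quadratic hf hg
    (FiniteField.odd_card_of_char_ne_two hF)
  refine ⟨x, y, ?_⟩
  simp only [eval_sub, eval_mul, eval_C, eval_pow, eval_X] at h
  linear_combination h

/-- Binary forms over a finite field are determined by their discriminant. -/
lemma of_add_of_eq_of_add_of (hF : ringChar F ≠ 2) {u v d : F} (hu : u ≠ 0) (hv : v ≠ 0)
    (hd : d ≠ 0) : of u + of v = of d + of (d * u * v) := by
  obtain ⟨x, y, rfl⟩ := FiniteField.exists_mul_sq_add_mul_sq_eq hF hu hv d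
  obtain rfl | hx := eq_or_ne x 0
  · have hy : y ≠ 0 := by
      rintro rfl
      simp at hd
    have h : (u * 0 ^ 2 + v * y ^ 2) * u * v = u * (v * y) ^ 2 := by ring
    rw [h, of_mul_sq u (mul_ne_zero hv hy), zero_pow two_ne_zero, mul_zero, zero_add,
      of_mul_sq v hy, add_comm]
  obtain rfl | hy := eq_or_ne y 0
  · have h : (u * x ^ 2 + v * 0 ^ 2) * u * v = v * (u * x) ^ 2 := by ring
    rw [h, of_mul_sq v (mul_ne_zero hu hx), zero_pow two_ne_zero, mul_zero, add_zero,
      of_mul_sq u hx]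
  · rw [← of_mul_sq u hx, ← of_mul_sq v hy, of_add_of,
      ← of_mul_sq (_ * u * v) (mul_ne_zero hx hy)]
    ring_nf

lemma of_eq_of_one_or {f : F} (hf : ¬ IsSquare f) {a : F} (ha : a ≠ 0) :
    of a = of 1 ∧ of (a * f) = of f ∨ of a = of f ∧ of (a * f) = of 1 := by
  have hf₀ : f ≠ 0 := by
    rintro rfl
    exact hf (IsSquare.zero)
  by_cases h : IsSquare a
  · obtain ⟨b, rfl⟩ := h
    have hb : b ≠ 0 := left_ne_zero_of_mul ha
    left
    rw [← of_mul_sq 1 hb, ← of_mul_sq f hb]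
    constructor <;> ring_nf
  · classical
    have h' : IsSquare (a * f) := by
      rw [← quadraticChar_one_iff_isSquare (mul_ne_zero ha hf₀), map_mul,
        quadraticChar_neg_one_iff_not_isSquare.2 h, quadraticChar_neg_one_iff_not_isSquare.2 hf]
      rfl
    obtain ⟨b, hb⟩ := h'
    have hb₀ : b ≠ 0 := by
      rintro rfl
      simp_all
    right
    rw [hb, ← of_mul_sq a hf₀, ← of_mul_sq f hb₀, ← of_mul_sq 1 hb₀]
    constructor
    · congr 1
      linear_combination f * hb
    · ring_nf

lemma eq_of_sub_of_rank_eq_zero (hF : ringChar F ≠ 2) {f : F} (hf : ¬ IsSquare f) {c : F}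
    (hc : c ≠ 0) {x : WittGroup F} (hx : rank x = 0) (hx₀ : x ≠ 0) : x = of c - of (c * f) := by
  have hf₀ : f ≠ 0 := by
    rintro rfl
    exact hf (IsSquare.zero)
  have h2 : of (1 : F) + of 1 = of f + of f := by
    simpa using of_add_of_eq_of_add_of hF one_ne_zero one_ne_zero hf₀
  have hneg : -of (1 : F) = of 1 ∨ -of (1 : F) = of f := by
    rw [neg_of]
    exact (of_eq_of_one_or hf (neg_ne_zero.2 one_ne_zero)).imp And.left And.left
  have key : x = 0 ∨ x = of 1 - of f ∨ x = of 1 ∨ x = of f := by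
    clear hx hx₀
    induction x using induction with
    | zero => simp
    | add_of x a ih =>
      obtain rfl | ha := eq_or_ne a 0
      · simpa using ih
      have ha := (of_eq_of_one_or hf ha).imp And.left And.left
      generalize of a = a' at *
      generalize of (1 : F) = b at *
      generalize of f = c at *
      obtain h | rfl := hneg
      · have hb : b + b = 0 := by nth_rw 1 [← h]; simp
        have hc : c + c = 0 := by rw [← h2, hb]
        have hs : b - c = b + c := by rw [sub_eq_iff_eq_add, add_assoc, hc, add_zero]
        rw [hs] at ih ⊢
        obtain rfl | rfl | rfl | rfl := ih <;> obtain rfl | rfl := ha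
        · simp
        · simp
        · simp [add_right_comm, hb]
        · simp [add_assoc, hc]
        · simp [hb]
        · simp
        · simp [add_comm]
        · simp [hc]
      · have hb : b + b + b = -b := by
          rw [eq_neg_iff_add_eq_zero, add_assoc]
          nth_rw 1 [h2]
          simp [add_assoc]
        rw [sub_neg_eq_add] at ih ⊢
        obtain rfl | rfl | rfl | rfl := ih <;> obtain rfl | rfl := ha
        · simp
        · simp
        · simp [hb]
        · simp
        · simp
        · simp
        · simp
        · simp [h2]
  have h : of c - of (c * f) = of 1 - of f := by
    obtain ⟨h, h'⟩ | ⟨h, h'⟩ := of_eq_of_one_or hf hc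
    · rw [h, h']
    · rw [h, h', sub_eq_sub_iff_add_eq_add, h2]
  obtain rfl | rfl | rfl | rfl := key
  · exact absurd rfl hx₀
  · exact h.symm
  · simp [rank_of] at hx
  · simp [rank_of hf₀] at hx

end FiniteField

/-- The integers that are products of integers of absolute value less than `n`. -/
def productsLT (n : ℕ) : Submonoid ℤ := Submonoid.closure {m | m.natAbs < n}

/-- The subgroup generated by `⟨m⟩`, for `m` a product of integers of absolute value less than
`n`. -/
def filtration (n : ℕ) : AddSubgroup (WittGroup ℚ) :=
  AddSubgroup.closure ((fun m : ℤ => of (m : ℚ)) '' productsLT n)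

lemma mem_productsLT {n : ℕ} {m : ℤ} (h : m.natAbs < n) : m ∈ productsLT n :=
  Submonoid.subset_closure h

lemma productsLT_mono : Monotone productsLT := fun _ _ h =>
  Submonoid.closure_mono fun _ hm => lt_of_lt_of_le hm h

lemma filtration_mono : Monotone filtration := fun _ _ h =>
  AddSubgroup.closure_mono (Set.image_mono (productsLT_mono h))

lemma of_mem_filtration {n : ℕ} {m : ℤ} (h : m ∈ productsLT n) : of (m : ℚ) ∈ filtration n :=
  AddSubgroup.subset_closure ⟨m, h, rfl⟩

lemma exists_mem_filtration (x : WittGroup ℚ) (k : ℕ) : ∃ n ≥ k, x ∈ filtration n := by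
  induction x using induction with
  | zero => exact ⟨k, le_rfl, zero_mem _⟩
  | add_of x a ih =>
    obtain ⟨n, hn, hx⟩ := ih
    obtain ⟨m, hm⟩ := exists_of_intCast a
    refine ⟨max n (m.natAbs + 1), le_max_of_le_left hn,
      add_mem (filtration_mono (le_max_left _ _) hx) ?_⟩
    rw [hm]
    exact of_mem_filtration (mem_productsLT (lt_max_of_lt_right (Nat.lt_succ_self _)))

lemma of_mul_sub_of_mul_emod_mem {p : ℕ} (hp : 2 ≤ p) {n : ℤ} (hn : n ∈ productsLT p) :
    ∀ u ∈ productsLT p, of ((p * u * n : ℤ) : ℚ) - of ((p * u * (n % p) : ℤ) : ℚ) ∈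
      filtration p := by
  induction hn using Submonoid.closure_induction_left with
  | one =>
    intro u _
    rw [Int.emod_eq_of_lt zero_le_one (by lia), sub_self]
    exact zero_mem _
  | mul_left q hq n hn ih =>
    intro u hu
    obtain rfl | hu₀ := eq_or_ne u 0
    · simp
    change q.natAbs < p at hq
    have hp₀ : (0 : ℤ) < p := by lia
    have hs := Int.emod_nonneg n hp₀.ne'
    have hs' := Int.emod_lt_of_pos n hp₀
    have h₁ := ih (u * q) (mul_mem hu (mem_productsLT hq))
    have hmod : q * n % p = q * (n % p) % p := by simp [Int.mul_emod]
    rw [hmod]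
    generalize n % p = s at *
    have hr := Int.emod_nonneg (q * s) hp₀.ne'
    have hr' := Int.emod_lt_of_pos (q * s) hp₀
    have hdiv := Int.emod_add_mul_ediv (q * s) p
    have hk : (q * s / p).natAbs < p := by
      have h : |q * s| ≤ (p - 1) * p := by
        rw [abs_mul, abs_of_nonneg hs]
        exact mul_le_mul (by rw [Int.abs_eq_natAbs]; lia) hs'.le hs (by lia)
      rw [abs_le] at h
      have h₂ : q * s / p ≤ p - 1 := Int.ediv_le_of_le_mul hp₀ h.2
      have h₃ : -((p : ℤ) - 1) ≤ q * s / p := (Int.le_ediv_iff_mul_le hp₀).2 (by linarith)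
      lia
    generalize q * s % p = r at *
    generalize q * s / p = k at *
    have hrel := of_add_of ((p * u * r : ℤ) : ℚ) ((p * u * (p * k) : ℤ) : ℚ)
    have e₁ : ((p * u * r : ℤ) : ℚ) + ((p * u * (p * k) : ℤ) : ℚ) =
        ((p * (u * q) * s : ℤ) : ℚ) := by
      rw [← Int.cast_add]
      congr 1
      linear_combination (p * u : ℤ) * hdiv
    have e₂ : of ((p * u * (p * k) : ℤ) : ℚ) = of ((u * k : ℤ) : ℚ) := by
      rw [← of_mul_sq ((u * k : ℤ) : ℚ) (b := p) (mod_cast hp₀.ne')]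
      push_cast
      ring_nf
    have e₃ : of (((p * u * r : ℤ) : ℚ) * ((p * u * (p * k) : ℤ) : ℚ) * ((p * (u * q) * s : ℤ) : ℚ))
        = of ((u * r * k * q * s : ℤ) : ℚ) := by
      rw [← of_mul_sq ((u * r * k * q * s : ℤ) : ℚ) (b := p ^ 2 * u)
        (mod_cast mul_ne_zero (pow_ne_zero 2 hp₀.ne') hu₀)]
      push_cast
      ring_nf
    rw [e₁, e₂, e₃] at hrel
    have h₂ : of ((u * k : ℤ) : ℚ) ∈ filtration p :=
      of_mem_filtration (mul_mem hu (mem_productsLT hk))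
    have h₃ : of ((u * r * k * q * s : ℤ) : ℚ) ∈ filtration p :=
      of_mem_filtration (mul_mem (mul_mem (mul_mem (mul_mem hu (mem_productsLT (by lia)))
        (mem_productsLT hk)) (mem_productsLT hq)) (mem_productsLT (by lia)))
    convert add_mem h₁ (sub_mem h₂ h₃) using 1
    rw [← mul_assoc, mul_assoc (p : ℤ) u q]
    linear_combination (norm := module) (-1 : ℤ) • hrel

section

variable {p : ℕ} [Fact p.Prime]

lemma mk_of_prime_mul {n : ℤ} (hn : n ∈ productsLT p) :
    (of ((p * n : ℤ) : ℚ) : WittGroup ℚ ⧸ filtration p) =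
      of ((p * ((n : ZMod p).val : ℤ) : ℤ) : ℚ) := by
  have h := of_mul_sub_of_mul_emod_mem (Fact.out : p.Prime).two_le hn 1 (one_mem _)
  rw [QuotientAddGroup.eq_iff_sub_mem, ZMod.val_intCast]
  simpa using h

lemma val_mem_productsLT (a : ZMod p) : (a.val : ℤ) ∈ productsLT p :=
  mem_productsLT (by rw [Int.natAbs_natCast]; exact a.val_lt)

variable (p) in
/-- A section of the residue at `p` modulo the forms involving only smaller primes. -/
noncomputable def unresidue : WittGroup (ZMod p) →+ WittGroup ℚ ⧸ filtration p :=
  lift (fun a => (of ((p * (a.val : ℤ) : ℤ) : ℚ) : WittGroup ℚ ⧸ filtration p)) (by simp)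
    (fun a b hb => by
      have h := mk_of_prime_mul
        (mul_mem (val_mem_productsLT a) (pow_mem (val_mem_productsLT b) 2))
      have hb : (b.val : ℚ) ≠ 0 := mod_cast (ZMod.val_ne_zero b).2 hb
      have e : (((a.val : ℤ) * (b.val : ℤ) ^ 2 : ℤ) : ZMod p) = a * b ^ 2 := by simp
      rw [← e, ← h, ← of_mul_sq ((p * (a.val : ℤ) : ℤ) : ℚ) hb]
      push_cast
      rw [mul_assoc])
    fun a b => by
      have hp : (p : ℚ) ≠ 0 := mod_cast (Fact.out : p.Prime).ne_zero
      have hc : ((a + b).val : ℤ) - a.val ∈ productsLT p :=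
        mem_productsLT (by have := a.val_lt; have := (a + b).val_lt; lia)
      have h₁ := mk_of_prime_mul hc
      have h₂ := mk_of_prime_mul (mul_mem (mul_mem (val_mem_productsLT a) hc)
        (val_mem_productsLT (a + b)))
      have e₁ : ((((a + b).val : ℤ) - a.val : ℤ) : ZMod p) = b := by simp
      have e₂ : (((a.val : ℤ) * ((a + b).val - a.val) * (a + b).val : ℤ) : ZMod p) =
          a * b * (a + b) := by simp
      rw [e₁] at h₁
      rw [e₂] at h₂
      rw [← h₁, ← h₂, ← QuotientAddGroup.mk_add, ← QuotientAddGroup.mk_add, of_add_of]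
      generalize ((a + b).val : ℤ) = C at *
      generalize (a.val : ℤ) = A at *
      have e₃ : ((p * A : ℤ) : ℚ) + ((p * (C - A) : ℤ) : ℚ) = ((p * C : ℤ) : ℚ) := by
        push_cast
        ring
      rw [e₃, ← of_mul_sq ((p * (A * (C - A) * C) : ℤ) : ℚ) hp]
      push_cast
      ring_nf

lemma unresidue_of_intCast {n : ℤ} (hn : n ∈ productsLT p) :
    unresidue p (of (n : ZMod p)) = of ((p * n : ℤ) : ℚ) := by
  rw [unresidue, lift_of, mk_of_prime_mul hn]

lemma exists_eq_pow_mul {p : ℕ} (hp : 2 ≤ p) {m : ℤ} (hm : m ∈ productsLT (p + 1)) :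
    ∃ k : ℕ, ∃ u ∈ productsLT p, m = p ^ k * u := by
  induction hm using Submonoid.closure_induction with
  | mem m hm =>
    change m.natAbs < p + 1 at hm
    obtain h | h := (Nat.lt_succ_iff.1 hm).lt_or_eq
    · exact ⟨0, m, mem_productsLT h, by simp⟩
    · obtain rfl | rfl := Int.natAbs_eq_iff.1 h
      · exact ⟨1, 1, one_mem _, by simp⟩
      · exact ⟨1, -1, mem_productsLT (by rw [Int.natAbs_neg, Int.natAbs_one]; exact hp), by simp⟩
  | one => exact ⟨0, 1, one_mem _, by simp⟩
  | mul m n _ _ hm hn =>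
    obtain ⟨k, u, hu, rfl⟩ := hm
    obtain ⟨l, v, hv, rfl⟩ := hn
    exact ⟨k + l, u * v, mul_mem hu hv, by ring⟩

lemma intCast_ne_zero_of_mem_productsLT {u : ℤ} (hu : u ∈ productsLT p) (hu₀ : u ≠ 0) :
    (u : ZMod p) ≠ 0 := by
  induction hu using Submonoid.closure_induction with
  | mem m hm =>
    rw [Ne, ZMod.intCast_zmod_eq_zero_iff_dvd]
    exact fun h => hu₀ (Int.eq_zero_of_dvd_of_natAbs_lt_natAbs h (by simpa using hm))
  | one => simp
  | mul m n _ _ hm hn =>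
    rw [mul_ne_zero_iff] at hu₀
    rw [Int.cast_mul]
    exact mul_ne_zero (hm hu₀.1) (hn hu₀.2)

lemma unresidue_residue {x : WittGroup ℚ} (hx : x ∈ filtration (p + 1)) :
    unresidue p (residue p x) = x := by
  have hp := (Fact.out : p.Prime)
  induction hx using AddSubgroup.closure_induction with
  | zero => simp
  | add x y _ _ hx hy => simp [hx, hy]
  | neg x _ hx => simp [hx]
  | mem x hx =>
    obtain ⟨m, hm, rfl⟩ := hx
    obtain ⟨k, u, hu, rfl⟩ := exists_eq_pow_mul hp.two_le hm
    obtain rfl | hu₀ := eq_or_ne u 0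
    · simp
    have h := residue_of_pow_mul k (intCast_ne_zero_of_mem_productsLT hu hu₀)
    simp only [Int.cast_mul, Int.cast_pow, Int.cast_natCast]
    rw [h]
    have hpk (l : ℕ) : (p : ℚ) ^ l ≠ 0 := pow_ne_zero _ (mod_cast hp.ne_zero)
    obtain ⟨l, rfl⟩ | ⟨l, rfl⟩ := k.even_or_odd
    · have e : of ((p : ℚ) ^ (l + l) * u) = of (u : ℚ) := by
        rw [← of_mul_sq (u : ℚ) (hpk l)]
        ring_nf
      rw [if_neg (by simp), map_zero, e, eq_comm, QuotientAddGroup.eq_zero_iff]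
      exact of_mem_filtration hu
    · have e : of ((p : ℚ) ^ (2 * l + 1) * u) = of ((p * u : ℤ) : ℚ) := by
        rw [← of_mul_sq ((p * u : ℤ) : ℚ) (hpk l)]
        push_cast
        ring_nf
      rw [if_pos (by simp), unresidue_of_intCast hu, e]

end

lemma mem_filtration_of_mem_succ {n : ℕ} (hn : 2 ≤ n) {x : WittGroup ℚ}
    (hx : x ∈ filtration (n + 1)) (h : ∀ (p : ℕ) [Fact p.Prime], residue p x = 0) :
    x ∈ filtration n := by
  by_cases hp : n.Prime
  · have : Fact n.Prime := ⟨hp⟩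
    rw [← QuotientAddGroup.eq_zero_iff, ← unresidue_residue hx, h, map_zero]
  · suffices productsLT (n + 1) ≤ productsLT n from
      AddSubgroup.closure_mono (Set.image_mono this) hx
    refine Submonoid.closure_le.2 fun m (hm : m.natAbs < n + 1) => ?_
    obtain h | h := (Nat.lt_succ_iff.1 hm).lt_or_eq
    · exact mem_productsLT h
    obtain ⟨a, b, ha, hb, rfl⟩ := (Nat.not_prime_iff_exists_mul_eq hn).1 hp
    rw [← Int.sign_mul_natAbs m, h, Nat.cast_mul]
    refine mul_mem (mem_productsLT (lt_of_le_of_lt ?_ hn)) (mul_mem (mem_productsLT (by simpa))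
      (mem_productsLT (by simpa)))
    rw [Int.natAbs_sign]
    split_ifs <;> simp

/-- A rational quadratic form is determined in the Witt group by its signature and residues. -/
theorem eq_zero_of_residue_eq_zero {x : WittGroup ℚ}
    (h : ∀ (p : ℕ) [Fact p.Prime], residue p x = 0) (hs : signature x = 0) : x = 0 := by
  have h₂ : x ∈ filtration 2 := by
    obtain ⟨n, hn, hx⟩ := exists_mem_filtration x 2
    induction n, hn using Nat.le_induction with
    | base => exact hx
    | succ n hn ih => exact ih (mem_filtration_of_mem_succ hn hx h)
  have h₁ : ∃ k : ℤ, x = k • of 1 := by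
    clear h hs
    induction h₂ using AddSubgroup.closure_induction with
    | zero => exact ⟨0, by simp⟩
    | add x y _ _ hx hy =>
      obtain ⟨k, rfl⟩ := hx
      obtain ⟨l, rfl⟩ := hy
      exact ⟨k + l, (add_zsmul ..).symm⟩
    | neg x _ hx =>
      obtain ⟨k, rfl⟩ := hx
      exact ⟨-k, (neg_zsmul ..).symm⟩
    | mem x hx =>
      obtain ⟨m, hm, rfl⟩ := hx
      have hm : m = 0 ∨ m = 1 ∨ m = -1 := by
        induction hm using Submonoid.closure_induction with
        | mem m hm =>
          change m.natAbs < 2 at hm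
          lia
        | one => simp
        | mul m n _ _ hm hn =>
          obtain rfl | rfl | rfl := hm <;> obtain rfl | rfl | rfl := hn <;> simp
      obtain rfl | rfl | rfl := hm
      · exact ⟨0, by simp⟩
      · exact ⟨1, by simp⟩
      · exact ⟨-1, by simp [of_neg]⟩
  obtain ⟨k, rfl⟩ := h₁
  have hk : k = 0 := by simpa [signature_of] using hs
  rw [hk, zero_smul]

lemma eq_zero_of_rank_eq_zero {x : WittGroup (ZMod 2)} (hx : rank x = 0) : x = 0 := by
  have h : (1 : ZMod 2) + 1 = 0 := rfl
  have h : x = 0 ∨ x = of 1 := by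
    clear hx
    induction x using induction with
    | zero => simp
    | add_of x a ih =>
      obtain rfl | rfl : a = 0 ∨ a = 1 := by decide +revert
      · simpa using ih
      · obtain rfl | rfl := ih
        · simp
        · simp [of_add_of, h]
  obtain rfl | rfl := h
  · rfl
  · simp [rank_of] at hx

end WittGroup

open NumberTheorySymbols in
lemma exists_prime_not_isSquare_and_jacobiSym_eq_one {σ : ℤ} (hσ : σ = 1 ∨ σ = -1) {S : Finset ℕ}
    (hS : ∀ p ∈ S, p.Prime ∧ p ≠ 2) (N : ℕ) :
    ∃ q > N, q.Prime ∧ q % 4 = 1 ∧ (∀ p ∈ S, ¬ IsSquare ((σ * q : ℤ) : ZMod p)) ∧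
      J(2 * (∏ p ∈ S, p : ℕ) | q) = 1 := by
  have hr : ∀ p : ℕ, ∃ r : ℕ, p ∈ S → ¬ IsSquare ((σ * r : ℤ) : ZMod p) := by
    intro p
    by_cases hp : p ∈ S
    · have : Fact p.Prime := ⟨(hS p hp).1⟩
      obtain ⟨a, ha⟩ := FiniteField.exists_nonsquare (F := ZMod p)
        (by rw [ZMod.ringChar_zmod_n]; exact (hS p hp).2)
      refine ⟨(σ * a : ZMod p).val, fun _ => ?_⟩
      obtain rfl | rfl := hσ <;> simpa using ha
    · exact ⟨0, fun h => absurd h hp⟩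
  choose r hr using hr
  set M := ∏ p ∈ S, p
  obtain ⟨t, ht⟩ := Nat.chineseRemainderOfFinset r id S (fun p hp => (hS p hp).1.ne_zero)
    fun p hp q hq hpq => (Nat.coprime_primes (hS p hp).1 (hS q hq).1).2 hpq
  have hsq (m : ℕ) (hm : m ≡ t [MOD M]) (p : ℕ) (hp : p ∈ S) :
      ¬ IsSquare ((σ * m : ℤ) : ZMod p) := by
    have h : (m : ZMod p) = r p :=
      (ZMod.natCast_eq_natCast_iff _ _ _).2
        ((hm.of_dvd (Finset.dvd_prod_of_mem _ hp)).trans (ht p hp))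
    simpa [h] using hr p hp
  have htM : t.Coprime M := Nat.Coprime.prod_right fun p hp => by
    rw [Nat.coprime_comm, (hS p hp).1.coprime_iff_not_dvd]
    intro h
    refine hsq t rfl p hp ?_
    simp [(ZMod.natCast_eq_zero_iff t p).2 h]
  have hM : Odd M := Finset.prod_induction _ _ (fun _ _ => Odd.mul) odd_one
    fun p hp => (hS p hp).1.odd_of_ne_two (hS p hp).2
  have h8 : Nat.Coprime 8 M := Nat.Coprime.pow_left 3 (Nat.coprime_two_left.2 hM)
  have key (s : ℕ) (hs : s = 1 ∨ s = 5) (hJ : ZMod.χ₈ s * J(t | M) = 1) :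
      ∃ q > N, q.Prime ∧ q % 4 = 1 ∧ (∀ p ∈ S, ¬ IsSquare ((σ * q : ℤ) : ZMod p)) ∧
        J(2 * M | q) = 1 := by
    obtain ⟨a, ha8, haM⟩ := Nat.chineseRemainder h8 s t
    have haq : a.Coprime (8 * M) := by
      refine Nat.Coprime.mul_right ?_ ?_
      · rw [Nat.coprime_iff_gcd_eq_one, ha8.gcd_eq]
        obtain rfl | rfl := hs <;> rfl
      · rw [Nat.coprime_iff_gcd_eq_one, haM.gcd_eq]
        exact htM
    obtain ⟨q, hqN, hq, hqa⟩ := Nat.forall_exists_prime_gt_and_modEq N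
      (mul_ne_zero (by simp) hM.pos.ne') haq
    have hq8 : q ≡ s [MOD 8] := (hqa.of_mul_right M).trans ha8
    have hqM : q ≡ t [MOD M] := (hqa.of_mul_left 8).trans haM
    have hq4 : q % 4 = 1 := by
      unfold Nat.ModEq at hq8
      lia
    refine ⟨q, hqN, hq, hq4, hsq q hqM, ?_⟩
    rw [jacobiSym.mul_left, jacobiSym.at_two (Nat.odd_iff.2 (Nat.odd_of_mod_four_eq_one hq4)),
      ← jacobiSym.quadratic_reciprocity_one_mod_four hq4 hM, ← hJ]
    congr 1
    · congr 1
      exact (ZMod.natCast_eq_natCast_iff _ _ 8).2 hq8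
    · exact jacobiSym.mod_left' (mod_cast hqM)
  obtain h | h := jacobiSym.eq_one_or_neg_one (a := t) (b := M) (by simpa using htM)
  · exact key 1 (.inl rfl) (by rw [h]; rfl)
  · exact key 5 (.inr rfl) (by rw [h]; rfl)

namespace WittGroup

/-- The class of the form `⟨d⟩ ⊗ ⟨1, -a⟩ ⊗ ⟨1, -b⟩`. -/
def pfister (d a b : ℤ) : WittGroup ℚ :=
  of (d : ℚ) - of ((d * a : ℤ) : ℚ) - of ((d * b : ℤ) : ℚ) + of ((d * a * b : ℤ) : ℚ)

lemma signature_pfister {d a b σ : ℤ} (ha : a.sign = σ) (hb : b.sign = σ) :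
    signature (pfister d a b) = d.sign * (1 - σ) ^ 2 := by
  have h (n : ℤ) : ((SignType.sign (n : ℚ) : SignType) : ℤ) = n.sign := by
    obtain h | rfl | h := lt_trichotomy n 0 <;>
      simp [*, Int.sign_eq_one_of_pos, Int.sign_eq_neg_one_of_neg]
  simp only [pfister, map_add, map_sub, signature_of, h, Int.sign_mul, ha, hb]
  ring

section

variable {p : ℕ} [Fact p.Prime] {d a b : ℤ}

lemma exists_eq_pow_mul_intCast (hd : d ≠ 0) :
    ∃ (k : ℕ) (x : ℤ), (x : ZMod p) ≠ 0 ∧ d = p ^ k * x := by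
  obtain ⟨x, hx, hpx⟩ := FiniteMultiplicity.exists_eq_pow_mul_and_not_dvd (a := (p : ℤ))
    (Int.finiteMultiplicity_iff.2 ⟨by simpa using (Fact.out : p.Prime).ne_one, hd⟩)
  exact ⟨_, x, by rwa [Ne, ZMod.intCast_zmod_eq_zero_iff_dvd], hx⟩

lemma residue_of_intCast_pow_mul (k : ℕ) {u : ℤ} (hu : (u : ZMod p) ≠ 0) :
    residue p (of ((p ^ k * u : ℤ) : ℚ)) = if Odd k then of (u : ZMod p) else 0 := by
  rw [← residue_of_pow_mul k hu]
  push_cast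
  rfl

lemma rank_residue_pfister (hd : d ≠ 0) (ha : a ≠ 0) (hb : b ≠ 0) :
    rank (residue p (pfister d a b)) = 0 := by
  have hd : (d : ℚ) ≠ 0 := mod_cast hd
  have ha : (a : ℚ) ≠ 0 := mod_cast ha
  have hb : (b : ℚ) ≠ 0 := mod_cast hb
  simp only [pfister, map_add, map_sub, Int.cast_mul]
  rw [rank_residue_of hd, rank_residue_of (mul_ne_zero hd ha), rank_residue_of (mul_ne_zero hd hb),
    rank_residue_of (mul_ne_zero (mul_ne_zero hd ha) hb), padicValRat.mul (mul_ne_zero hd ha) hb,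
    padicValRat.mul hd ha, padicValRat.mul hd hb]
  push_cast
  ring

lemma residue_pfister_of_ne_zero (hp : p ≠ 2) (hd : d ≠ 0) (ha : (a : ZMod p) ≠ 0)
    (hb : (b : ZMod p) ≠ 0) : residue p (pfister d a b) = 0 := by
  obtain ⟨k, x, hx, rfl⟩ := exists_eq_pow_mul_intCast (p := p) hd
  simp only [pfister, map_add, map_sub, mul_assoc]
  rw [residue_of_intCast_pow_mul k hx, residue_of_intCast_pow_mul k (by simp [hx, ha]),
    residue_of_intCast_pow_mul k (by simp [hx, hb]),
    residue_of_intCast_pow_mul k (by simp [hx, ha, hb])]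
  split_ifs
  · have h := of_add_of_eq_of_add_of (by rwa [ZMod.ringChar_zmod_n]) (mul_ne_zero hx ha)
      (mul_ne_zero hx hb) hx
    have e : (x * (x * a) * (x * b) : ZMod p) = x * (a * b) * x ^ 2 := by ring
    rw [e, of_mul_sq _ hx] at h
    push_cast
    rw [sub_sub, h]
    abel
  · simp

lemma residue_pfister_of_prime_mul (hp : p ≠ 2) (hd : d ≠ 0) (ha : (a : ZMod p) ≠ 0)
    (hb : ¬ IsSquare (b : ZMod p)) {x : WittGroup (ZMod p)} (hx : rank x = 0) (hx₀ : x ≠ 0) :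
    residue p (pfister d (p * a) b) = x := by
  have hF : ringChar (ZMod p) ≠ 2 := by rwa [ZMod.ringChar_zmod_n]
  have hb₀ : (b : ZMod p) ≠ 0 := by
    intro h
    simp [h] at hb
  obtain ⟨k, y, hy, rfl⟩ := exists_eq_pow_mul_intCast (p := p) hd
  have e₁ : (p ^ k * y * (p * a) : ℤ) = p ^ (k + 1) * (y * a) := by ring
  have e₂ : (p ^ (k + 1) * (y * a) * b : ℤ) = p ^ (k + 1) * (y * a * b) := by ring
  simp only [pfister, map_add, map_sub, e₁, e₂]
  rw [mul_assoc _ y b, residue_of_intCast_pow_mul k hy,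
    residue_of_intCast_pow_mul _ (by simp [hy, ha]),
    residue_of_intCast_pow_mul k (by simp [hy, hb₀]),
    residue_of_intCast_pow_mul _ (by simp [hy, ha, hb₀])]
  by_cases hk : Odd k
  · have hk' : ¬ Odd (k + 1) := by simpa [parity_simps] using hk
    rw [eq_of_sub_of_rank_eq_zero hF hb hy hx hx₀]
    simp [hk, hk']
  · have hk' : Odd (k + 1) := by simpa [parity_simps] using hk
    rw [← neg_neg x, eq_of_sub_of_rank_eq_zero hF hb (mul_ne_zero hy ha) (x := -x)
      (by rw [map_neg, hx, neg_zero]) (neg_ne_zero.2 hx₀)]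
    simp [hk, hk', neg_add_eq_sub]

lemma residue_pfister_of_isSquare (hd : (d : ZMod p) ≠ 0) (ha : IsSquare (a : ZMod p))
    (ha₀ : (a : ZMod p) ≠ 0) (hb : (b : ZMod p) ≠ 0) :
    residue p (pfister d a (b * p)) = 0 := by
  have e₁ : d * (b * p) = p ^ 1 * (d * b) := by ring
  have e₂ : d * a * (b * p) = p ^ 1 * (d * b * a) := by ring
  simp only [pfister, map_add, map_sub, e₁, e₂]
  rw [residue_of_intCast hd, residue_of_intCast (by simp [hd, ha₀]),
    residue_of_intCast_pow_mul 1 (by simp [hd, hb]),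
    residue_of_intCast_pow_mul 1 (by simp [hd, hb, ha₀])]
  obtain ⟨c, hc⟩ := ha
  have hc₀ : c ≠ 0 := by
    rintro rfl
    simp [hc] at ha₀
  have e : of ((d * b * a : ℤ) : ZMod p) = of ((d * b : ℤ) : ZMod p) := by
    rw [← of_mul_sq ((d * b : ℤ) : ZMod p) hc₀, Int.cast_mul _ a, hc, sq]
  rw [e]
  simp

end

lemma exists_forall_residue_eq_zero (x : WittGroup ℚ) :
    ∃ n, ∀ (p : ℕ) [Fact p.Prime], n ≤ p → residue p x = 0 := by
  obtain ⟨n, -, hx⟩ := exists_mem_filtration x 0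
  refine ⟨n, fun p _ hp => ?_⟩
  induction hx using AddSubgroup.closure_induction with
  | zero => simp
  | add x y _ _ hx hy => simp [hx, hy]
  | neg x _ hx => simp [hx]
  | mem x hx =>
    obtain ⟨m, hm, rfl⟩ := hx
    obtain rfl | hm₀ := eq_or_ne m 0
    · simp
    · exact residue_of_intCast
        (intCast_ne_zero_of_mem_productsLT (productsLT_mono hp hm) hm₀)

/-- An element of the Witt group of `ℚ` whose residues have even rank is a scaled Pfister form with
any prescribed nonzero scalar compatible with its signature. -/
theorem exists_eq_pfister {x : WittGroup ℚ} (hx : ∀ (p : ℕ) [Fact p.Prime], rank (residue p x) = 0)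
    {d : ℤ} (hd : d ≠ 0) {σ : ℤ} (hσ : σ = 1 ∨ σ = -1) (hs : signature x = d.sign * (1 - σ) ^ 2) :
    ∃ a b : ℤ, x = pfister d a b := by
  classical
  obtain ⟨n, hn⟩ := exists_forall_residue_eq_zero x
  let S := (Finset.range n).filter fun p =>
    ∃ h : p.Prime, p ≠ 2 ∧ @residue p ⟨h⟩ x ≠ 0
  have hS (p : ℕ) (hp : p ∈ S) : p.Prime ∧ p ≠ 2 := by
    obtain ⟨-, h, h', -⟩ := Finset.mem_filter.1 hp
    exact ⟨h, h'⟩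
  obtain ⟨q, hqd, hq, hq4, hsq, hJ⟩ :=
    exists_prime_not_isSquare_and_jacobiSym_eq_one hσ hS d.natAbs
  set M : ℕ := ∏ p ∈ S, p
  have : Fact q.Prime := ⟨hq⟩
  have hσu {p : ℕ} [Fact p.Prime] : (σ : ZMod p) ≠ 0 := by obtain rfl | rfl := hσ <;> simp
  have hσs {m : ℤ} (hm : 0 < m) : (σ * m).sign = σ := by
    rw [Int.sign_mul, Int.sign_eq_one_of_pos hm, mul_one]
    obtain rfl | rfl := hσ <;> rfl
  have hM₀ : 0 < M := Finset.prod_pos fun p hp => (hS p hp).1.pos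
  have hσ₀ : σ ≠ 0 := by obtain rfl | rfl := hσ <;> simp
  refine ⟨σ * (2 * M), σ * q, ?_⟩
  rw [← sub_eq_zero]
  refine eq_zero_of_residue_eq_zero (fun p _ => ?_) ?_
  · have hp : p.Prime := Fact.out
    obtain rfl | hp2 := eq_or_ne p 2
    · refine eq_zero_of_rank_eq_zero ?_
      rw [map_sub, map_sub, hx, rank_residue_pfister hd, sub_zero]
      · exact mul_ne_zero hσ₀ (by positivity)
      · exact mul_ne_zero hσ₀ (mod_cast hq.ne_zero)
    have h2 : (2 : ZMod p) ≠ 0 := Ring.two_ne_zero (by rwa [ZMod.ringChar_zmod_n])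
    have hprod {T : Finset ℕ} (hT : T ⊆ S) (hpT : p ∉ T) : ((∏ r ∈ T, r : ℕ) : ZMod p) ≠ 0 := by
      rw [Ne, ZMod.natCast_eq_zero_iff, Prime.dvd_finsetProd_iff hp.prime]
      rintro ⟨r, hr, h⟩
      rw [Nat.prime_dvd_prime_iff_eq hp (hS r (hT hr)).1] at h
      exact hpT (h ▸ hr)
    rw [map_sub, sub_eq_zero]
    by_cases hpS : p ∈ S
    · obtain ⟨-, _, -, hxp⟩ := Finset.mem_filter.1 hpS
      have h : σ * (2 * M) = p * (σ * 2 * (∏ r ∈ S.erase p, r : ℕ)) := by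
        rw [show M = p * ∏ r ∈ S.erase p, r from (Finset.mul_prod_erase S _ hpS).symm]
        push_cast
        ring
      rw [h, residue_pfister_of_prime_mul hp2 hd _ (hsq p hpS) (hx p) hxp]
      rw [Int.cast_mul, Int.cast_mul, Int.cast_natCast]
      exact mul_ne_zero (mul_ne_zero hσu (by simpa)) (hprod (Finset.erase_subset ..) (by simp))
    have hxp : residue p x = 0 := by
      by_contra h
      exact hpS (Finset.mem_filter.2
        ⟨Finset.mem_range.2 (not_le.1 fun h' => h (hn p h')), hp, hp2, h⟩)
    have ha : ((σ * (2 * M) : ℤ) : ZMod p) ≠ 0 := by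
      have hM : (M : ZMod p) ≠ 0 := hprod subset_rfl hpS
      simp [h2, hσu, hM]
    rw [hxp, eq_comm]
    obtain rfl | hpq := eq_or_ne p q
    · refine residue_pfister_of_isSquare ?_ ?_ ha hσu
      · rw [Ne, ZMod.intCast_zmod_eq_zero_iff_dvd]
        exact fun h => hd (Int.eq_zero_of_dvd_of_natAbs_lt_natAbs h (by simpa using hqd))
      · rw [Int.cast_mul] at ha ⊢
        refine IsSquare.mul ?_ ?_
        · obtain rfl | rfl := hσ
          · simp
          · simpa using ZMod.exists_sq_eq_neg_one_iff.2 (by lia)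
        · rw [← legendreSym.eq_one_iff p (right_ne_zero_of_mul ha),
            jacobiSym.legendreSym.to_jacobiSym, hJ]
    · refine residue_pfister_of_ne_zero hp2 hd ha ?_
      rw [Int.cast_mul, Int.cast_natCast]
      refine mul_ne_zero hσu ?_
      rwa [Ne, ZMod.natCast_eq_zero_iff, Nat.prime_dvd_prime_iff_eq hp hq]
  · rw [map_sub, hs, signature_pfister (hσs (by positivity)) (hσs (mod_cast hq.pos)), sub_self]

/-- An isotropic diagonal form with nonzero coefficients is universal. -/
theorem exists_sum_mul_sq_eq {ι K : Type*} [Fintype ι] [Field K] (h2 : (2 : K) ≠ 0) {a x : ι → K}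
    (ha : ∀ i, a i ≠ 0) (hx : x ≠ 0) (h : ∑ i, a i * x i ^ 2 = 0) (b : K) :
    ∃ y : ι → K, ∑ i, a i * y i ^ 2 = b := by
  classical
  obtain ⟨i, hi⟩ := Function.ne_iff.1 hx
  have hi : x i ≠ 0 := hi
  set t := (b - a i) / (2 * a i * x i) with ht
  refine ⟨fun j => t * x j + Pi.single (M := fun _ => K) i 1 j, ?_⟩
  have key (j : ι) : a j * (t * x j + Pi.single (M := fun _ => K) i 1 j) ^ 2 =
      t ^ 2 * (a j * x j ^ 2) + if j = i then 2 * t * a j * x j + a j else 0 := by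
    by_cases hj : j = i
    · subst hj
      simp
      ring
    · simp [hj]
      ring
  have hai := ha i
  rw [Finset.sum_congr rfl fun j _ => key j, Finset.sum_add_distrib, ← Finset.mul_sum, h,
    Finset.sum_ite_eq' Finset.univ i, if_pos (Finset.mem_univ i), ht]
  field_simp
  ring

theorem mk_eq_sum {K : Type*} [Field K] (s : Multiset K) : mk s = (s.map of).sum := by
  induction s using Multiset.induction with
  | empty => simp
  | cons a s ih =>
    rw [← Multiset.singleton_add, map_add, ih, Multiset.map_add, Multiset.map_singleton,
      Multiset.sum_add, Multiset.sum_singleton, of]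

theorem exists_intCast_sign_eq {a : ℚ} (ha : a ≠ 0) :
    ∃ n : ℤ, n ≠ 0 ∧ of a = of (n : ℚ) ∧ n.sign = (SignType.sign a : ℤ) := by
  obtain ⟨n, hn⟩ := exists_of_intCast a
  have hs : n.sign = (SignType.sign a : ℤ) := by
    rw [← signature_of, hn, signature_of]
    rcases lt_trichotomy n 0 with h | rfl | h
    · simp [h, sign_neg]
    · simp
    · simp [h, sign_pos]
  refine ⟨n, ?_, hn, hs⟩
  rintro rfl
  rcases lt_or_gt_of_ne ha with h | h <;> simp [h, sign_neg, sign_pos] at hs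

/-- An indefinite diagonal form in five variables over `ℚ` is isotropic. -/
theorem exists_isotropic {a : Fin 5 → ℚ} (ha : ∀ i, a i ≠ 0) (hneg : a 0 * a 4 < 0) :
    ∃ x : Fin 5 → ℚ, x ≠ 0 ∧ ∑ i, a i * x i ^ 2 = 0 := by
  set D : ℚ := -∏ i, a i with hD
  have hprod : ∏ i, a i ≠ 0 := Finset.prod_ne_zero_iff.2 fun i _ => ha i
  have hD0 : D ≠ 0 := neg_ne_zero.2 hprod
  obtain ⟨d, hd, hDd, hsign⟩ := exists_intCast_sign_eq hD0
  have hres (p : ℕ) [Fact p.Prime] : rank (residue p (∑ i, of (a i) + of D)) = 0 := by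
    rw [map_add, map_add, map_sum, map_sum, rank_residue_of hD0]
    simp only [rank_residue_of (ha _)]
    rw [hD, padicValRat.neg]
    have : padicValRat p (∏ i, a i) = ∑ i, padicValRat p (a i) := by
      simp only [Fin.prod_univ_five, Fin.sum_univ_five]
      rw [padicValRat.mul, padicValRat.mul, padicValRat.mul, padicValRat.mul] <;> simp [ha]
    rw [this]
    push_cast
    exact CharTwo.add_self_eq_zero _
  obtain ⟨σ, hσ, hsig⟩ : ∃ σ : ℤ, (σ = 1 ∨ σ = -1) ∧
      signature (∑ i, of (a i) + of D) = d.sign * (1 - σ) ^ 2 := by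
    rw [map_add, map_sum, signature_of, hsign]
    have hneg' : (SignType.sign (a 0) : SignType) * SignType.sign (a 4) = -1 := by
      rw [← sign_mul, sign_neg hneg]
    have hs (i) : SignType.sign (a i) ≠ 0 := sign_ne_zero.2 (ha i)
    simp only [signature_of, hD, Left.sign_neg, Fin.sum_univ_five, Fin.prod_univ_five, sign_mul]
    have h0 := hs 0
    have h1 := hs 1
    have h2 := hs 2
    have h3 := hs 3
    have h4 := hs 4
    generalize SignType.sign (a 0) = s0 at *
    generalize SignType.sign (a 1) = s1 at *
    generalize SignType.sign (a 2) = s2 at *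
    generalize SignType.sign (a 3) = s3 at *
    generalize SignType.sign (a 4) = s4 at *
    suffices (((s0 : ℤ) + s1 + s2 + s3 + s4 + ((-(s0 * s1 * s2 * s3 * s4) : SignType) : ℤ) =
      ((-(s0 * s1 * s2 * s3 * s4) : SignType) : ℤ) * (1 - 1) ^ 2) ∨
      ((s0 : ℤ) + s1 + s2 + s3 + s4 + ((-(s0 * s1 * s2 * s3 * s4) : SignType) : ℤ) =
      ((-(s0 * s1 * s2 * s3 * s4) : SignType) : ℤ) * (1 - -1) ^ 2)) by
      rcases this with h | h
      exacts [⟨1, .inl rfl, h⟩, ⟨-1, .inr rfl, h⟩]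
    clear hs hsign
    revert s0 s1 s2 s3 s4
    decide
  obtain ⟨e, f, hef⟩ := exists_eq_pfister hres hd hσ hsig
  set w : Fin 5 ⊕ Fin 3 → ℚ :=
    Sum.elim a ![((d * e : ℤ) : ℚ), ((d * f : ℤ) : ℚ), -((d * e * f : ℤ) : ℚ)] with hw
  have hzero : mk (Finset.univ.val.map w) = 0 := by
    rw [mk_eq_sum, Multiset.map_map]
    change ∑ i, of (w i) = 0
    rw [Fintype.sum_sum_type]
    simp only [hw, Sum.elim_inl, Sum.elim_inr, Fin.sum_univ_three, Matrix.cons_val, of_neg]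
    rw [hDd, pfister] at hef
    rw [eq_sub_of_add_eq hef]
    abel
  obtain ⟨N, hN, hcard⟩ :=
    (Multiset.IsMetabolic.map_univ_iff w).1 (isMetabolic_of_mk_eq_zero two_ne_zero hzero)
  have hfin : 4 ≤ Module.finrank ℚ N := by
    rw [Nat.card_eq_fintype_card] at hcard
    simp only [Fintype.card_sum, Fintype.card_fin] at hcard
    lia
  have hker : LinearMap.ker ((LinearMap.funLeft ℚ ℚ (Sum.inr : Fin 3 → Fin 5 ⊕ Fin 3)).comp
      N.subtype) ≠ ⊥ := by
    apply LinearMap.ker_ne_bot_of_finrank_lt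
    simp
    lia
  obtain ⟨v, hv, hv0⟩ := Submodule.exists_mem_ne_zero_of_ne_bot hker
  have hinr (j : Fin 3) : (v : Fin 5 ⊕ Fin 3 → ℚ) (Sum.inr j) = 0 := congrFun hv j
  refine ⟨fun i => (v : Fin 5 ⊕ Fin 3 → ℚ) (Sum.inl i), fun h => hv0 ?_, ?_⟩
  · ext (i | j)
    exacts [congrFun h i, hinr j]
  · have := hN v v.2
    rw [Fintype.sum_sum_type] at this
    simpa [hinr, hw] using this

end WittGroup

/-- The arithmetic core of Example A.1: for any nonzero rationals `a₁,…,a₅` there are a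
sign `ε ∈ {1, -1}`, rationals `x₁,…,x₄` and a nonzero rational `c` with
`a₁x₁² + a₂x₂² + a₃x₃² + a₄x₄² = ε a₅ c²`. -/
theorem exists_sign_and_rational_representation (a₁ a₂ a₃ a₄ a₅ : ℚ)
    (h₁ : a₁ ≠ 0) (h₂ : a₂ ≠ 0) (h₃ : a₃ ≠ 0) (h₄ : a₄ ≠ 0) (h₅ : a₅ ≠ 0) :
    ∃ ε : ℚ, (ε = 1 ∨ ε = -1) ∧
      ∃ x₁ x₂ x₃ x₄ c : ℚ, c ≠ 0 ∧
        a₁ * x₁ ^ 2 + a₂ * x₂ ^ 2 + a₃ * x₃ ^ 2 + a₄ * x₄ ^ 2 = ε * a₅ * c ^ 2 := by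
  obtain ⟨ε, hε, hpos⟩ : ∃ ε : ℚ, (ε = 1 ∨ ε = -1) ∧ 0 < a₁ * (ε * a₅) := by
    rcases lt_or_gt_of_ne (mul_ne_zero h₁ h₅) with h | h
    · exact ⟨-1, .inr rfl, by linarith⟩
    · exact ⟨1, .inl rfl, by linarith⟩
  refine ⟨ε, hε, ?_⟩
  have hε0 : ε ≠ 0 := by rcases hε with rfl | rfl <;> norm_num
  obtain ⟨x, hx, h⟩ := WittGroup.exists_isotropic (a := ![a₁, a₂, a₃, a₄, -(ε * a₅)])
    (by simp [Fin.forall_fin_succ, *]) (by simpa using hpos)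
  simp only [Fin.sum_univ_five, Matrix.cons_val] at h
  by_cases hx4 : x 4 = 0
  · have hx' : ![x 0, x 1, x 2, x 3] ≠ 0 := by
      intro h'
      apply hx
      ext i
      have h0 := congrFun h' 0
      have h1 := congrFun h' 1
      have h2 := congrFun h' 2
      have h3 := congrFun h' 3
      fin_cases i
      exacts [h0, h1, h2, h3, hx4]
    obtain ⟨y, hy⟩ := WittGroup.exists_sum_mul_sq_eq two_ne_zero (a := ![a₁, a₂, a₃, a₄])
      (by simp [Fin.forall_fin_succ, *]) hx' (by simpa [Fin.sum_univ_four, hx4] using h) (ε * a₅)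
    simp only [Fin.sum_univ_four, Matrix.cons_val] at hy
    exact ⟨y 0, y 1, y 2, y 3, 1, one_ne_zero, by linarith⟩
  · exact ⟨x 0, x 1, x 2, x 3, x 4, hx4, by linarith⟩
end
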